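/- Fix τ > 2 and α ∈ DC_τ. Let ψ : ℝ/ℤ → ℝ satisfy condition (V) and sup ψ − inf ψ < π, and for λ > 0, θ ∈ ℝ let B^{(θ,λ)}(x) = diag(λ, λ⁻¹)·R_{ψ(x)}·R_θ. Then there exists λ₀ = λ₀(α, ψ) such that for all λ > λ₀ and all θ ∈ ℝ, the Lyapunov exponent L(α, θ, λ) := lim_{n→∞} (1/n) ∫_{ℝ/ℤ} log‖B^{(θ,λ)}_n(x)‖ dx exists and satisfies L(α, θ, λ) > (99/100)·log λ. -/

import Mathlib

open scoped Real
open Matrix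

noncomputable section

/-- 2×2 real matrices. -/
abbrev M2 : Type := Matrix (Fin 2) (Fin 2) ℝ

/-- Rotation matrix by angle θ. -/
def rot (θ : ℝ) : M2 := !![Real.cos θ, -Real.sin θ; Real.sin θ, Real.cos θ]

/-- Euclidean norm of a vector in ℝ². -/
def vnorm (w : Fin 2 → ℝ) : ℝ := ‖(WithLp.equiv 2 (Fin 2 → ℝ)).symm w‖

/-- Operator norm of a 2×2 real matrix acting on Euclidean ℝ². -/
def opNorm (A : M2) : ℝ := ‖Matrix.toEuclideanCLM (𝕜 := ℝ) A‖

/-- Forward iterates B_n(x) = B(x+(n-1)β)⋯B(x+β)B(x). -/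
def fwdIter (β : ℝ) (B : ℝ → M2) : ℕ → ℝ → M2
  | 0, _ => 1
  | n + 1, x => B (x + n * β) * fwdIter β B n x

/-- Cocycle iterates indexed by ℤ: B₀ = Id, B_n for n ≥ 1 as above, and
B_n(x) = [B_{-n}(x+nβ)]⁻¹ for n ≤ -1. -/
def cocycleIter (β : ℝ) (B : ℝ → M2) (n : ℤ) (x : ℝ) : M2 :=
  if 0 ≤ n then fwdIter β B n.toNat x else (fwdIter β B (-n).toNat (x + (n : ℝ) * β))⁻¹

/-- Uniform hyperbolicity of the cocycle (β, B) over the circle ℝ/ℤ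
(B is understood as a 1-periodic function of x): there are invariant 1-periodic line fields
s̄ (stable) and ū (unstable) with uniform exponential contraction forwards resp. backwards. -/
def IsUH (β : ℝ) (B : ℝ → M2) : Prop :=
  ∃ (s u : ℝ → Submodule ℝ (Fin 2 → ℝ)) (c ρ : ℝ),
    0 < c ∧ 1 < ρ ∧
    (∀ x, Module.finrank ℝ (s x) = 1 ∧ Module.finrank ℝ (u x) = 1) ∧
    (∀ x, s (x + 1) = s x ∧ u (x + 1) = u x) ∧
    (∀ x, (s x).map (Matrix.toLin' (B x)) = s (x + β) ∧
          (u x).map (Matrix.toLin' (B x)) = u (x + β)) ∧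
    (∀ x, ∀ n : ℕ, 1 ≤ n →
      (∀ w : Fin 2 → ℝ, w ∈ s x → vnorm w = 1 →
        vnorm ((cocycleIter β B n x) *ᵥ w) < c / ρ ^ n) ∧
      (∀ w : Fin 2 → ℝ, w ∈ u x → vnorm w = 1 →
        vnorm ((cocycleIter β B (-(n : ℤ)) x) *ᵥ w) < c / ρ ^ n))

/-- The Diophantine condition DC_{τ,γ}. -/
def DCwith (τ γ α : ℝ) : Prop :=
  ∀ p q : ℤ, q ≠ 0 → γ / |(q : ℝ)| ^ τ ≤ |α - (p : ℝ) / (q : ℝ)|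

/-- The Diophantine condition DC_τ = ∪_{γ>0} DC_{τ,γ}. -/
def DC (τ α : ℝ) : Prop := ∃ γ > 0, DCwith τ γ α

/-- Condition (V) for a 1-periodic potential: C², the derivative vanishes at exactly two
points of the circle, one a global minimum and the other a global maximum, both
non-degenerate. -/
def ConditionV (v : ℝ → ℝ) : Prop :=
  ContDiff ℝ 2 v ∧
  ∃ z₁ z₂ : ℝ, z₁ ∈ Set.Ico (0 : ℝ) 1 ∧ z₂ ∈ Set.Ico (0 : ℝ) 1 ∧ z₁ ≠ z₂ ∧
    (∀ x ∈ Set.Ico (0 : ℝ) 1, deriv v x = 0 ↔ x = z₁ ∨ x = z₂) ∧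
    (∀ x, v z₁ ≤ v x) ∧ (∀ x, v x ≤ v z₂) ∧
    iteratedDeriv 2 v z₁ ≠ 0 ∧ iteratedDeriv 2 v z₂ ≠ 0

/-- The Schrödinger cocycle map A^{(E-λv)}. -/
def schCocycle (lam : ℝ) (v : ℝ → ℝ) (E : ℝ) (x : ℝ) : M2 :=
  !![E - lam * v x, -1; 1, 0]

/-- The one-parameter family of cocycle maps B^{(θ,λ)}(x) = diag(λ, λ⁻¹)·R_{ψ(x)}·R_θ. -/
def rotFamily (lam θ : ℝ) (ψ : ℝ → ℝ) (x : ℝ) : M2 :=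
  Matrix.diagonal ![lam, lam⁻¹] * rot (ψ x) * rot θ

namespace LargeCoupling

open Filter Topology

/-! ### Weighted second order jets -/

/-- The weighted norm, with weight `h`, of the second order Taylor jet of `f` at `x` is at
most `K`. -/
def JetBound (h : ℝ) (f : ℝ → ℝ) (x K : ℝ) : Prop :=
  (∀ᶠ y in 𝓝 x, DifferentiableAt ℝ f y) ∧ DifferentiableAt ℝ (deriv f) x ∧
    |f x| + h * |deriv f x| + h ^ 2 / 2 * |deriv (deriv f) x| ≤ K

namespace JetBound

variable {h h' x K L : ℝ} {f g : ℝ → ℝ}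

theorem of_hasDerivAt {f1 : ℝ → ℝ} {a2 : ℝ} (h1 : ∀ᶠ y in 𝓝 x, HasDerivAt f (f1 y) y)
    (h2 : HasDerivAt f1 a2 x) (hK : |f x| + h * |f1 x| + h ^ 2 / 2 * |a2| ≤ K) :
    JetBound h f x K := by
  have he : deriv f =ᶠ[𝓝 x] f1 := h1.mono fun y hy => hy.deriv
  have h3 : HasDerivAt (deriv f) a2 x := h2.congr_of_eventuallyEq he
  refine ⟨h1.mono fun y hy => hy.differentiableAt, h3.differentiableAt, ?_⟩
  rw [h3.deriv, he.eq_of_nhds]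
  exact hK

theorem hasDerivAt (H : JetBound h f x K) : ∀ᶠ y in 𝓝 x, HasDerivAt f (deriv f y) y :=
  H.1.mono fun _ hy => hy.hasDerivAt

theorem hasDerivAt_self (H : JetBound h f x K) : HasDerivAt f (deriv f x) x :=
  H.hasDerivAt.self_of_nhds

theorem hasDerivAt_deriv (H : JetBound h f x K) :
    HasDerivAt (deriv f) (deriv (deriv f) x) x := H.2.1.hasDerivAt

theorem continuousAt (H : JetBound h f x K) : ContinuousAt f x :=
  H.hasDerivAt_self.continuousAt

theorem mono (H : JetBound h f x K) (hKL : K ≤ L) : JetBound h f x L :=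
  ⟨H.1, H.2.1, H.2.2.trans hKL⟩

theorem mono_weight (H : JetBound h f x K) (h0 : 0 ≤ h') (hh : h' ≤ h) :
    JetBound h' f x K := by
  refine ⟨H.1, H.2.1, le_trans ?_ H.2.2⟩
  gcongr

theorem congr (H : JetBound h f x K) (e : f =ᶠ[𝓝 x] g) : JetBound h g x K := by
  have e1 : deriv f =ᶠ[𝓝 x] deriv g := e.deriv
  refine ⟨?_, ?_, ?_⟩
  · filter_upwards [H.1, e.eventuallyEq_nhds] with y hy hy'
    exact hy.congr_of_eventuallyEq hy'.symm
  · exact H.2.1.congr_of_eventuallyEq e1.symm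
  · rw [← e.eq_of_nhds, ← e1.eq_of_nhds, ← e1.deriv_eq]
    exact H.2.2

theorem abs_le (H : JetBound h f x K) (h0 : 0 ≤ h) : |f x| ≤ K := by
  refine le_trans ?_ H.2.2
  have := mul_nonneg h0 (abs_nonneg (deriv f x))
  have := mul_nonneg (by positivity : 0 ≤ h ^ 2 / 2) (abs_nonneg (deriv (deriv f) x))
  linarith

theorem nonneg (H : JetBound h f x K) (h0 : 0 ≤ h) : 0 ≤ K :=
  (abs_nonneg _).trans (H.abs_le h0)

theorem abs_deriv_le (H : JetBound h f x K) (h0 : 0 < h) : |deriv f x| ≤ K / h := by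
  rw [le_div_iff₀ h0]
  have := H.2.2
  have := abs_nonneg (f x)
  have := mul_nonneg (by positivity : 0 ≤ h ^ 2 / 2) (abs_nonneg (deriv (deriv f) x))
  linarith

theorem abs_deriv2_le (H : JetBound h f x K) (h0 : 0 < h) :
    |deriv (deriv f) x| ≤ 2 * K / h ^ 2 := by
  rw [le_div_iff₀ (by positivity)]
  have := H.2.2
  have := abs_nonneg (f x)
  have := mul_nonneg h0.le (abs_nonneg (deriv f x))
  linarith

/-- Decreasing the weight makes the jet nearly constant. -/
theorem shrink (H : JetBound h f x K) (h0 : 0 < h) (h0' : 0 ≤ h') (hh : h' ≤ h) :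
    JetBound h' f x (|f x| + h' / h * K) := by
  refine ⟨H.1, H.2.1, ?_⟩
  have e := H.2.2
  have e0 := abs_nonneg (f x)
  have e1 := abs_nonneg (deriv f x)
  have e2 := abs_nonneg (deriv (deriv f) x)
  have hr : h' / h ≤ 1 := (div_le_one h0).2 hh
  have hr0 : 0 ≤ h' / h := by positivity
  have i1 : h' * |deriv f x| = h' / h * (h * |deriv f x|) := by field_simp
  have i2 : h' ^ 2 / 2 * |deriv (deriv f) x|
      ≤ h' / h * (h ^ 2 / 2 * |deriv (deriv f) x|) := by
    have : h' / h * (h ^ 2 / 2 * |deriv (deriv f) x|)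
      = h' * h / 2 * |deriv (deriv f) x| := by field_simp
    rw [this]
    gcongr
    nlinarith
  have i3 : h' / h * (h * |deriv f x|) + h' / h * (h ^ 2 / 2 * |deriv (deriv f) x|)
      ≤ h' / h * K := by
    rw [← mul_add]
    gcongr
    linarith
  linarith

theorem const (c : ℝ) : JetBound h (fun _ => c) x |c| := by
  refine of_hasDerivAt (f1 := fun _ => 0) (a2 := 0)
    (Eventually.of_forall fun y => hasDerivAt_const y c) (hasDerivAt_const x _) (by simp)

theorem neg (H : JetBound h f x K) : JetBound h (fun y => -f y) x K :=
  of_hasDerivAt (H.hasDerivAt.mono fun _ hy => hy.fun_neg) H.hasDerivAt_deriv.fun_neg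
    (by simpa only [abs_neg] using H.2.2)

theorem add (Hf : JetBound h f x K) (Hg : JetBound h g x L) (h0 : 0 ≤ h) :
    JetBound h (fun y => f y + g y) x (K + L) := by
  refine of_hasDerivAt (f1 := fun y => deriv f y + deriv g y)
    (Hf.hasDerivAt.and Hg.hasDerivAt |>.mono fun y hy => hy.1.fun_add hy.2)
    (Hf.hasDerivAt_deriv.fun_add Hg.hasDerivAt_deriv) ?_
  have := Hf.2.2
  have := Hg.2.2
  have a0 := abs_add_le (f x) (g x)
  have a1 := mul_le_mul_of_nonneg_left (abs_add_le (deriv f x) (deriv g x)) h0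
  have a2 := mul_le_mul_of_nonneg_left (abs_add_le (deriv (deriv f) x) (deriv (deriv g) x))
    (by positivity : 0 ≤ h ^ 2 / 2)
  linarith

theorem sub (Hf : JetBound h f x K) (Hg : JetBound h g x L) (h0 : 0 ≤ h) :
    JetBound h (fun y => f y - g y) x (K + L) := by
  simpa only [sub_eq_add_neg] using Hf.add Hg.neg h0

theorem mul (Hf : JetBound h f x K) (Hg : JetBound h g x L) (h0 : 0 ≤ h) :
    JetBound h (fun y => f y * g y) x (K * L) := by
  refine of_hasDerivAt (f1 := fun y => deriv f y * g y + f y * deriv g y)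
    (Hf.hasDerivAt.and Hg.hasDerivAt |>.mono fun y hy => hy.1.fun_mul hy.2)
    ((Hf.hasDerivAt_deriv.fun_mul Hg.hasDerivAt_self).fun_add
      (Hf.hasDerivAt_self.fun_mul Hg.hasDerivAt_deriv)) ?_
  have hK := Hf.2.2
  have hL := Hg.2.2
  have hK0 := Hf.nonneg h0
  refine le_trans ?_ (mul_le_mul hK hL (by positivity) hK0)
  have a1 : |deriv f x * g x + f x * deriv g x|
      ≤ |deriv f x| * |g x| + |f x| * |deriv g x| := by
    rw [← abs_mul, ← abs_mul]; exact abs_add_le _ _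
  have a2 : |deriv (deriv f) x * g x + deriv f x * deriv g x
      + (deriv f x * deriv g x + f x * deriv (deriv g) x)|
      ≤ |deriv (deriv f) x| * |g x| + 2 * (|deriv f x| * |deriv g x|)
        + |f x| * |deriv (deriv g) x| := by
    rw [← abs_mul, ← abs_mul, ← abs_mul]
    refine (abs_add_le _ _).trans ?_
    have := abs_add_le (deriv (deriv f) x * g x) (deriv f x * deriv g x)
    have := abs_add_le (deriv f x * deriv g x) (f x * deriv (deriv g) x)
    linarith
  have b1 := mul_le_mul_of_nonneg_left a1 h0
  have b2 := mul_le_mul_of_nonneg_left a2 (by positivity : 0 ≤ h ^ 2 / 2)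
  rw [abs_mul]
  have c0 : 0 ≤ h ^ 3 / 2 * (|deriv f x| * |deriv (deriv g) x|) := by positivity
  have c1 : 0 ≤ h ^ 3 / 2 * (|deriv (deriv f) x| * |deriv g x|) := by positivity
  have c2 : 0 ≤ h ^ 4 / 4 * (|deriv (deriv f) x| * |deriv (deriv g) x|) := by positivity
  nlinarith

/-- Inversion of a jet which is dominated by its value. -/
theorem inv {e : ℝ} (H : JetBound h f x (|f x| + e / 2)) (h0 : 0 ≤ h) (he : 0 < e)
    (hf : e ≤ |f x|) : JetBound h (fun y => (f y)⁻¹) x (2 / e) := by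
  have hfx : f x ≠ 0 := by
    intro h0; rw [h0, abs_zero] at hf; linarith
  have hne : ∀ᶠ y in 𝓝 x, f y ≠ 0 := H.continuousAt.eventually_ne hfx
  have hd : HasDerivAt (fun y => -deriv f y / f y ^ 2)
      ((-deriv (deriv f) x * f x ^ 2 - -deriv f x * (2 * f x * deriv f x)) / (f x ^ 2) ^ 2) x := by
    have := (H.hasDerivAt_deriv.fun_neg).fun_div (H.hasDerivAt_self.fun_pow 2)
      (pow_ne_zero 2 hfx)
    simpa using this
  refine of_hasDerivAt (f1 := fun y => -deriv f y / f y ^ 2) ?_ hd ?_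
  · filter_upwards [H.hasDerivAt, hne] with y hy hy'
    exact hy.fun_inv hy'
  · set A := |f x| with hA
    set B := |deriv f x|
    set D := |deriv (deriv f) x|
    have hA0 : 0 < A := he.trans_le hf
    have hB0 : 0 ≤ B := abs_nonneg _
    have hD0 : 0 ≤ D := abs_nonneg _
    have hs : h * B + h ^ 2 / 2 * D ≤ e / 2 := by have := H.2.2; linarith
    have e1 : |(f x)⁻¹| = 1 / A := by rw [abs_inv, one_div]
    have e2 : |-deriv f x / f x ^ 2| = B / A ^ 2 := by
      rw [abs_div, abs_neg, abs_pow]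
    have e3 : |(-deriv (deriv f) x * f x ^ 2 - -deriv f x * (2 * f x * deriv f x))
        / (f x ^ 2) ^ 2| ≤ D / A ^ 2 + 2 * B ^ 2 / A ^ 3 := by
      have : (-deriv (deriv f) x * f x ^ 2 - -deriv f x * (2 * f x * deriv f x))
        / (f x ^ 2) ^ 2 = -deriv (deriv f) x / f x ^ 2 + 2 * deriv f x ^ 2 / f x ^ 3 := by
        field_simp
        ring
      rw [this]
      refine (abs_add_le _ _).trans (le_of_eq ?_)
      rw [abs_div, abs_div, abs_neg, abs_pow, abs_pow, abs_mul, abs_pow, abs_two]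
    rw [e1]
    change 1 / A + h * |-deriv f x / f x ^ 2| + _ ≤ _
    rw [e2]
    set u := h * B with hu
    set v := h ^ 2 / 2 * D with hv
    have hu0 : 0 ≤ u := by positivity
    have hv0 : 0 ≤ v := by positivity
    calc 1 / A + h * (B / A ^ 2) + h ^ 2 / 2 * _
        ≤ 1 / A + h * (B / A ^ 2) + h ^ 2 / 2 * (D / A ^ 2 + 2 * B ^ 2 / A ^ 3) := by gcongr
      _ = 1 / A + (u + v) / A ^ 2 + u ^ 2 / A ^ 3 := by rw [hu, hv]; ring
      _ ≤ 1 / e + (e / 2) / e ^ 2 + (e / 2) ^ 2 / e ^ 3 := by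
          gcongr
          linarith
      _ ≤ 2 / e := by
          have : 1 / e + (e / 2) / e ^ 2 + (e / 2) ^ 2 / e ^ 3 = (7 / 4) / e := by
            field_simp
            ring
          rw [this]; gcongr; norm_num

theorem comp_add_const {a : ℝ} (H : JetBound h f (x + a) K) :
    JetBound h (fun y => f (y + a)) x K := by
  refine of_hasDerivAt (f1 := fun y => deriv f (y + a)) ?_ (H.hasDerivAt_deriv.comp_add_const x a)
    H.2.2
  have : Tendsto (fun y => y + a) (𝓝 x) (𝓝 (x + a)) :=
    (continuous_id.add continuous_const).tendsto x
  exact (this.eventually H.hasDerivAt).mono fun y hy => hy.comp_add_const y a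

theorem of_sub {e : ℝ} (H : JetBound h f x K) (He : JetBound h (fun y => g y - f y) x e)
    (h0 : 0 ≤ h) : JetBound h g x (K + e) := by
  simpa using H.add He h0

end JetBound

/-! ### Distance to the integers -/

/-- The distance of a real number to the integers. -/
def nd (x : ℝ) : ℝ := ‖(x : UnitAddCircle)‖

theorem nd_eq (x : ℝ) : nd x = |x - round x| := UnitAddCircle.norm_eq

theorem nd_nonneg (x : ℝ) : 0 ≤ nd x := norm_nonneg _

theorem nd_neg (x : ℝ) : nd (-x) = nd x := by
  simp [nd]

theorem nd_sub_comm (x y : ℝ) : nd (x - y) = nd (y - x) := by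
  rw [← nd_neg, neg_sub]

theorem nd_add_le (x y : ℝ) : nd (x + y) ≤ nd x + nd y := by
  simpa [nd, AddCircle.coe_add] using norm_add_le (x : UnitAddCircle) (y : UnitAddCircle)

theorem nd_le_abs (x : ℝ) : nd x ≤ |x| := by
  rw [nd_eq]
  simpa using round_le x 0

theorem nd_sub_int (x : ℝ) (m : ℤ) : nd (x - m) = nd x := by
  rw [nd_eq, nd_eq, round_sub_intCast]
  push_cast
  ring_nf

theorem nd_le_abs_sub_int (x : ℝ) (m : ℤ) : nd x ≤ |x - m| := by
  rw [← nd_sub_int x m]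
  exact nd_le_abs _

theorem exists_int_abs_eq_nd (x : ℝ) : ∃ m : ℤ, |x - m| = nd x := ⟨round x, (nd_eq x).symm⟩

theorem nd_sub_triangle (x y z : ℝ) : nd (x - z) ≤ nd (x - y) + nd (y - z) := by
  have := nd_add_le (x - y) (y - z)
  simpa using this

theorem nd_le_half (x : ℝ) : nd x ≤ 1 / 2 := by
  rw [nd_eq]
  exact abs_sub_round x

theorem continuous_nd : Continuous nd :=
  continuous_norm.comp (AddCircle.continuous_mk' 1)

/-! ### The cocycle and its blocks -/

/-- The data of a rotation number, a coupling and a periodic phase. -/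
structure Sys where
  /-- the rotation number -/
  α : ℝ
  /-- the coupling -/
  lam : ℝ
  /-- the phase -/
  φ : ℝ → ℝ
  lam_pos : 0 < lam
  periodic : Function.Periodic φ 1

theorem rot_mul_rot (a b : ℝ) : rot a * rot b = rot (a + b) := by
  ext i j
  fin_cases i <;> fin_cases j <;>
    simp [rot, Matrix.mul_apply, Fin.sum_univ_two, Real.cos_add, Real.sin_add] <;> ring

theorem rot_zero : rot 0 = 1 := by
  ext i j
  fin_cases i <;> fin_cases j <;> simp [rot]

theorem det_rot (a : ℝ) : (rot a).det = 1 := by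
  simp [rot, Matrix.det_fin_two, ← sq]

theorem fwdIter_add (α : ℝ) (B : ℝ → M2) (m n : ℕ) (x : ℝ) :
    fwdIter α B (m + n) x = fwdIter α B m (x + n * α) * fwdIter α B n x := by
  induction m with
  | zero => simp [fwdIter]
  | succ m ih =>
    rw [Nat.succ_add_eq_add_succ, Nat.add_succ, fwdIter, fwdIter, ih, Matrix.mul_assoc]
    congr 2
    push_cast
    ring

theorem fwdIter_periodic (α : ℝ) {B : ℝ → M2} (hB : Function.Periodic B 1) (n : ℕ) :
    Function.Periodic (fwdIter α B n) 1 := by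
  induction n with
  | zero => intro x; rfl
  | succ n ih =>
    intro x
    rw [fwdIter, fwdIter, ih x, add_right_comm, hB]

theorem det_fwdIter (α : ℝ) {B : ℝ → M2} (hB : ∀ x, (B x).det = 1) (n : ℕ) (x : ℝ) :
    (fwdIter α B n x).det = 1 := by
  induction n with
  | zero => simp [fwdIter]
  | succ n ih => rw [fwdIter, Matrix.det_mul, hB, ih, one_mul]

namespace Sys

variable (S : Sys)

/-- The generator of the cocycle. -/
def gen (x : ℝ) : M2 := Matrix.diagonal ![S.lam, S.lam⁻¹] * rot (S.φ x)

/-- The iterates of the cocycle. -/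
def W (n : ℕ) (x : ℝ) : M2 := fwdIter S.α S.gen n x

/-- The iterates of the cocycle, with the first rotation removed. -/
def P (n : ℕ) (x : ℝ) : M2 := S.W n x * rot (-S.φ x)

/-- The iterates of the cocycle, with one more rotation applied. -/
def Q (k : ℕ) (x : ℝ) : M2 := rot (S.φ (x + k * S.α)) * S.W k x

/-- The upper left entry of `P`. -/
def a (n : ℕ) (x : ℝ) : ℝ := S.P n x 0 0

/-- The normalised lower left entry of `P`. -/
def y (n : ℕ) (x : ℝ) : ℝ := S.P n x 1 0 / S.P n x 0 0

/-- Minus the normalised upper right entry of `P`. -/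
def w (n : ℕ) (x : ℝ) : ℝ := -S.P n x 0 1 / S.P n x 0 0

theorem gen_periodic : Function.Periodic S.gen 1 := fun x => by
  rw [gen, gen, S.periodic]

theorem det_gen (x : ℝ) : (S.gen x).det = 1 := by
  rw [gen, Matrix.det_mul, det_rot, Matrix.det_diagonal]
  simp [S.lam_pos.ne']

theorem W_add (m n : ℕ) (x : ℝ) : S.W (m + n) x = S.W m (x + n * S.α) * S.W n x :=
  fwdIter_add _ _ _ _ _

theorem W_periodic (n : ℕ) : Function.Periodic (S.W n) 1 := fwdIter_periodic _ S.gen_periodic n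

theorem det_W (n : ℕ) (x : ℝ) : (S.W n x).det = 1 := det_fwdIter _ S.det_gen n x

theorem P_periodic (n : ℕ) : Function.Periodic (S.P n) 1 := fun x => by
  rw [P, P, S.W_periodic, S.periodic]

theorem Q_periodic (k : ℕ) : Function.Periodic (S.Q k) 1 := fun x => by
  rw [Q, Q, S.W_periodic, add_right_comm, S.periodic]

theorem a_periodic (n : ℕ) : Function.Periodic (S.a n) 1 := fun x => by
  rw [a, a, S.P_periodic]

theorem y_periodic (n : ℕ) : Function.Periodic (S.y n) 1 := fun x => by
  rw [y, y, S.P_periodic]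

theorem w_periodic (n : ℕ) : Function.Periodic (S.w n) 1 := fun x => by
  rw [w, w, S.P_periodic]

theorem det_P (n : ℕ) (x : ℝ) : (S.P n x).det = 1 := by
  rw [P, Matrix.det_mul, S.det_W, det_rot, one_mul]

theorem P_mul_rot (n : ℕ) (x : ℝ) : S.P n x * rot (S.φ x) = S.W n x := by
  rw [P, Matrix.mul_assoc, rot_mul_rot, neg_add_cancel, rot_zero, Matrix.mul_one]

theorem P_joint (n₁ k n₂ : ℕ) (x : ℝ) :
    S.P (n₁ + k + n₂) x =
      S.P n₂ (x + n₁ * S.α + k * S.α) * S.Q k (x + n₁ * S.α) * S.P n₁ x := by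
  rw [Q, ← Matrix.mul_assoc, P_mul_rot, P, P, add_comm (n₁ + k) n₂, W_add, add_comm n₁ k, W_add]
  simp only [Matrix.mul_assoc]
  congr 2
  push_cast
  ring

theorem Q_joint (k l : ℕ) (x : ℝ) :
    S.Q (k + (k + l)) x =
      S.Q k (x + (k + l : ℕ) * S.α) * S.P l (x + k * S.α) * S.Q k x := by
  have h1 : S.P l (x + k * S.α) * S.Q k x = S.W (l + k) x := by
    rw [Q, ← Matrix.mul_assoc, P_mul_rot, W_add]
  rw [Matrix.mul_assoc, h1, Q, Q, W_add S k (k + l), add_comm l k, Matrix.mul_assoc]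
  congr 3
  push_cast
  ring

theorem P_one (x : ℝ) : S.P 1 x = Matrix.diagonal ![S.lam, S.lam⁻¹] := by
  simp [P, W, fwdIter, gen, Matrix.mul_assoc, rot_mul_rot, rot_zero]

/-- The entry of the joint of two blocks. -/
def joint (q : ℝ → M2) (k i j : ℕ) (x : ℝ) : ℝ :=
  q x 0 0 + q x 0 1 * S.y i (x - i * S.α) - S.w j (x + k * S.α) * q x 1 0
    - S.w j (x + k * S.α) * (q x 1 1 * S.y i (x - i * S.α))

theorem joint_add (q : ℝ → M2) (k i j : ℕ) (x : ℝ) :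
    S.joint q k i j (x + i * S.α) =
      q (x + i * S.α) 0 0 + q (x + i * S.α) 0 1 * S.y i x
        - S.w j (x + i * S.α + k * S.α) * q (x + i * S.α) 1 0
        - S.w j (x + i * S.α + k * S.α) * (q (x + i * S.α) 1 1 * S.y i x) := by
  simp only [joint, add_sub_cancel_right]

theorem joint_periodic {q : ℝ → M2} (hq : Function.Periodic q 1) (k i j : ℕ) :
    Function.Periodic (S.joint q k i j) 1 := fun x => by
  have h1 : x + 1 - i * S.α = x - i * S.α + 1 := by ring
  have h2 : x + 1 + k * S.α = x + k * S.α + 1 := by ring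
  simp only [joint, hq x, h1, h2, S.y_periodic _ (x - i * S.α), S.w_periodic _ (x + k * S.α)]

theorem entry_eq {n : ℕ} {x : ℝ} (h : S.a n x ≠ 0) :
    S.P n x 0 0 = S.a n x ∧ S.P n x 0 1 = -(S.a n x * S.w n x) ∧
      S.P n x 1 0 = S.a n x * S.y n x ∧
      S.P n x 1 1 = S.a n x * ((S.a n x)⁻¹ ^ 2 - S.w n x * S.y n x) := by
  have hd := S.det_P n x
  rw [Matrix.det_fin_two] at hd
  unfold a at h
  refine ⟨rfl, ?_, ?_, ?_⟩ <;> simp only [a, y, w]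
  · field_simp
  · field_simp
  field_simp
  linarith

section Joint

variable {S}
variable {q : ℝ → M2} {μ : ℝ → ℝ} {k n₁ n₂ : ℕ} {x : ℝ}

theorem a_joint (h1 : S.a n₁ x ≠ 0) (h2 : S.a n₂ (x + n₁ * S.α + k * S.α) ≠ 0)
    (hq : S.Q k (x + n₁ * S.α) = μ (x + n₁ * S.α) • q (x + n₁ * S.α)) :
    S.a (n₁ + k + n₂) x = μ (x + n₁ * S.α) * S.a n₁ x * S.a n₂ (x + n₁ * S.α + k * S.α)
      * S.joint q k n₁ n₂ (x + n₁ * S.α) := by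
  obtain ⟨e1, e2, e3, e4⟩ := S.entry_eq h1
  obtain ⟨f1, f2, f3, f4⟩ := S.entry_eq h2
  rw [a, P_joint, hq]
  simp only [Matrix.mul_apply, Fin.sum_univ_two, joint, Matrix.smul_apply, smul_eq_mul,
    e1, e3, f1, f2, add_sub_cancel_right]
  ring

theorem y_joint (h1 : S.a n₁ x ≠ 0) (h2 : S.a n₂ (x + n₁ * S.α + k * S.α) ≠ 0)
    (hq : S.Q k (x + n₁ * S.α) = μ (x + n₁ * S.α) • q (x + n₁ * S.α))
    (hμ : μ (x + n₁ * S.α) ≠ 0) (hF : S.joint q k n₁ n₂ (x + n₁ * S.α) ≠ 0) :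
    S.y (n₁ + k + n₂) x = S.y n₂ (x + n₁ * S.α + k * S.α)
      + (q (x + n₁ * S.α) 1 0 + q (x + n₁ * S.α) 1 1 * S.y n₁ x)
        * ((S.a n₂ (x + n₁ * S.α + k * S.α))⁻¹ * (S.a n₂ (x + n₁ * S.α + k * S.α))⁻¹)
        * (S.joint q k n₁ n₂ (x + n₁ * S.α))⁻¹ := by
  obtain ⟨e1, e2, e3, e4⟩ := S.entry_eq h1
  obtain ⟨f1, f2, f3, f4⟩ := S.entry_eq h2
  have ha := a_joint h1 h2 hq
  rw [a] at ha
  rw [y, ha, div_eq_iff (mul_ne_zero (mul_ne_zero (mul_ne_zero hμ h1) h2) hF)]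
  rw [P_joint, hq]
  simp only [Matrix.mul_apply, Fin.sum_univ_two, Matrix.smul_apply, smul_eq_mul,
    e1, e3, f3, f4]
  have hJ := S.joint_add q k n₁ n₂ x
  generalize S.joint q k n₁ n₂ (x + n₁ * S.α) = J at *
  generalize x + n₁ * S.α + k * S.α = x₃ at *
  field_simp
  rw [hJ]
  ring

theorem w_joint (h1 : S.a n₁ x ≠ 0) (h2 : S.a n₂ (x + n₁ * S.α + k * S.α) ≠ 0)
    (hq : S.Q k (x + n₁ * S.α) = μ (x + n₁ * S.α) • q (x + n₁ * S.α))
    (hμ : μ (x + n₁ * S.α) ≠ 0) (hF : S.joint q k n₁ n₂ (x + n₁ * S.α) ≠ 0) :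
    S.w (n₁ + k + n₂) x = S.w n₁ x
      - (q (x + n₁ * S.α) 0 1 - S.w n₂ (x + n₁ * S.α + k * S.α) * q (x + n₁ * S.α) 1 1)
        * ((S.a n₁ x)⁻¹ * (S.a n₁ x)⁻¹) * (S.joint q k n₁ n₂ (x + n₁ * S.α))⁻¹ := by
  obtain ⟨e1, e2, e3, e4⟩ := S.entry_eq h1
  obtain ⟨f1, f2, f3, f4⟩ := S.entry_eq h2
  have ha := a_joint h1 h2 hq
  rw [a] at ha
  rw [w, ha, div_eq_iff (mul_ne_zero (mul_ne_zero (mul_ne_zero hμ h1) h2) hF)]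
  rw [P_joint, hq]
  simp only [Matrix.mul_apply, Fin.sum_univ_two, Matrix.smul_apply, smul_eq_mul,
    e2, e4, f1, f2]
  have hJ := S.joint_add q k n₁ n₂ x
  generalize S.joint q k n₁ n₂ (x + n₁ * S.α) = J at *
  generalize x + n₁ * S.α + k * S.α = x₃ at *
  field_simp
  rw [hJ]
  ring

end Joint

end Sys

theorem ne_zero_of_inv_ne_zero {a : ℝ} (h : a⁻¹ ≠ 0) : a ≠ 0 := by
  rintro rfl
  simp at h

namespace Sys

variable {S : Sys}

/-- Quantitative control, near `z`, of a block of length `n`. -/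
structure Good (S : Sys) (h : ℝ) (n : ℕ) (z b Y : ℝ) : Prop where
  ne : S.a n z ≠ 0
  inv : JetBound h (fun x => (S.a n x)⁻¹) z b
  y : JetBound h (S.y n) z Y
  w : JetBound h (S.w n) z Y

theorem Good.mono {h h' z b b' Y Y' : ℝ} {n : ℕ} (H : Good S h n z b Y) (h0 : 0 ≤ h')
    (hh : h' ≤ h) (hb : b ≤ b') (hY : Y ≤ Y') : Good S h' n z b' Y' :=
  ⟨H.ne, (H.inv.mono_weight h0 hh).mono hb, (H.y.mono_weight h0 hh).mono hY,
    (H.w.mono_weight h0 hh).mono hY⟩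

theorem Good.eventually_ne {h z b Y : ℝ} {n : ℕ} (H : Good S h n z b Y) :
    ∀ᶠ x in 𝓝 z, S.a n x ≠ 0 :=
  (H.inv.continuousAt.eventually_ne (inv_ne_zero H.ne)).mono fun _ => ne_zero_of_inv_ne_zero

/-- The normalised joint matrix. -/
def nQ (S : Sys) (k : ℕ) (μ : ℝ → ℝ) (x : ℝ) : M2 := (μ x)⁻¹ • S.Q k x

theorem Q_eq_smul_nQ {k : ℕ} {μ : ℝ → ℝ} {x : ℝ} (hx : μ x ≠ 0) :
    S.Q k x = μ x • S.nQ k μ x := by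
  rw [nQ, smul_smul, mul_inv_cancel₀ hx, one_smul]

theorem nQ_periodic {k : ℕ} {μ : ℝ → ℝ} (hμ : Function.Periodic μ 1) :
    Function.Periodic (S.nQ k μ) 1 := fun x => by
  rw [nQ, nQ, hμ, S.Q_periodic]

/-- Joining two controlled blocks. -/
theorem Good.join {h z b₁ b₃ bμ f K : ℝ} {n₁ k n₂ : ℕ} {μ : ℝ → ℝ} (h0 : 0 ≤ h)
    (G₁ : Good S h n₁ z b₁ 1) (G₃ : Good S h n₂ (z + n₁ * S.α + k * S.α) b₃ 1)
    (hμ : μ (z + n₁ * S.α) ≠ 0) (hμi : JetBound h (fun x => (μ x)⁻¹) (z + n₁ * S.α) bμ)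
    (hQ : ∀ i j, JetBound h (fun x => S.nQ k μ x i j) (z + n₁ * S.α) K)
    (hF : S.joint (S.nQ k μ) k n₁ n₂ (z + n₁ * S.α) ≠ 0)
    (hFi : JetBound h (fun x => (S.joint (S.nQ k μ) k n₁ n₂ x)⁻¹) (z + n₁ * S.α) f) :
    S.a (n₁ + k + n₂) z ≠ 0 ∧
      JetBound h (fun x => (S.a (n₁ + k + n₂) x)⁻¹) z (bμ * b₁ * b₃ * f) ∧
      JetBound h (fun x => S.y (n₁ + k + n₂) x - S.y n₂ (x + (n₁ * S.α + k * S.α))) z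
        (2 * K * (b₃ * b₃) * f) ∧
      JetBound h (fun x => S.w (n₁ + k + n₂) x - S.w n₁ x) z (2 * K * (b₁ * b₁) * f) := by
  have t1 : Tendsto (fun x => x + n₁ * S.α) (𝓝 z) (𝓝 (z + n₁ * S.α)) :=
    (continuous_id.add continuous_const).tendsto z
  have t3 : Tendsto (fun x => x + n₁ * S.α + k * S.α) (𝓝 z) (𝓝 (z + n₁ * S.α + k * S.α)) :=
    ((continuous_id.add continuous_const).add continuous_const).tendsto z
  have eμ : ∀ᶠ x in 𝓝 z, μ (x + n₁ * S.α) ≠ 0 := t1.eventually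
    ((hμi.continuousAt.eventually_ne (inv_ne_zero hμ)).mono fun _ => ne_zero_of_inv_ne_zero)
  have eF : ∀ᶠ x in 𝓝 z, S.joint (S.nQ k μ) k n₁ n₂ (x + n₁ * S.α) ≠ 0 := t1.eventually
    ((hFi.continuousAt.eventually_ne (inv_ne_zero hF)).mono fun _ => ne_zero_of_inv_ne_zero)
  have e1 := G₁.eventually_ne
  have e3 := t3.eventually G₃.eventually_ne
  have j3 : JetBound h (fun x => (S.a n₂ (x + (n₁ * S.α + k * S.α)))⁻¹) z b₃ :=
    JetBound.comp_add_const (by rw [← add_assoc]; exact G₃.inv)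
  have jw : JetBound h (fun x => S.w n₂ (x + (n₁ * S.α + k * S.α))) z 1 :=
    JetBound.comp_add_const (by rw [← add_assoc]; exact G₃.w)
  have jμ := hμi.comp_add_const
  have jF := hFi.comp_add_const
  have jQ := fun i j => (hQ i j).comp_add_const
  have hK : 0 ≤ K := (hQ 0 0).nonneg h0
  refine ⟨?_, ?_, ?_, ?_⟩
  · rw [a_joint G₁.ne G₃.ne (Q_eq_smul_nQ hμ)]
    exact mul_ne_zero (mul_ne_zero (mul_ne_zero hμ G₁.ne) G₃.ne) hF
  · refine ((((jμ.mul G₁.inv h0).mul j3 h0).mul jF h0)).congr ?_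
    filter_upwards [eμ, e1, e3] with x hx h1 h3
    rw [a_joint h1 h3 (Q_eq_smul_nQ hx), ← add_assoc]
    simp only [mul_inv]
  · refine JetBound.mono (JetBound.congr ((((jQ 1 0).add ((jQ 1 1).mul G₁.y h0) h0).mul
      (j3.mul j3 h0) h0).mul jF h0) ?_) (le_of_eq (by ring))
    filter_upwards [eμ, e1, e3, eF] with x hx h1 h3 hF
    rw [y_joint h1 h3 (Q_eq_smul_nQ hx) hx hF, ← add_assoc]
    ring
  · refine JetBound.mono (JetBound.congr ((((jQ 0 1).sub (jw.mul (jQ 1 1) h0) h0).mul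
      (G₁.inv.mul G₁.inv h0) h0).mul jF h0).neg ?_) (le_of_eq (by ring))
    filter_upwards [eμ, e1, e3, eF] with x hx h1 h3 hF
    rw [w_joint h1 h3 (Q_eq_smul_nQ hx) hx hF, ← add_assoc]
    ring

/-- Membership in the `r`-neighbourhood of two points of the circle. -/
def InJ (c : Bool → ℝ) (r x : ℝ) : Prop := ∃ b, nd (x - c b) < r

theorem InJ.mono {c : Bool → ℝ} {r r' x : ℝ} (H : InJ c r x) (h : r ≤ r') : InJ c r' x :=
  H.imp fun _ hb => hb.trans_le h

theorem InJ.of_nd {c : Bool → ℝ} {r s x y : ℝ} (H : InJ c r x) (h : nd (y - x) ≤ s) :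
    InJ c (r + s) y :=
  H.imp fun b hb => by
    have := nd_sub_triangle y x (c b)
    linarith

/-- `n` is the length of an excursion from the critical region starting at `z`. -/
structure Exc (S : Sys) (k : ℕ) (c : Bool → ℝ) (ρ z : ℝ) (n : ℕ) : Prop where
  one_le : 1 ≤ n
  left : InJ c (2 * ρ) (z - k * S.α)
  right : InJ c (2 * ρ) (z + n * S.α)
  inter : ∀ t : ℕ, 0 < t → t < n → ¬ InJ c ρ (z + t * S.α)

/-- The inductive description of the dynamics at one scale. -/
structure Dyn (S : Sys) (k : ℕ) (M d ρ Γ ε : ℝ) (c : Bool → ℝ) (F : Bool → ℝ → ℝ)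
    (μ : ℝ → ℝ) : Prop where
  ret : ∀ (x : ℝ) (t : ℕ), 1 ≤ t → InJ c (2 * ρ) x → InJ c (2 * ρ) (x + t * S.α) → k + M ≤ t
  mu_ne : ∀ x, InJ c (2 * ρ) x → μ x ≠ 0
  mu_inv : ∀ x, InJ c (2 * ρ) x → JetBound d (fun x => (μ x)⁻¹) x (Real.exp (-Γ * k))
  nQ_jet : ∀ x, InJ c (2 * ρ) x → ∀ i j, JetBound d (fun x => S.nQ k μ x i j) x (1 / d)
  exc : ∀ (z : ℝ) (n : ℕ), Exc S k c ρ z n → Good S d n z (Real.exp (-Γ * n)) (1 - d)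
  fn : ∀ (b : Bool) (x : ℝ) (i j : ℕ), nd (x - c b) < 2 * ρ →
    Exc S k c ρ (x - i * S.α) i → Exc S k c ρ (x + k * S.α) j →
    JetBound d (fun x => S.joint (S.nQ k μ) k i j x - F b x) x ε
  F_jet : ∀ (b : Bool) (x : ℝ), nd (x - c b) < 2 * ρ → JetBound d (F b) x (5 / d)
  mu_periodic : Function.Periodic μ 1
  F_periodic : ∀ b, Function.Periodic (F b) 1

/-- The numerical relations between two consecutive scales. -/
structure Scale (M d Γ ε d' e η Γ' : ℝ) : Prop where
  hd' : 0 < d'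
  hdd : d' ≤ d
  hd1 : d ≤ 1
  hM : 0 < M
  he : 0 < e
  he1 : e ≤ 1
  hη : 0 ≤ η
  hε : 0 ≤ ε
  hF : 5 / d * (d' / d) + 2 * (ε + 2 * η / d) ≤ e / 4
  hY : d' + η ≤ d
  hΓ' : 1 ≤ Γ'
  hΓ : Γ' * M + Real.log (4 / e) ≤ Γ * M
  hy : 2 / d * (4 / e) * Real.exp (-Γ * M) ≤ η
  hw : 2 / d * (4 / e) * Real.exp (-Γ' * M) ≤ η / 2

/-- Consecutive visits, at times `t - k` and `t + i`, along an orbit. -/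
structure Old (k : ℕ) (V : ℤ → Prop) (t : ℤ) (i : ℕ) : Prop where
  one_le : 1 ≤ i
  left : V (t - k)
  right : V (t + i)
  inter : ∀ u, t < u → u < t + i → ¬ V u

/-- `V` is an approximate itinerary of the orbit of `z`. -/
structure Itin (S : Sys) (c : Bool → ℝ) (ρ z : ℝ) (V : ℤ → Prop) : Prop where
  of_inJ : ∀ t : ℤ, InJ c ρ (z + t * S.α) → V t
  inJ : ∀ t : ℤ, V t → InJ c (2 * ρ) (z + t * S.α)

section Chain

variable {k : ℕ} {M d ρ Γ ε d' e η Γ' z : ℝ} {c : Bool → ℝ} {F : Bool → ℝ → ℝ} {μ : ℝ → ℝ}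
  {V : ℤ → Prop}

theorem Itin.gap (D : Dyn S k M d ρ Γ ε c F μ) (I : Itin S c ρ z V) {t u : ℤ} (htu : t < u)
    (ht : V t) (hu : V u) : (k : ℝ) + M ≤ (u - t : ℤ) := by
  obtain ⟨m, hm⟩ := Int.eq_ofNat_of_zero_le (by lia : 0 ≤ u - t)
  have := D.ret (z + t * S.α) m (by lia) (I.inJ t ht) (by
    have h := I.inJ u hu
    have e : (u : ℝ) = t + m := by
      have : u = t + m := by lia
      rw [this]; push_cast; ring
    rw [e] at h
    convert h using 1
    ring)
  rw [hm]
  exact_mod_cast this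

theorem Itin.gap_int (D : Dyn S k M d ρ Γ ε c F μ) (I : Itin S c ρ z V) (hM : 0 < M) {t u : ℤ}
    (htu : t < u) (ht : V t) (hu : V u) : k < u - t := by
  have := I.gap D htu ht hu
  have h : ((k : ℤ) : ℝ) < (u - t : ℤ) := by push_cast at this ⊢; linarith
  exact_mod_cast h

theorem Old.exc (I : Itin S c ρ z V) {t : ℤ} {i : ℕ} (H : Old k V t i) :
    Exc S k c ρ (z + t * S.α) i where
  one_le := H.one_le
  left := by
    have := I.inJ _ H.left
    push_cast at this
    convert this using 1; ring
  right := by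
    have := I.inJ _ H.right
    push_cast at this
    convert this using 1; ring
  inter u hu hui hJ := by
    refine H.inter (t + u) (by lia) (by lia) (I.of_inJ _ ?_)
    push_cast
    convert hJ using 1; ring

theorem Old.left_unique (D : Dyn S k M d ρ Γ ε c F μ) (I : Itin S c ρ z V) (hM : 0 < M) {t : ℤ}
    {i i' : ℕ} (H : Old k V (t - i) i) (H' : Old k V (t - i') i') : i = i' := by
  wlog h : i < i' generalizing i i'
  · rcases lt_trichotomy i i' with h' | h' | h'
    · exact absurd h' h
    · exact h'
    · exact (this H' H h').symm
  exfalso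
  by_cases h2 : t - i' < t - i - k
  · have := H.one_le
    exact H'.inter _ h2 (by lia) H.left
  · have := I.gap_int D hM (by lia) H'.left H.left
    lia

theorem Old.right_unique {t : ℤ} {i i' : ℕ} (H : Old k V t i) (H' : Old k V t i') : i = i' := by
  wlog h : i < i' generalizing i i'
  · rcases lt_trichotomy i i' with h' | h' | h'
    · exact absurd h' h
    · exact h'
    · exact (this H' H h').symm
  have := H.one_le
  exact absurd H.right (H'.inter _ (by lia) (by lia))

/-- Control of a chain of excursions whose joints are not degenerate. -/
structure Chain (S : Sys) (k : ℕ) (d' η Γ' z : ℝ) (V : ℤ → Prop) (s : ℤ) (n : ℕ) : Prop where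
  good : Good S d' n (z + s * S.α) (Real.exp (-Γ' * n)) (1 - d')
  y : ∃ i : ℕ, Old k V (s + n - i) i ∧
    JetBound d' (fun x => S.y n x - S.y i (x + ((n : ℝ) - i) * S.α)) (z + s * S.α) η
  w : ∃ j : ℕ, Old k V s j ∧
    JetBound d' (fun x => S.w n x - S.w j x) (z + s * S.α) (η * (1 - (1 / 2) ^ n))

theorem Scale.hd {M d Γ ε d' e η Γ' : ℝ} (C : Scale M d Γ ε d' e η Γ') : 0 < d :=
  C.hd'.trans_le C.hdd

theorem Scale.hlog {M d Γ ε d' e η Γ' : ℝ} (C : Scale M d Γ ε d' e η Γ') :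
    0 ≤ Real.log (4 / e) :=
  Real.log_nonneg (by rw [le_div_iff₀ C.he]; linarith [C.he1])

theorem Scale.hΓΓ {M d Γ ε d' e η Γ' : ℝ} (C : Scale M d Γ ε d' e η Γ') : Γ' ≤ Γ := by
  have := C.hΓ
  have := C.hlog
  exact le_of_mul_le_mul_right (by linarith) C.hM

theorem Scale.exp_mul_le {M d Γ ε d' e η Γ' : ℝ} (C : Scale M d Γ ε d' e η Γ') {m : ℝ}
    (hm : M ≤ m) : Real.exp (-Γ * m) * (4 / e) ≤ Real.exp (-Γ' * m) := by
  have h4 : 0 < 4 / e := by have := C.he; positivity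
  rw [← Real.exp_log h4, ← Real.exp_add, Real.exp_le_exp]
  have := C.hΓ
  have := mul_le_mul_of_nonneg_left hm (sub_nonneg.2 C.hΓΓ)
  linarith

/-- The inverse of a function close to one which is not small. -/
theorem Scale.jet_inv {M d Γ ε d' e η Γ' : ℝ} (C : Scale M d Γ ε d' e η Γ') {f g : ℝ → ℝ}
    {x : ℝ} (hf : JetBound d f x (5 / d)) (he : e ≤ |f x|)
    (hg : JetBound d' (fun x => g x - f x) x (ε + 2 * η / d)) :
    g x ≠ 0 ∧ JetBound d' (fun x => (g x)⁻¹) x (4 / e) := by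
  have hd := C.hd
  have hd' := C.hd'
  have he0 := C.he
  have h1 := hg.abs_le hd'.le
  have h2 := (hf.shrink hd hd'.le C.hdd).of_sub hg hd'.le
  have hF := C.hF
  have h5 : 0 ≤ 5 / d * (d' / d) := by positivity
  have h3 : |f x| - |g x| ≤ ε + 2 * η / d := by
    have := abs_sub_abs_le_abs_sub (f x) (g x)
    rw [abs_sub_comm] at this
    exact this.trans h1
  have h4 : e / 2 ≤ |g x| := by linarith
  refine ⟨fun h => by rw [h, abs_zero] at h4; linarith, ?_⟩
  have h6 : JetBound d' g x (|g x| + e / 2 / 2) := h2.mono (by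
    rw [mul_comm] at h5
    have : d' / d * (5 / d) = 5 / d * (d' / d) := mul_comm _ _
    linarith)
  refine (h6.inv hd'.le (by positivity) h4).mono (le_of_eq ?_)
  field_simp
  norm_num

theorem chain (D : Dyn S k M d ρ Γ ε c F μ) (C : Scale M d Γ ε d' e η Γ') (I : Itin S c ρ z V)
    (n : ℕ) (s : ℤ) (hn : 1 ≤ n) (hl : V (s - k)) (hr : V (s + n))
    (hG : ∀ t, s < t → t < s + n → V t →
      ∃ b, nd (z + t * S.α - c b) < 2 * ρ ∧ e ≤ |F b (z + t * S.α)|) :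
    Chain S k d' η Γ' z V s n := by
  induction n using Nat.strong_induction_on with
  | _ n ih =>
  have hd := C.hd
  have hd' := C.hd'
  have hη := C.hη
  by_cases hv : ∃ m : ℕ, 0 < m ∧ m < n ∧ V (s + m)
  · -- split at the last visit
    classical
    let A := (Finset.range n).filter fun m : ℕ => 0 < m ∧ V (s + m)
    have hA : A.Nonempty := by
      obtain ⟨m, h1, h2, h3⟩ := hv
      exact ⟨m, by simp [A, h1, h2, h3]⟩
    obtain ⟨n₁, h₁A, hmax⟩ := A.exists_max_image id hA
    simp only [A, Finset.mem_filter, Finset.mem_range, id] at h₁A hmax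
    obtain ⟨h₁n, h₁0, h₁V⟩ := h₁A
    have hgap := I.gap D (by lia : s + n₁ < s + n) h₁V hr
    have hgap' := I.gap_int D C.hM (by lia : s + n₁ < s + n) h₁V hr
    obtain ⟨n₂, hn₂⟩ : ∃ n₂, n = n₁ + k + n₂ := ⟨n - n₁ - k, by lia⟩
    have hold : Old k V (s + n₁ + k) n₂ :=
      ⟨by lia, by convert h₁V using 1; ring, by convert hr using 1; lia, fun u hu hu' hVu => by
        obtain ⟨m, hm⟩ := Int.eq_ofNat_of_zero_le (by lia : 0 ≤ u - s)
        have hu_eq : u = s + m := by lia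
        rw [hu_eq] at hVu
        have := hmax m ⟨by lia, by lia, hVu⟩
        lia⟩
    have ih₁ := ih n₁ h₁n h₁0 h₁V fun t h1 h2 => hG t h1 (by lia)
    have hM₁ : M ≤ n₁ := by
      have := I.gap D (by lia : s - k < s + n₁) hl h₁V
      push_cast at this
      linarith
    have hM₂ : M ≤ n₂ := by
      rw [hn₂] at hgap
      push_cast at hgap
      linarith
    obtain ⟨b, hb, hFb⟩ := hG (s + n₁) (by lia) (by lia) h₁V
    obtain ⟨i₁, hi₁, hy₁⟩ := ih₁.y
    obtain ⟨j₁, hj₁, hw₁⟩ := ih₁.w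
    set z₀ := z + s * S.α with hz₀
    have hx : z + ((s + n₁ : ℤ) : ℝ) * S.α = z₀ + n₁ * S.α := by
      rw [hz₀]; push_cast; ring
    have hx₃ : z + ((s + n₁ + k : ℤ) : ℝ) * S.α = z₀ + n₁ * S.α + k * S.α := by
      rw [hz₀]; push_cast; ring
    have hxi : z + ((s + n₁ - i₁ : ℤ) : ℝ) * S.α = z₀ + n₁ * S.α - i₁ * S.α := by
      rw [hz₀]; push_cast; ring
    have hJ := I.inJ _ h₁V
    rw [hx] at hb hFb hJ
    have G₃ := D.exc _ _ (hold.exc I)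
    rw [hx₃] at G₃
    have hexc₂ := hold.exc I
    rw [hx₃] at hexc₂
    have hexc₁ := hi₁.exc I
    rw [hxi] at hexc₁
    have hfn := D.fn b _ i₁ n₂ hb hexc₁ hexc₂
    have hQd := D.nQ_jet _ hJ
    have hQ' := fun i j => (hQd i j).mono_weight hd'.le C.hdd
    have hy₁' : JetBound d' (fun x => S.y n₁ (x - n₁ * S.α) - S.y i₁ (x - i₁ * S.α))
        (z₀ + n₁ * S.α) η := by
      have h1 : JetBound d' (fun x => S.y n₁ x - S.y i₁ (x + ((n₁ : ℝ) - i₁) * S.α))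
          (z₀ + n₁ * S.α + -(n₁ * S.α)) η := by
        rw [add_neg_cancel_right]; exact hy₁
      refine h1.comp_add_const.congr (Eventually.of_forall fun x => ?_)
      simp only [← sub_eq_add_neg]
      congr 2
      ring
    have hw₂ : JetBound d' (fun x => S.w n₂ (x + k * S.α)) (z₀ + n₁ * S.α) 1 :=
      JetBound.comp_add_const ((G₃.w.mono_weight hd'.le C.hdd).mono (by linarith))
    have hdiff : JetBound d' (fun x => S.joint (S.nQ k μ) k n₁ n₂ x
        - S.joint (S.nQ k μ) k i₁ n₂ x) (z₀ + n₁ * S.α) (2 * η / d) := by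
      refine JetBound.mono (JetBound.congr
        (((hQ' 0 1).sub (hw₂.mul (hQ' 1 1) hd'.le) hd'.le).mul hy₁' hd'.le)
        (Eventually.of_forall fun x => ?_)) (le_of_eq (by ring))
      simp only [joint]
      ring
    have hFd : JetBound d' (fun x => S.joint (S.nQ k μ) k n₁ n₂ x - F b x) (z₀ + n₁ * S.α)
        (ε + 2 * η / d) := by
      refine ((hfn.mono_weight hd'.le C.hdd).add hdiff hd'.le).congr
        (Eventually.of_forall fun x => ?_)
      simp only
      ring
    obtain ⟨hFne, hFinv⟩ := C.jet_inv (D.F_jet b _ hb) hFb hFd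
    have G₁' := ih₁.good.mono hd'.le le_rfl le_rfl (by linarith : 1 - d' ≤ 1)
    have G₃' := G₃.mono hd'.le C.hdd le_rfl (by linarith : 1 - d ≤ 1)
    obtain ⟨ta, tinv, ty, tw⟩ := Good.join hd'.le G₁' G₃' (D.mu_ne _ hJ)
      ((D.mu_inv _ hJ).mono_weight hd'.le C.hdd) hQ' hFne hFinv
    rw [← hn₂] at ta tinv ty tw
    have h4e : 0 ≤ 4 / e := by have := C.he; positivity
    have hd2 : 0 ≤ 2 / d := by positivity
    have hΓ0 : 0 ≤ Γ' := by linarith [C.hΓ']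
    have hΓ1 : 0 ≤ Γ := hΓ0.trans C.hΓΓ
    have hy2 : 2 * (1 / d) * (Real.exp (-Γ * n₂) * Real.exp (-Γ * n₂)) * (4 / e) ≤ η := by
      refine le_trans ?_ C.hy
      have h1 : Real.exp (-Γ * n₂) ≤ Real.exp (-Γ * M) := by
        rw [Real.exp_le_exp]; nlinarith
      have h2 : Real.exp (-Γ * n₂) ≤ 1 := by
        rw [Real.exp_le_one_iff]; nlinarith [(Nat.cast_nonneg n₂ : (0:ℝ) ≤ n₂)]
      have h3 := mul_le_mul h1 h2 (Real.exp_nonneg _) (Real.exp_nonneg _)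
      calc _ = 2 / d * (4 / e) * (Real.exp (-Γ * n₂) * Real.exp (-Γ * n₂)) := by ring
        _ ≤ 2 / d * (4 / e) * (Real.exp (-Γ * M) * 1) := by gcongr
        _ = _ := by ring
    have hw2 : 2 * (1 / d) * (Real.exp (-Γ' * n₁) * Real.exp (-Γ' * n₁)) * (4 / e)
        ≤ η / 2 * (1 / 2) ^ n₁ := by
      have h1 : Real.exp (-Γ' * n₁) ≤ Real.exp (-Γ' * M) := by
        rw [Real.exp_le_exp]; nlinarith
      have h2 : Real.exp (-Γ' * n₁) ≤ (1 / 2) ^ n₁ := by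
        have : Real.exp (-1) ≤ 1 / 2 := by
          rw [Real.exp_neg, one_div]
          exact inv_anti₀ (by norm_num) (by linarith [Real.add_one_le_exp (1 : ℝ)])
        calc Real.exp (-Γ' * n₁) ≤ Real.exp (n₁ * (-1)) := by
              rw [Real.exp_le_exp]
              nlinarith [(Nat.cast_nonneg n₁ : (0:ℝ) ≤ n₁), C.hΓ']
          _ = Real.exp (-1) ^ n₁ := by rw [Real.exp_nat_mul]
          _ ≤ _ := by gcongr
      have h3 := mul_le_mul h1 h2 (Real.exp_nonneg _) (Real.exp_nonneg _)
      calc _ = 2 / d * (4 / e) * (Real.exp (-Γ' * n₁) * Real.exp (-Γ' * n₁)) := by ring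
        _ ≤ 2 / d * (4 / e) * (Real.exp (-Γ' * M) * (1 / 2) ^ n₁) := by gcongr
        _ = 2 / d * (4 / e) * Real.exp (-Γ' * M) * (1 / 2) ^ n₁ := by ring
        _ ≤ _ := by gcongr; exact C.hw
    have ty' : JetBound d' (fun x => S.y n x - S.y n₂ (x + ((n : ℝ) - n₂) * S.α)) z₀ η := by
      refine (ty.mono hy2).congr (Eventually.of_forall fun x => ?_)
      simp only
      congr 2
      rw [hn₂]; push_cast; ring
    have tw' : JetBound d' (fun x => S.w n x - S.w j₁ x) z₀ (η * (1 - (1 / 2) ^ n)) := by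
      refine JetBound.mono (JetBound.congr ((tw.mono hw2).add hw₁ hd'.le)
        (Eventually.of_forall fun x => ?_)) ?_
      · simp only; ring
      · have : ((1:ℝ) / 2) ^ n ≤ (1 / 2) ^ (n₁ + 1) :=
          pow_le_pow_of_le_one (by norm_num) (by norm_num) (by lia)
        rw [pow_succ] at this
        have := mul_le_mul_of_nonneg_left this hη
        linarith
    have hηn : η * (1 - (1 / 2) ^ n) ≤ η := by
      have : (0:ℝ) ≤ (1 / 2) ^ n := by positivity
      nlinarith
    refine ⟨⟨ta, tinv.mono ?_, ?_, ?_⟩, ⟨n₂, ?_, ty'⟩, ⟨j₁, hj₁, tw'⟩⟩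
    · have h1 := C.exp_mul_le (by linarith [(Nat.cast_nonneg k : (0:ℝ) ≤ k)] : M ≤ (k : ℝ) + n₂)
      calc _ = Real.exp (-Γ' * n₁) * (Real.exp (-Γ * (k + n₂)) * (4 / e)) := by
            rw [mul_add, Real.exp_add]; ring
        _ ≤ Real.exp (-Γ' * n₁) * Real.exp (-Γ' * (k + n₂)) := by gcongr
        _ = _ := by rw [← Real.exp_add, hn₂]; push_cast; ring_nf
    · have h3 : JetBound d' (fun x => S.y n₂ (x + ((n : ℝ) - n₂) * S.α)) z₀ (1 - d) :=
        JetBound.comp_add_const (by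
          have : z₀ + ((n : ℝ) - n₂) * S.α = z₀ + n₁ * S.α + k * S.α := by
            rw [hn₂]; push_cast; ring
          rw [this]
          exact G₃.y.mono_weight hd'.le C.hdd)
      exact (h3.of_sub ty' hd'.le).mono (by linarith [C.hY])
    · have h3 := ((D.exc _ _ (hj₁.exc I)).w.mono_weight hd'.le C.hdd)
      exact (h3.of_sub tw' hd'.le).mono (by linarith [C.hY])
    · convert hold using 1
      rw [hn₂]; push_cast; ring
  · -- a single excursion
    push Not at hv
    have hold : Old k V s n := ⟨hn, hl, hr, fun u h1 h2 => by
      obtain ⟨m, hm⟩ := Int.eq_ofNat_of_zero_le (by lia : 0 ≤ u - s)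
      have : u = s + m := by lia
      rw [this]
      exact hv m (by lia) (by lia)⟩
    have hz : ∀ f : ℝ → ℝ, ∀ K, 0 ≤ K → JetBound d' (fun x => f x - f x) (z + s * S.α) K := by
      intro f K hK
      simp only [sub_self]
      exact (JetBound.const 0).mono (by simpa using hK)
    refine ⟨(D.exc _ _ (hold.exc I)).mono hd'.le C.hdd ?_ (by linarith [C.hdd]), ⟨n, ?_, ?_⟩,
      ⟨n, hold, hz _ _ ?_⟩⟩
    · rw [Real.exp_le_exp]
      nlinarith [(Nat.cast_nonneg n : (0:ℝ) ≤ n), C.hΓΓ]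
    · simpa using hold
    · simpa using hz (S.y n) η hη
    · refine mul_nonneg hη (sub_nonneg.2 (pow_le_one₀ (by norm_num) (by norm_num)))

end Chain

end Sys

theorem exists_nd_mul_lt (α : ℝ) {δ : ℝ} (hδ : 0 < δ) : ∃ N : ℕ, 1 ≤ N ∧ nd (N * α) < δ := by
  obtain ⟨n, hn⟩ := exists_nat_gt (1 / δ)
  have hn0 : 0 < n := by
    have : (0:ℝ) < n := (by positivity : 0 < 1 / δ).trans hn
    exact_mod_cast this
  obtain ⟨N, hN, -, h⟩ := Real.exists_nat_abs_mul_sub_round_le α hn0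
  refine ⟨N, hN, ?_⟩
  rw [nd_eq]
  refine h.trans_lt ?_
  rw [div_lt_iff₀ (by positivity)]
  rw [div_lt_iff₀ hδ] at hn
  nlinarith

theorem exists_min_nat {p : ℕ → Prop} (h : ∃ n, p n) : ∃ n, p n ∧ ∀ m < n, ¬ p m := by
  classical
  exact ⟨Nat.find h, Nat.find_spec h, fun m => Nat.find_min h⟩

namespace Sys

variable {S : Sys}

section Old

variable {k : ℕ} {M d ρ Γ ε u z : ℝ} {c : Bool → ℝ} {F : Bool → ℝ → ℝ} {μ : ℝ → ℝ}

theorem InJ.congr_nd {c : Bool → ℝ} {r r' x y : ℝ} (H : InJ c r x) (h : r + nd (x - y) ≤ r') :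
    InJ c r' y :=
  (H.of_nd (nd_sub_comm y x).le).mono h

/-- The itinerary of `u`. -/
def itin (S : Sys) (c : Bool → ℝ) (ρ u : ℝ) (t : ℤ) : Prop := InJ c (3 / 2 * ρ) (u + t * S.α)

theorem itin_spec (h : nd (z - u) ≤ ρ / 2) : Itin S c ρ z (S.itin c ρ u) where
  of_inJ t ht := by
    refine InJ.congr_nd ht ?_
    rw [add_sub_add_right_eq_sub]
    linarith
  inJ t ht := by
    refine InJ.congr_nd ht ?_
    rw [add_sub_add_right_eq_sub, nd_sub_comm]
    linarith

theorem exists_old_left (D : Dyn S k M d ρ Γ ε c F μ) (hM : 0 < M) (hρ : 0 < ρ) (t : ℤ)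
    (ht : InJ c (5 / 4 * ρ) (u + t * S.α)) : ∃ i : ℕ, Old k (S.itin c ρ u) (t - i) i := by
  have hI : Itin S c ρ u (S.itin c ρ u) :=
    itin_spec (by rw [sub_self]; exact (nd_le_abs 0).trans (by rw [abs_zero]; linarith))
  have ht0 : S.itin c ρ u t := ht.mono (by linarith)
  have hex : ∃ N : ℕ, 1 ≤ N ∧ S.itin c ρ u (t - N) := by
    obtain ⟨N, hN, h⟩ := exists_nd_mul_lt S.α (by positivity : 0 < ρ / 4)
    refine ⟨N, hN, InJ.congr_nd ht ?_⟩
    have : u + t * S.α - (u + ((t - N : ℤ) : ℝ) * S.α) = N * S.α := by push_cast; ring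
    rw [this]
    linarith
  obtain ⟨N, hN, hmin⟩ := exists_min_nat hex
  have hk := hI.gap_int D hM (by lia) hN.2 ht0
  refine ⟨N - k, by lia, ?_, ?_, fun v h1 h2 hv => ?_⟩
  · convert hN.2 using 1; lia
  · convert ht0 using 1; lia
  · obtain ⟨m, hm⟩ := Int.eq_ofNat_of_zero_le (by lia : 0 ≤ t - v)
    refine hmin m (by lia) ⟨by lia, ?_⟩
    convert hv using 1; lia

theorem exists_old_right (D : Dyn S k M d ρ Γ ε c F μ) (hM : 0 < M) (hρ : 0 < ρ) (t : ℤ)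
    (ht : InJ c (5 / 4 * ρ) (u + t * S.α)) : ∃ j : ℕ, Old k (S.itin c ρ u) (t + k) j := by
  have hI : Itin S c ρ u (S.itin c ρ u) :=
    itin_spec (by rw [sub_self]; exact (nd_le_abs 0).trans (by rw [abs_zero]; linarith))
  have ht0 : S.itin c ρ u t := ht.mono (by linarith)
  have hex : ∃ N : ℕ, 1 ≤ N ∧ S.itin c ρ u (t + N) := by
    obtain ⟨N, hN, h⟩ := exists_nd_mul_lt S.α (by positivity : 0 < ρ / 4)
    refine ⟨N, hN, InJ.congr_nd ht ?_⟩
    have : u + t * S.α - (u + ((t + N : ℤ) : ℝ) * S.α) = -(N * S.α) := by push_cast; ring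
    rw [this, nd_neg]
    linarith
  obtain ⟨N, hN, hmin⟩ := exists_min_nat hex
  have hk := hI.gap_int D hM (by lia) ht0 hN.2
  refine ⟨N - k, by lia, ?_, ?_, fun v h1 h2 hv => ?_⟩
  · convert ht0 using 1; lia
  · convert hN.2 using 1; lia
  · obtain ⟨m, hm⟩ := Int.eq_ofNat_of_zero_le (by lia : 0 ≤ v - t)
    refine hmin m (by lia) ⟨by lia, ?_⟩
    convert hv using 1; lia

/-- Changing the two ends of a joint. -/
theorem joint_close {q : ℝ → M2} {h K η x : ℝ} {i j i₀ j₀ : ℕ} (h0 : 0 ≤ h)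
    (hq : ∀ r s, JetBound h (fun x => q x r s) x K)
    (hy : JetBound h (fun x => S.y i (x - i * S.α) - S.y i₀ (x - i₀ * S.α)) x η)
    (hw : JetBound h (fun x => S.w j (x + k * S.α) - S.w j₀ (x + k * S.α)) x η)
    (hy₀ : JetBound h (fun x => S.y i₀ (x - i₀ * S.α)) x 1)
    (hwj : JetBound h (fun x => S.w j (x + k * S.α)) x 1) :
    JetBound h (fun x => S.joint q k i j x - S.joint q k i₀ j₀ x) x (4 * K * η) := by
  refine JetBound.mono (JetBound.congr
    ((((hq 0 1).sub (hwj.mul (hq 1 1) h0) h0).mul hy h0).sub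
      (hw.mul ((hq 1 0).add ((hq 1 1).mul hy₀ h0) h0) h0) h0)
    (Eventually.of_forall fun x => ?_)) (le_of_eq (by ring))
  simp only [joint]
  ring

theorem joint_jet {q : ℝ → M2} {h K x : ℝ} {i j : ℕ} (h0 : 0 ≤ h)
    (hq : ∀ r s, JetBound h (fun x => q x r s) x K)
    (hy : JetBound h (fun x => S.y i (x - i * S.α)) x 1)
    (hw : JetBound h (fun x => S.w j (x + k * S.α)) x 1) :
    JetBound h (S.joint q k i j) x (4 * K) := by
  refine JetBound.mono (JetBound.congr
    ((((hq 0 0).add ((hq 0 1).mul hy h0) h0).sub (hw.mul (hq 1 0) h0) h0).sub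
      (hw.mul ((hq 1 1).mul hy h0) h0) h0)
    (Eventually.of_forall fun x => ?_)) (le_of_eq (by ring))
  simp only [joint]

theorem jet_shift_y {h η x : ℝ} {i i₀ : ℕ}
    (H : JetBound h (fun x => S.y i x - S.y i₀ (x + ((i : ℝ) - i₀) * S.α)) (x - i * S.α) η) :
    JetBound h (fun x => S.y i (x - i * S.α) - S.y i₀ (x - i₀ * S.α)) x η := by
  rw [sub_eq_add_neg] at H
  refine H.comp_add_const.congr (Eventually.of_forall fun x => ?_)
  simp only [← sub_eq_add_neg]
  congr 2
  ring

theorem Dyn.y_jet (D : Dyn S k M d ρ Γ ε c F μ) (hd : 0 < d) {x : ℝ} {i : ℕ}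
    (H : Exc S k c ρ (x - i * S.α) i) : JetBound d (fun x => S.y i (x - i * S.α)) x 1 := by
  have := (D.exc _ _ H).y
  rw [sub_eq_add_neg] at this
  exact this.comp_add_const.mono (by linarith)

theorem Dyn.w_jet (D : Dyn S k M d ρ Γ ε c F μ) (hd : 0 < d) {x : ℝ} {j l : ℕ}
    (H : Exc S k c ρ (x + l * S.α) j) : JetBound d (fun x => S.w j (x + l * S.α)) x 1 :=
  (D.exc _ _ H).w.comp_add_const.mono (by linarith)

end Old

section NonRes

variable {k : ℕ} {M M' d ρ ρ' Γ ε ε' d' e η Γ' : ℝ} {c c' : Bool → ℝ} {F : Bool → ℝ → ℝ}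
  {μ : ℝ → ℝ}

theorem nd_self (x : ℝ) : nd (x - x) = 0 := by
  rw [sub_self]
  exact le_antisymm ((nd_le_abs 0).trans (by simp)) (nd_nonneg 0)

/-- Passing to the next scale when the two critical points do not interact. -/
theorem nonres_step (D : Dyn S k M d ρ Γ ε c F μ) (C : Scale M d Γ ε d' e η Γ')
    (hρ' : 0 < ρ') (hρρ : 16 * ρ' ≤ ρ) (hc : ∀ b, nd (c' b - c b) ≤ ρ)
    (hzone : ∀ b x, nd (x - c b) < 2 * ρ → (∀ b', ρ' ≤ nd (x - c' b')) → e ≤ |F b x|)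
    (hret : ∀ (x : ℝ) (t : ℕ), 1 ≤ t → InJ c' (2 * ρ') x → InJ c' (2 * ρ') (x + t * S.α) →
      k + M' ≤ t)
    (hε' : 4 * (1 / d) * η ≤ ε') :
    ∃ F' : Bool → ℝ → ℝ, Dyn S k M' d' ρ' Γ' ε' c' F' μ ∧
      (c' true = c' false → F' true = F' false) ∧
      ∀ b x, nd (x - c' b) < 2 * ρ' → JetBound d (fun x => F' b x - F b x) x ε := by
  have hd := C.hd
  have hd' := C.hd'
  have hρ : 0 < ρ := by linarith
  have hsub : ∀ {r x}, InJ c' r x → InJ c (r + ρ) x := fun {r x} ⟨b, hb⟩ => ⟨b, by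
    have := nd_sub_triangle x (c' b) (c b)
    have := hc b
    linarith⟩
  have hex : ∀ u : ℝ, ∃ p : ℕ × ℕ, InJ c (5 / 4 * ρ) u →
      Old k (S.itin c ρ u) (0 - p.1) p.1 ∧ Old k (S.itin c ρ u) (0 + k) p.2 := fun u => by
    by_cases hu : InJ c (5 / 4 * ρ) u
    · have hu' : InJ c (5 / 4 * ρ) (u + (0 : ℤ) * S.α) := by simpa using hu
      obtain ⟨i, hi⟩ := exists_old_left D C.hM hρ 0 hu'
      obtain ⟨j, hj⟩ := exists_old_right D C.hM hρ 0 hu'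
      exact ⟨(i, j), fun _ => ⟨hi, hj⟩⟩
    · exact ⟨(0, 0), fun h => absurd h hu⟩
  choose p hp using hex
  have hc5 : ∀ b, InJ c (5 / 4 * ρ) (c' b) := fun b => ⟨b, (hc b).trans_lt (by linarith)⟩
  have hnear : ∀ {b x}, nd (x - c' b) < 2 * ρ' → nd (x - c b) < 2 * ρ := fun {b x} hb => by
    have := nd_sub_triangle x (c' b) (c b)
    have := hc b
    linarith
  have hitin : ∀ {b x}, nd (x - c' b) < 2 * ρ' → Itin S c ρ x (S.itin c ρ (c' b)) :=
    fun {b x} hb => itin_spec (by linarith)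
  have hE₁ : ∀ {b x}, nd (x - c' b) < 2 * ρ' →
      Exc S k c ρ (x - (p (c' b)).1 * S.α) (p (c' b)).1 := fun {b x} hb => by
    have := (hp _ (hc5 b)).1.exc (hitin hb)
    push_cast at this
    convert this using 1; ring
  have hE₂ : ∀ {b x}, nd (x - c' b) < 2 * ρ' →
      Exc S k c ρ (x + k * S.α) (p (c' b)).2 := fun {b x} hb => by
    have := (hp _ (hc5 b)).2.exc (hitin hb)
    push_cast at this
    convert this using 1; ring
  have hvis : ∀ {z x u : ℝ} {t : ℤ}, nd (z - u) < 2 * ρ' → InJ c' (2 * ρ') (z + t * S.α) →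
      S.itin c ρ u t := fun {z x u t} hz h => by
    refine InJ.congr_nd (hsub h) ?_
    rw [add_sub_add_right_eq_sub]
    linarith
  have hgood : ∀ {z u : ℝ} {n : ℕ} {s : ℤ}, nd (z - u) < 2 * ρ' →
      Exc S k c' ρ' (z + s * S.α) n → Chain S k d' η Γ' z (S.itin c ρ u) s n :=
    fun {z u n s} hz hE => by
      have I : Itin S c ρ z (S.itin c ρ u) := itin_spec (by linarith)
      refine chain D C I n s hE.one_le (hvis (x := z) hz ?_) (hvis (x := z) hz ?_) fun t h1 h2 hV => ?_
      · have := hE.left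
        push_cast
        convert this using 1; ring
      · have := hE.right
        push_cast
        convert this using 1; ring
      · obtain ⟨b, hb⟩ := I.inJ t hV
        refine ⟨b, hb, hzone b _ hb fun b' => ?_⟩
        obtain ⟨m, hm⟩ := Int.eq_ofNat_of_zero_le (by lia : 0 ≤ t - s)
        have := hE.inter m (by lia) (by lia)
        have e : z + s * S.α + m * S.α = z + t * S.α := by
          have : t = s + m := by lia
          rw [this]; push_cast; ring
        rw [e] at this
        by_contra! hlt
        exact this ⟨b', hlt⟩
  refine ⟨fun b => S.joint (S.nQ k μ) k (p (c' b)).1 (p (c' b)).2, ⟨hret, ?_, ?_, ?_, ?_, ?_, ?_,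
    D.mu_periodic, fun b => S.joint_periodic (nQ_periodic D.mu_periodic) _ _ _⟩, fun h => ?_,
    fun b x hb => D.fn b x _ _ (hnear hb) (hE₁ hb) (hE₂ hb)⟩
  · exact fun x hx => D.mu_ne x ((hsub hx).mono (by linarith))
  · intro x hx
    refine ((D.mu_inv x ((hsub hx).mono (by linarith))).mono_weight hd'.le C.hdd).mono ?_
    rw [Real.exp_le_exp]
    nlinarith [(Nat.cast_nonneg k : (0:ℝ) ≤ k), C.hΓΓ]
  · intro x hx i j
    refine ((D.nQ_jet x ((hsub hx).mono (by linarith)) i j).mono_weight hd'.le C.hdd).mono ?_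
    exact one_div_le_one_div_of_le hd' C.hdd
  · intro z n hE
    have := (hgood (z := z) (u := z) (s := 0) (by rw [nd_self]; linarith)
      (by simpa using hE)).good
    simpa using this
  · intro b x i j hb hEi hEj
    have c₁ := (hgood (s := -i) hb (by
      push_cast; convert hEi using 1; ring)).y
    have c₂ := hgood (s := k) hb (by push_cast; exact hEj)
    have D₁ := (hp _ (hc5 b)).1
    have D₂ := (hp _ (hc5 b)).2
    obtain ⟨i₁, ho₁, hy⟩ := c₁
    obtain ⟨j₁, ho₂, hw⟩ := c₂.w
    rw [show (-i + i - i₁ : ℤ) = 0 - i₁ by ring] at ho₁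
    rw [zero_add] at D₂
    have e₁ := ho₁.left_unique D (hitin hb) C.hM D₁
    have e₂ := ho₂.right_unique D₂
    subst e₁ e₂
    have hy' := jet_shift_y (x := x) (i := i) (by
      convert hy using 1; push_cast; ring)
    have hJ : InJ c (2 * ρ) x := ⟨b, hnear hb⟩
    have hw' : JetBound d' (fun x => S.w j x - S.w (p (c' b)).2 x) (x + k * S.α) η := by
      refine JetBound.mono (by exact_mod_cast hw) ?_
      have : (0:ℝ) ≤ (1 / 2) ^ j := by positivity
      nlinarith [C.hη]
    have hwj : JetBound d' (S.w j) (x + k * S.α) 1 :=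
      JetBound.mono (by exact_mod_cast c₂.good.w) (by linarith)
    exact (joint_close hd'.le (fun r s => (D.nQ_jet x hJ r s).mono_weight hd'.le C.hdd) hy'
      hw'.comp_add_const ((D.y_jet hd (hE₁ hb)).mono_weight hd'.le C.hdd)
      hwj.comp_add_const).mono hε'
  · intro b x hb
    refine JetBound.mono (joint_jet hd'.le
      (fun r s => (D.nQ_jet x ⟨b, hnear hb⟩ r s).mono_weight hd'.le C.hdd)
      ((D.y_jet hd (hE₁ hb)).mono_weight hd'.le C.hdd)
      ((D.w_jet hd (hE₂ hb)).mono_weight hd'.le C.hdd)) ?_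
    have := one_div_le_one_div_of_le hd' C.hdd
    have h0 : 0 < 1 / d' := by positivity
    have : 5 / d' = 5 * (1 / d') := by ring
    linarith
  · simp only [h]

end NonRes

end Sys

namespace Sys

variable {S : Sys}

/-- The middle factor of a pair of joints. -/
def mid (S : Sys) (l : ℕ) (x : ℝ) : M2 :=
  !![1, -S.w l x; S.y l x, (S.a l x)⁻¹ * (S.a l x)⁻¹ - S.w l x * S.y l x]

theorem P_eq_smul_mid {l : ℕ} {x : ℝ} (h : S.a l x ≠ 0) : S.P l x = S.a l x • S.mid l x := by
  obtain ⟨e1, e2, e3, e4⟩ := S.entry_eq h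
  ext i j
  fin_cases i <;> fin_cases j
  · simpa [mid] using e1
  · simpa [mid] using e2
  · simpa [mid] using e3
  · simpa [mid, pow_two] using e4

/-- The normalisation of a pair of joints. -/
def pairμ (S : Sys) (k l : ℕ) (μ : ℝ → ℝ) (x : ℝ) : ℝ :=
  μ x * S.a l (x + k * S.α) * μ (x + (k + l : ℕ) * S.α)

theorem pairμ_periodic {k l : ℕ} {μ : ℝ → ℝ} (hμ : Function.Periodic μ 1) :
    Function.Periodic (S.pairμ k l μ) 1 := fun x => by
  rw [pairμ, pairμ, hμ, add_right_comm x 1 (k * S.α), S.a_periodic, add_right_comm x 1, hμ]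

theorem nQ_pair {k l : ℕ} {μ : ℝ → ℝ} {x : ℝ} (h : S.a l (x + k * S.α) ≠ 0) :
    S.nQ (k + (k + l)) (S.pairμ k l μ) x =
      S.nQ k μ (x + (k + l : ℕ) * S.α) * S.mid l (x + k * S.α) * S.nQ k μ x := by
  rw [nQ, Q_joint, P_eq_smul_mid h, nQ, nQ, pairμ, mul_inv, mul_inv]
  simp only [Matrix.smul_mul, Matrix.mul_smul, smul_smul]
  congr 1
  field_simp

theorem joint_pair {k l i j : ℕ} {μ : ℝ → ℝ} {x : ℝ} (h : S.a l (x + k * S.α) ≠ 0) :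
    S.joint (S.nQ (k + (k + l)) (S.pairμ k l μ)) (k + (k + l)) i j x =
      S.joint (S.nQ k μ) k l j (x + (k + l : ℕ) * S.α) * S.joint (S.nQ k μ) k i l x
      + (S.a l (x + k * S.α))⁻¹ * (S.a l (x + k * S.α))⁻¹
        * (S.nQ k μ (x + (k + l : ℕ) * S.α) 0 1
          - S.w j (x + (k + l : ℕ) * S.α + k * S.α) * S.nQ k μ (x + (k + l : ℕ) * S.α) 1 1)
        * (S.nQ k μ x 1 0 + S.nQ k μ x 1 1 * S.y i (x - i * S.α)) := by
  have e1 : x + ((k + (k + l) : ℕ) : ℝ) * S.α = x + (k + l : ℕ) * S.α + k * S.α := by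
    push_cast; ring
  have e2 : x + ((k + l : ℕ) : ℝ) * S.α - l * S.α = x + k * S.α := by
    push_cast; ring
  simp only [joint, nQ_pair h, e1, e2, Matrix.mul_apply, Fin.sum_univ_two]
  generalize S.nQ k μ x = A
  generalize S.nQ k μ (x + (k + l : ℕ) * S.α) = B
  simp [mid]
  ring

theorem mid_jet {h b x : ℝ} {l : ℕ} (h0 : 0 ≤ h) (hb : b ≤ 1) (G : Good S h l x b 1)
    (r s : Fin 2) : JetBound h (fun x => S.mid l x r s) x 2 := by
  have hb0 := G.inv.nonneg h0
  fin_cases r <;> fin_cases s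
  · exact (JetBound.const 1).mono (by norm_num)
  · exact G.w.neg.mono (by norm_num)
  · exact G.y.mono (by norm_num)
  · exact ((G.inv.mul G.inv h0).sub (G.w.mul G.y h0) h0).mono (by nlinarith)

section Res

variable {k m : ℕ} {M M' d ρ ρ' Γ ε ε' d' e η Γ' T : ℝ} {c c' : Bool → ℝ} {F : Bool → ℝ → ℝ}
  {μ : ℝ → ℝ} {q : Bool}

/-- Passing to the next scale when the two critical points interact. -/
theorem res_step (D : Dyn S k M d ρ Γ ε c F μ) (C : Scale M d Γ ε d' e η Γ')
    (hρ' : 0 < ρ') (hρρ : 100 * ρ' ≤ ρ) (hc : ∀ b, nd (c' b - c b) ≤ ρ)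
    (hzone : ∀ b x, nd (x - c b) < 2 * ρ → (∀ b', ρ' ≤ nd (x - c' b')) → e ≤ |F b x|)
    (hm : 1 ≤ m) (hmk : (m : ℝ) ≤ k + M') (hT : 2 * (k + M') ≤ T) (hM' : 0 ≤ M')
    (hres : nd (c' q + m * S.α - c' !q) < 4 * ρ')
    (hdio : ∀ t : ℕ, 1 ≤ t → t ≤ T → 64 * ρ' ≤ nd (t * S.α))
    (hdd : 8 / d ^ 2 ≤ 1 / d') (hε' : 4 * (1 / d') * η ≤ ε') :
    ∃ (F' μ' : ℝ → ℝ),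
      Dyn S (k + m) M' d' (8 * ρ') Γ' ε' (fun _ => c' q) (fun _ => F') μ' ∧
      ∀ x, nd (x - c' q) < 16 * ρ' →
        JetBound d' (fun x => F' x - F q x * F (!q) (x + m * S.α)) x
          (10 * (ε + 4 * η / d) / d) := by
  have hd := C.hd
  have hd' := C.hd'
  have hρ : 0 < ρ := by linarith
  have hk0 : (0:ℝ) ≤ k := Nat.cast_nonneg k
  have hdio' : ∀ {x y : ℝ} (t : ℕ), 1 ≤ t → (t : ℝ) ≤ T → y - x = t * S.α →
      64 * ρ' ≤ nd (x - c' q) + nd (y - c' q) := fun {x y} t h1 h2 h3 => by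
    have := hdio t h1 h2
    rw [← h3] at this
    have h4 := nd_sub_triangle y (c' q) x
    rw [nd_sub_comm (c' q) x] at h4
    linarith
  have hsh : ∀ {x y : ℝ}, y - x = m * S.α → nd (y - c' (!q)) ≤ nd (x - c' q) + 4 * ρ' :=
    fun {x y} h => by
      have h1 := nd_add_le (x - c' q) (c' q + m * S.α - c' !q)
      have h2 : x - c' q + (c' q + m * S.α - c' !q) = y - c' (!q) := by linarith
      rw [h2] at h1
      linarith
  have hsh' : ∀ {x y : ℝ}, y - x = m * S.α → nd (x - c' q) ≤ nd (y - c' (!q)) + 4 * ρ' :=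
    fun {x y} h => by
      have h1 := nd_sub_triangle (x - c' q) (y - c' (!q)) 0
      have h2 : x - c' q - (y - c' !q) = -(c' q + m * S.α - c' !q) := by linarith
      rw [h2, nd_neg, sub_zero, sub_zero] at h1
      linarith
  have hnearb : ∀ {b x r}, nd (x - c' b) < r → nd (x - c b) < r + ρ := fun {b x r} hb => by
    have := nd_sub_triangle x (c' b) (c b)
    have := hc b
    linarith
  -- the two critical points are `m` steps apart
  have hl : (k : ℝ) + M ≤ m := by
    refine D.ret (c' q) m hm ⟨q, (hc q).trans_lt (by linarith)⟩ ⟨!q, ?_⟩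
    exact (hnearb hres).trans_le (by linarith)
  obtain ⟨l, rfl⟩ : ∃ l, m = k + l := ⟨m - k, by
    have : (k : ℝ) ≤ m := by linarith [C.hM]
    have : k ≤ m := by exact_mod_cast this
    lia⟩
  have hMl : M ≤ l := by push_cast at hl; linarith
  have hl1 : 1 ≤ l := by
    have : (0 : ℝ) < l := C.hM.trans_le hMl
    exact_mod_cast this
  have hc5 : InJ c (5 / 4 * ρ) (c' q + (0 : ℤ) * S.α) :=
    ⟨q, by simpa using (hc q).trans_lt (by linarith)⟩
  have hc5' : InJ c (5 / 4 * ρ) (c' q + ((k + l : ℕ) : ℤ) * S.α) :=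
    ⟨!q, by exact_mod_cast (hnearb hres).trans_le (by linarith)⟩
  obtain ⟨i₀, hi₀⟩ := exists_old_left D C.hM hρ 0 hc5
  obtain ⟨j₀, hj₀⟩ := exists_old_right D C.hM hρ _ hc5'
  have hitin : ∀ {x}, nd (x - c' q) < 16 * ρ' → Itin S c ρ x (S.itin c ρ (c' q)) :=
    fun {x} hb => itin_spec (by linarith)
  have hE₁ : ∀ {x}, nd (x - c' q) < 16 * ρ' → Exc S k c ρ (x - i₀ * S.α) i₀ := fun {x} hb => by
    have := hi₀.exc (hitin hb)
    push_cast at this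
    convert this using 1; ring
  have hE₂ : ∀ {x}, nd (x - c' q) < 16 * ρ' →
      Exc S k c ρ (x + (k + l : ℕ) * S.α + k * S.α) j₀ := fun {x} hb => by
    have := hj₀.exc (hitin hb)
    push_cast at this ⊢
    convert this using 1; ring
  have hvis : ∀ {z u : ℝ} {t : ℤ} {b : Bool}, nd (z - u) < 16 * ρ' →
      nd (z + t * S.α - c' b) < 20 * ρ' → S.itin c ρ u t := fun {z u t b} hz h => by
    refine InJ.congr_nd (⟨b, hnearb h⟩ : InJ c _ _) ?_
    rw [add_sub_add_right_eq_sub]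
    linarith
  -- long excursions
  have hgood : ∀ {z u : ℝ} {n : ℕ} {s : ℤ}, nd (z - u) < 16 * ρ' →
      Exc S (k + (k + l)) (fun _ => c' q) (8 * ρ') (z + s * S.α) n →
      Chain S k d' η Γ' z (S.itin c ρ u) s n :=
    fun {z u n s} hz hE => by
      have I : Itin S c ρ z (S.itin c ρ u) := itin_spec (by linarith)
      obtain ⟨_, hleft⟩ := hE.left
      obtain ⟨_, hright⟩ := hE.right
      beta_reduce at hleft hright
      refine chain D C I n s hE.one_le (hvis (z := z) (b := !q) hz ?_)
        (hvis (z := z) (b := q) hz ?_) fun t h1 h2 hV => ?_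
      · refine (hsh (x := z + s * S.α - (k + (k + l) : ℕ) * S.α) ?_).trans_lt ?_
        · push_cast; ring
        · linarith
      · have : z + ((s + n : ℤ) : ℝ) * S.α = z + s * S.α + n * S.α := by push_cast; ring
        rw [this]
        linarith
      · obtain ⟨b, hb⟩ := I.inJ t hV
        refine ⟨b, hb, hzone b _ hb fun b' => ?_⟩
        have hint : ∀ v : ℤ, s < v → v < s + n → 8 * ρ' ≤ nd (z + v * S.α - c' q) :=
          fun v h1 h2 => by
            obtain ⟨a, ha⟩ := Int.eq_ofNat_of_zero_le (by lia : 0 ≤ v - s)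
            have := hE.inter a (by lia) (by lia)
            have e : z + s * S.α + a * S.α = z + v * S.α := by
              have : v = s + a := by lia
              rw [this]; push_cast; ring
            rw [e] at this
            by_contra! hlt
            exact this ⟨true, hlt⟩
        by_contra! hlt
        obtain rfl | rfl : b' = q ∨ b' = !q := by cases b' <;> cases q <;> simp
        · linarith [hint t h1 h2]
        · have h5 := hsh' (x := z + ((t - (k + l : ℕ) : ℤ) : ℝ) * S.α) (y := z + t * S.α)
            (by push_cast; ring)
          by_cases htm : s < t - (k + l : ℕ)
          · linarith [hint _ htm (by lia)]
          · obtain ⟨a, ha⟩ := Int.eq_ofNat_of_zero_le (by lia : 0 ≤ t - s)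
            have hak : ((a + k : ℕ) : ℝ) ≤ T := by
              have : a + k ≤ k + l + k := by lia
              have : ((a + k : ℕ) : ℝ) ≤ ((k + l : ℕ) : ℝ) + k := by exact_mod_cast this
              linarith
            have := hdio' (a + k) (by lia) hak (x := z + s * S.α - (k + (k + l) : ℕ) * S.α)
              (y := z + ((t - (k + l : ℕ) : ℤ) : ℝ) * S.α) (by
                have : t = s + a := by lia
                rw [this]; push_cast; ring)
            linarith
  -- the passage between the two critical points
  have hmid : ∀ {x}, nd (x - c' q) < 16 * ρ' → Chain S k d' η Γ' x (S.itin c ρ (c' q)) k l :=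
    fun {x} hx => by
      have I := hitin hx
      have hxm := hsh (x := x) (y := x + ((k + l : ℕ) : ℝ) * S.α) (by ring)
      refine chain D C I l k hl1 (hvis (z := x) (b := q) hx ?_) (hvis (z := x) (b := !q) hx ?_)
        fun t h1 h2 hV => ?_
      · simp only [sub_self, Int.cast_zero, zero_mul, add_zero]
        linarith
      · push_cast at hxm ⊢
        linarith
      · obtain ⟨b, hb⟩ := I.inJ t hV
        refine ⟨b, hb, hzone b _ hb fun b' => ?_⟩
        obtain ⟨a, ha⟩ := Int.eq_ofNat_of_zero_le (by lia : 0 ≤ t)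
        have haT : ∀ a' : ℕ, a' ≤ k + l → (a' : ℝ) ≤ T := fun a' h => by
          have : (a' : ℝ) ≤ ((k + l : ℕ) : ℝ) := by exact_mod_cast h
          linarith
        by_contra! hlt
        obtain rfl | rfl : b' = q ∨ b' = !q := by cases b' <;> cases q <;> simp
        · have := hdio' a (by lia) (haT a (by lia)) (x := x) (y := x + t * S.α) (by
            rw [ha]; push_cast; ring)
          linarith
        · have h5 := hsh' (x := x + ((t - (k + l : ℕ) : ℤ) : ℝ) * S.α) (y := x + t * S.α)
            (by push_cast; ring)
          have := hdio' (k + l - a) (by lia) (haT _ (by lia))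
            (x := x + ((t - (k + l : ℕ) : ℤ) : ℝ) * S.α) (y := x) (by
              rw [ha, Nat.cast_sub (by lia)]; push_cast; ring)
          linarith
  have hJ : ∀ {x}, nd (x - c' q) < 16 * ρ' → InJ c (2 * ρ) x := fun {x} hx =>
    ⟨q, (hnearb hx).trans_le (by linarith)⟩
  have hnm : ∀ {x}, nd (x - c' q) < 16 * ρ' →
      nd (x + (k + l : ℕ) * S.α - c !q) < 2 * ρ := fun {x} hx => by
    have hxm := hsh (x := x) (y := x + ((k + l : ℕ) : ℝ) * S.α) (by ring)
    exact (hnearb (hxm.trans_lt (by linarith : _ < 20 * ρ'))).trans_le (by linarith)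
  have hJm : ∀ {x}, nd (x - c' q) < 16 * ρ' → InJ c (2 * ρ) (x + (k + l : ℕ) * S.α) :=
    fun {x} hx => ⟨!q, hnm hx⟩
  have hGm : ∀ {x}, nd (x - c' q) < 16 * ρ' →
      Good S d' l (x + k * S.α) (Real.exp (-Γ' * l)) 1 := fun {x} hx => by
    have := (hmid hx).good
    exact this.mono hd'.le le_rfl le_rfl (by linarith)
  have hΓ0 : 0 ≤ Γ' := by linarith [C.hΓ']
  have hexp1 : Real.exp (-Γ' * l) ≤ 1 := by
    rw [Real.exp_le_one_iff]; nlinarith [(Nat.cast_nonneg l : (0:ℝ) ≤ l)]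
  have hq₁ : ∀ {x}, nd (x - c' q) < 16 * ρ' → ∀ r s,
      JetBound d' (fun x => S.nQ k μ x r s) x (1 / d) := fun {x} hx r s =>
    (D.nQ_jet x (hJ hx) r s).mono_weight hd'.le C.hdd
  have hq₂ : ∀ {x}, nd (x - c' q) < 16 * ρ' → ∀ r s,
      JetBound d' (fun x => S.nQ k μ x r s) (x + (k + l : ℕ) * S.α) (1 / d) := fun {x} hx r s =>
    (D.nQ_jet _ (hJm hx) r s).mono_weight hd'.le C.hdd
  have hne : ∀ {x}, nd (x - c' q) < 16 * ρ' → ∀ᶠ y in 𝓝 x, S.a l (y + k * S.α) ≠ 0 :=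
    fun {x} hx => (((continuous_id.add continuous_const).tendsto x :
      Tendsto (fun y => y + k * S.α) (𝓝 x) (𝓝 (x + k * S.α)))).eventually (hGm hx).eventually_ne
  have hqp : ∀ {x}, nd (x - c' q) < 16 * ρ' → ∀ r s,
      JetBound d' (fun x => S.nQ (k + (k + l)) (S.pairμ k l μ) x r s) x (1 / d') :=
    fun {x} hx r s => by
      have hM := fun r s => (mid_jet hd'.le hexp1 (hGm hx) r s).comp_add_const
      have h2 := fun r s => (hq₂ hx r s).comp_add_const
      have h1 := hq₁ hx
      refine JetBound.mono (JetBound.congr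
        (((((h2 r 0).mul (hM 0 0) hd'.le).add ((h2 r 1).mul (hM 1 0) hd'.le) hd'.le).mul
            (h1 0 s) hd'.le).add
          ((((h2 r 0).mul (hM 0 1) hd'.le).add ((h2 r 1).mul (hM 1 1) hd'.le) hd'.le).mul
            (h1 1 s) hd'.le) hd'.le) ?_)
        (le_trans (le_of_eq ?_) hdd)
      · filter_upwards [hne hx] with y hy
        rw [nQ_pair hy]
        simp only [Matrix.mul_apply, Fin.sum_univ_two]
      · field_simp
        ring
  have hy₀ : ∀ {x}, nd (x - c' q) < 16 * ρ' →
      JetBound d' (fun x => S.y i₀ (x - i₀ * S.α)) x 1 := fun {x} hx =>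
    (D.y_jet hd (hE₁ hx)).mono_weight hd'.le C.hdd
  have hw₀ : ∀ {x}, nd (x - c' q) < 16 * ρ' →
      JetBound d' (fun x => S.w j₀ (x + k * S.α)) (x + (k + l : ℕ) * S.α) 1 := fun {x} hx =>
    (D.w_jet hd (hE₂ hx)).mono_weight hd'.le C.hdd
  have hw₀' : ∀ {x}, nd (x - c' q) < 16 * ρ' →
      JetBound d' (fun x => S.w j₀ (x + (k + (k + l) : ℕ) * S.α)) x 1 := fun {x} hx => by
    refine (hw₀ hx).comp_add_const.congr (Eventually.of_forall fun y => ?_)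
    simp only
    congr 1
    push_cast; ring
  refine ⟨S.joint (S.nQ (k + (k + l)) (S.pairμ k l μ)) (k + (k + l)) i₀ j₀, S.pairμ k l μ,
    ⟨?_, ?_, ?_, ?_, ?_, ?_, ?_, pairμ_periodic D.mu_periodic, fun b =>
      S.joint_periodic (nQ_periodic (pairμ_periodic D.mu_periodic)) _ _ _⟩, ?_⟩
  · rintro x t ht ⟨_, h1⟩ ⟨_, h2⟩
    beta_reduce at h1 h2
    by_contra! hlt
    have := hdio' t ht (by push_cast at hlt hmk hT ⊢; linarith) (x := x) (y := x + t * S.α) (by ring)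
    linarith
  · rintro x ⟨_, hx⟩
    have hx : nd (x - c' q) < 16 * ρ' := by beta_reduce at hx; linarith
    exact mul_ne_zero (mul_ne_zero (D.mu_ne _ (hJ hx)) (hGm hx).ne) (D.mu_ne _ (hJm hx))
  · rintro x ⟨_, hx⟩
    have hx : nd (x - c' q) < 16 * ρ' := by beta_reduce at hx; linarith
    have h1 := (D.mu_inv _ (hJ hx)).mono_weight hd'.le C.hdd
    have h2 := (hGm hx).inv.comp_add_const
    have h3 := ((D.mu_inv _ (hJm hx)).mono_weight hd'.le C.hdd).comp_add_const
    refine JetBound.mono (JetBound.congr ((h1.mul h2 hd'.le).mul h3 hd'.le)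
      (Eventually.of_forall fun y => ?_)) ?_
    · simp only [pairμ, mul_inv]
    · rw [← Real.exp_add, ← Real.exp_add, Real.exp_le_exp]
      push_cast
      nlinarith [C.hΓΓ]
  · rintro x ⟨_, hx⟩
    exact hqp (by beta_reduce at hx; linarith)
  · intro z n hE
    have := (hgood (z := z) (u := z) (s := 0) (by rw [nd_self]; linarith)
      (by simpa using hE)).good
    simpa using this
  · intro b x i j hb hEi hEj
    have hb : nd (x - c' q) < 16 * ρ' := by beta_reduce at hb; linarith
    have c₁ := (hgood (s := -i) hb (by
      push_cast; convert hEi using 1; ring)).y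
    have c₂ := hgood (s := (k + (k + l) : ℕ)) hb (by exact_mod_cast hEj)
    obtain ⟨i₁, ho₁, hy⟩ := c₁
    obtain ⟨j₁, ho₂, hw⟩ := c₂.w
    rw [show (-i + i - i₁ : ℤ) = 0 - i₁ by ring] at ho₁
    have hj₀' : Old k (S.itin c ρ (c' q)) ((k + (k + l) : ℕ)) j₀ := by
      convert hj₀ using 1; push_cast; ring
    have e₁ := ho₁.left_unique D (hitin hb) C.hM hi₀
    have e₂ := ho₂.right_unique hj₀'
    subst e₁ e₂
    have hy' := jet_shift_y (x := x) (i := i) (by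
      convert hy using 1; push_cast; ring)
    have hw' : JetBound d' (fun x => S.w j x - S.w j₁ x) (x + (k + (k + l) : ℕ) * S.α) η := by
      refine JetBound.mono (by exact_mod_cast hw) ?_
      have : (0:ℝ) ≤ (1 / 2) ^ j := by positivity
      nlinarith [C.hη]
    have hwj : JetBound d' (S.w j) (x + (k + (k + l) : ℕ) * S.α) 1 :=
      JetBound.mono (by exact_mod_cast c₂.good.w) (by linarith)
    exact (joint_close hd'.le (hqp hb) hy' hw'.comp_add_const (hy₀ hb)
      hwj.comp_add_const).mono hε'
  · intro b x hb
    have hb : nd (x - c' q) < 16 * ρ' := by beta_reduce at hb; linarith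
    refine JetBound.mono (joint_jet hd'.le (hqp hb) (hy₀ hb) (hw₀' hb)) ?_
    have h0 : 0 < 1 / d' := by positivity
    have : 5 / d' = 5 * (1 / d') := by ring
    linarith
  · intro x hx
    have hG := hGm hx
    obtain ⟨i₁, ho₁, hy⟩ := (hmid hx).y
    obtain ⟨j₁, ho₂, hw⟩ := (hmid hx).w
    have hx₁ : nd (x - c q) < 2 * ρ := (hnearb hx).trans_le (by linarith)
    have hEj : Exc S k c ρ (x + k * S.α) j₁ := by
      have := ho₂.exc (hitin hx)
      exact_mod_cast this
    have hEi : Exc S k c ρ (x + (k + l : ℕ) * S.α - i₁ * S.α) i₁ := by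
      have := ho₁.exc (hitin hx)
      push_cast at this ⊢
      convert this using 1; ring
    have hη0 := C.hη
    have hwl : JetBound d' (fun x => S.w l (x + k * S.α)) x 1 := hG.w.comp_add_const
    have hyl : JetBound d' (fun x => S.y l (x - l * S.α)) (x + (k + l : ℕ) * S.α) 1 := by
      have h1 : JetBound d' (S.y l) (x + (k + l : ℕ) * S.α + -(l * S.α)) 1 := by
        convert hG.y using 1; push_cast; ring
      exact h1.comp_add_const.congr (Eventually.of_forall fun y => by simp only [sub_eq_add_neg])
    have hy' := jet_shift_y (x := x + (k + l : ℕ) * S.α) (i := l) (by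
      convert hy using 1; push_cast; ring)
    have hw' : JetBound d' (fun x => S.w l x - S.w j₁ x) (x + k * S.α) η := by
      refine JetBound.mono (by exact_mod_cast hw) ?_
      have : (0:ℝ) ≤ (1 / 2) ^ l := by positivity
      nlinarith [C.hη]
    have hz : ∀ {f : ℝ → ℝ} {x : ℝ}, JetBound d' (fun x => f x - f x) x η := fun {f x} => by
      simp only [sub_self]
      exact (JetBound.const 0).mono (by simpa using hη0)
    have hF₁ : JetBound d' (fun x => S.joint (S.nQ k μ) k i₀ l x - F q x) x
        (ε + 4 * (1 / d) * η) := by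
      refine (((D.fn q x i₀ j₁ hx₁ (hE₁ hx) hEj).mono_weight hd'.le C.hdd).add
        (joint_close hd'.le (hq₁ hx) hz hw'.comp_add_const (hy₀ hx) hwl) hd'.le).congr
        (Eventually.of_forall fun y => ?_)
      simp only
      ring
    have hF₂ : JetBound d' (fun x => S.joint (S.nQ k μ) k l j₀ x - F (!q) x)
        (x + (k + l : ℕ) * S.α) (ε + 4 * (1 / d) * η) := by
      refine (((D.fn (!q) _ i₁ j₀ (hnm hx) hEi (hE₂ hx)).mono_weight hd'.le C.hdd).add
        (joint_close hd'.le (hq₂ hx) hy' hz ((D.y_jet hd hEi).mono_weight hd'.le C.hdd) (hw₀ hx))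
        hd'.le).congr (Eventually.of_forall fun y => ?_)
      simp only
      ring
    have hJ₁ := joint_jet hd'.le (hq₁ hx) (hy₀ hx) hwl
    have hFq := ((D.F_jet (!q) _ (hnm hx)).mono_weight hd'.le C.hdd).comp_add_const
    have hr := ((hG.inv.mul hG.inv hd'.le).comp_add_const.mul
      ((hq₂ hx 0 1).sub ((hw₀ hx).mul (hq₂ hx 1 1) hd'.le) hd'.le).comp_add_const hd'.le).mul
      ((hq₁ hx 1 0).add ((hq₁ hx 1 1).mul (hy₀ hx) hd'.le) hd'.le) hd'.le
    refine JetBound.mono (JetBound.congr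
      (((hF₂.comp_add_const.mul hJ₁ hd'.le).add (hFq.mul hF₁ hd'.le) hd'.le).add hr hd'.le) ?_) ?_
    · filter_upwards [hne hx] with y hy
      rw [joint_pair hy]
      ring
    · have h1 : Real.exp (-Γ' * l) * Real.exp (-Γ' * l) ≤ Real.exp (-Γ' * M) := by
        have h1 : Real.exp (-Γ' * l) ≤ Real.exp (-Γ' * M) := by
          rw [Real.exp_le_exp]; nlinarith
        have := mul_le_mul h1 hexp1 (Real.exp_nonneg _) (Real.exp_nonneg _)
        linarith
      have h2 : 8 / d * Real.exp (-Γ' * M) ≤ η / 2 := by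
        refine le_trans ?_ C.hw
        have : 4 ≤ 4 / e := by rw [le_div_iff₀ C.he]; linarith [C.he1]
        have h3 : 2 / d * 4 ≤ 2 / d * (4 / e) := by gcongr
        calc 8 / d * Real.exp (-Γ' * M) = 2 / d * 4 * Real.exp (-Γ' * M) := by ring
          _ ≤ _ := by gcongr
      have h3 : Real.exp (-Γ' * l) * Real.exp (-Γ' * l) * (4 / d ^ 2) ≤ η / 4 / d := by
        calc _ ≤ Real.exp (-Γ' * M) * (4 / d ^ 2) := by gcongr
          _ = 8 / d * Real.exp (-Γ' * M) / (2 * d) := by field_simp; norm_num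
          _ ≤ η / 2 / (2 * d) := by gcongr
          _ = _ := by field_simp; norm_num
      have h4 : 0 ≤ ε / d := div_nonneg C.hε hd.le
      have h5 : 0 ≤ η / d := div_nonneg hη0 hd.le
      have h6 : η / d ≤ η / d / d := by
        rw [le_div_iff₀ hd]; nlinarith [C.hd1]
      calc _ = 9 * (ε / d) + 36 * (η / d / d)
            + Real.exp (-Γ' * l) * Real.exp (-Γ' * l) * (4 / d ^ 2) := by field_simp; ring
        _ ≤ 9 * (ε / d) + 36 * (η / d / d) + η / 4 / d := by gcongr
        _ ≤ 10 * (ε / d) + 40 * (η / d / d) := by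
            have : η / 4 / d = η / d / 4 := by ring
            linarith
        _ = _ := by field_simp; ring

end Res

end Sys

/-! ### Convex profiles -/

theorem mul_sub_le_of_le_deriv {f : ℝ → ℝ} {v x y : ℝ} (hxy : x ≤ y)
    (h1 : ∀ z ∈ Set.Icc x y, DifferentiableAt ℝ f z) (h2 : ∀ z ∈ Set.Icc x y, v ≤ deriv f z) :
    v * (y - x) ≤ f y - f x := by
  refine (convex_Icc x y).mul_sub_le_image_sub_of_le_deriv
    (fun z hz => (h1 z hz).continuousAt.continuousWithinAt)
    (fun z hz => (h1 z (interior_subset hz)).differentiableWithinAt)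
    (fun z hz => h2 z (interior_subset hz)) x ⟨le_rfl, hxy⟩ y ⟨hxy, le_rfl⟩ hxy

theorem abs_sub_le_of_abs_deriv_le {f : ℝ → ℝ} {v x y : ℝ}
    (h1 : ∀ z ∈ Set.uIcc x y, DifferentiableAt ℝ f z)
    (h2 : ∀ z ∈ Set.uIcc x y, |deriv f z| ≤ v) : |f y - f x| ≤ v * |y - x| := by
  have := (convex_uIcc x y).norm_image_sub_le_of_norm_deriv_le (f := f) (C := v) h1 h2
    Set.left_mem_uIcc Set.right_mem_uIcc
  simpa using this

theorem quadratic_lower_bound {g : ℝ → ℝ} {a b d x y : ℝ}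
    (h1 : ∀ x ∈ Set.Ioo a b, DifferentiableAt ℝ g x)
    (h2 : ∀ x ∈ Set.Ioo a b, DifferentiableAt ℝ (deriv g) x)
    (h3 : ∀ x ∈ Set.Ioo a b, d ≤ deriv (deriv g) x) (hx : x ∈ Set.Ioo a b)
    (hy : y ∈ Set.Ioo a b) :
    g x + deriv g x * (y - x) + d / 2 * (y - x) ^ 2 ≤ g y := by
  have hsub : ∀ {u v}, u ∈ Set.Ioo a b → v ∈ Set.Ioo a b → Set.Icc u v ⊆ Set.Ioo a b :=
    fun hu hv z hz => ⟨hu.1.trans_le hz.1, hz.2.trans_lt hv.2⟩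
  have hmono : ∀ {u v}, u ∈ Set.Ioo a b → v ∈ Set.Ioo a b → u ≤ v →
      d * (v - u) ≤ deriv g v - deriv g u := fun hu hv huv =>
    mul_sub_le_of_le_deriv huv (fun z hz => h2 z (hsub hu hv hz)) fun z hz => h3 z (hsub hu hv hz)
  let k : ℝ → ℝ := fun z => g z - deriv g x * (z - x) - d / 2 * (z - x) ^ 2
  have hk : ∀ z ∈ Set.Ioo a b, HasDerivAt k (deriv g z - deriv g x - d * (z - x)) z :=
    fun z hz => by
      have e1 := (h1 z hz).hasDerivAt
      have e2 : HasDerivAt (fun z : ℝ => z - x) 1 z := (hasDerivAt_id z).sub_const x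
      exact ((e1.sub (e2.const_mul (deriv g x))).sub ((e2.pow 2).const_mul (d / 2))).congr_deriv
        (by simp; ring)
  rcases le_total x y with h | h
  · have := mul_sub_le_of_le_deriv (f := k) (v := 0) h
      (fun z hz => (hk z (hsub hx hy hz)).differentiableAt) fun z hz => by
        rw [(hk z (hsub hx hy hz)).deriv]
        linarith [hmono hx (hsub hx hy hz) hz.1]
    simp only [k, sub_self] at this
    linarith
  · have := mul_sub_le_of_le_deriv (f := fun z => -k z) (v := 0) h
      (fun z hz => (hk z (hsub hy hx hz)).differentiableAt.neg) fun z hz => by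
        rw [(hk z (hsub hy hx hz)).fun_neg.deriv]
        linarith [hmono (hsub hy hx hz) hx hz.2]
    simp only [k, sub_self] at this
    linarith

theorem chord_bound {G D v η A B : ℝ} (h0 : G + D * B ≤ -v) (h1 : G - D * A ≤ 0) (hv : 0 ≤ v)
    (hη : 0 ≤ η) (hA : η ≤ A) (hB : 0 ≤ B) (hAB : A + B ≤ 1) (hpos : 0 < A + B) :
    v * η ≤ -G := by
  have f1 := mul_le_mul_of_nonneg_left h0 (hη.trans hA)
  have f2 := mul_le_mul_of_nonneg_left h1 hB
  have f3 : v * η ≤ v * A := mul_le_mul_of_nonneg_left hA hv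
  have f4 : G * (A + B) ≤ -(v * η) := by linarith
  have f5 : 0 ≤ v * η := mul_nonneg hv hη
  by_contra! hcon
  have f6 := mul_lt_mul_of_pos_right (by linarith : -(v * η) < G) hpos
  have f7 := mul_le_mul_of_nonneg_left hAB f5
  linarith

/-- A convex profile which is positive away from a ball either stays essentially positive, except
near one point, or has two transversal zeros. -/
theorem convex_profile {g : ℝ → ℝ} {c r d δ : ℝ} (hr : 0 < r) (hr' : r ≤ 1 / 2) (hd : 0 < d)
    (hδ : 0 ≤ δ) (hδ' : δ ≤ 1)
    (h1 : ∀ x ∈ Set.Ioo (c - 2 * r) (c + 2 * r), DifferentiableAt ℝ g x)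
    (h2 : ∀ x ∈ Set.Ioo (c - 2 * r) (c + 2 * r), DifferentiableAt ℝ (deriv g) x)
    (h3 : ∀ x ∈ Set.Ioo (c - 2 * r) (c + 2 * r), d ≤ deriv (deriv g) x)
    (hout : ∀ x ∈ Set.Ioo (c - 2 * r) (c + 2 * r), r ≤ |x - c| → d ≤ g x) :
    (∃ m, |m - c| ≤ r ∧
      ∀ x ∈ Set.Ioo (c - 2 * r) (c + 2 * r), δ ≤ |x - m| → d * δ ^ 2 / 4 ≤ g x) ∨
    ∃ z₁ z₂, |z₁ - c| ≤ r ∧ |z₂ - c| ≤ r ∧ g z₁ = 0 ∧ g z₂ = 0 ∧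
      deriv g z₁ ≤ -(d * δ ^ 2 / 4) ∧ d * δ ^ 2 / 4 ≤ deriv g z₂ ∧
      ∀ x η, |x - c| ≤ r → 0 ≤ η → η ≤ |x - z₁| → η ≤ |x - z₂| → d * δ ^ 2 / 4 * η ≤ |g x| := by
  have hmem : ∀ {x}, |x - c| ≤ r → x ∈ Set.Ioo (c - 2 * r) (c + 2 * r) := fun {x} h => by
    rw [abs_le] at h
    constructor <;> linarith
  have hIcc : ∀ {x}, x ∈ Set.Icc (c - r) (c + r) → |x - c| ≤ r := fun {x} h => by
    rw [abs_le]; constructor <;> linarith [h.1, h.2]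
  have hcont : ContinuousOn g (Set.Icc (c - r) (c + r)) := fun x hx =>
    (h1 x (hmem (hIcc hx))).continuousAt.continuousWithinAt
  have hT : ∀ {x y}, |x - c| ≤ r → y ∈ Set.Ioo (c - 2 * r) (c + 2 * r) →
      g x + deriv g x * (y - x) + d / 2 * (y - x) ^ 2 ≤ g y := fun hx hy =>
    quadratic_lower_bound h1 h2 h3 (hmem hx) hy
  have hδ2 : δ ^ 2 ≤ 1 := by nlinarith
  have hdδ : d * δ ^ 2 ≤ d := by nlinarith
  have hdδ0 : 0 ≤ d * δ ^ 2 := by positivity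
  have hb1 : |c - r - c| = r := by rw [sub_sub_cancel_left, abs_neg, abs_of_pos hr]
  have hb2 : |c + r - c| = r := by rw [add_sub_cancel_left, abs_of_pos hr]
  have hg1 : d ≤ g (c - r) := hout _ (hmem hb1.le) hb1.ge
  have hg2 : d ≤ g (c + r) := hout _ (hmem hb2.le) hb2.ge
  obtain ⟨m, hm, hmin⟩ := isCompact_Icc.exists_isMinOn
    (Set.nonempty_Icc.2 (by linarith : c - r ≤ c + r)) hcont
  by_cases hcase : -(d * δ ^ 2 / 4) ≤ g m
  · left
    refine ⟨m, hIcc hm, fun x hx hxm => ?_⟩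
    by_cases hx' : r ≤ |x - c|
    · linarith [hout x hx hx']
    · push Not at hx'
      have hxI : x ∈ Set.Icc (c - r) (c + r) := by
        rw [abs_lt] at hx'; constructor <;> linarith
      by_cases hbig : d / 2 ≤ g m
      · have := hmin hxI
        simp only [Set.mem_ofPred_eq] at this
        linarith
      · push Not at hbig
        have hint : m ∈ Set.Ioo (c - r) (c + r) := by
          refine ⟨lt_of_le_of_ne hm.1 ?_, lt_of_le_of_ne hm.2 ?_⟩ <;> rintro rfl <;> linarith
        have hloc : IsLocalMin g m := hmin.isLocalMin (Icc_mem_nhds hint.1 hint.2)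
        have := hT (hIcc hm) hx
        rw [hloc.deriv_eq_zero] at this
        have hsq : δ ^ 2 ≤ (x - m) ^ 2 := by
          rw [← sq_abs (x - m)]; gcongr
        nlinarith
  · right
    push Not at hcase
    have hm1 : c - r ≤ m := hm.1
    have hm2 : m ≤ c + r := hm.2
    obtain ⟨z₁, hz₁, hgz₁⟩ : ∃ z ∈ Set.Icc (c - r) m, g z = 0 :=
      intermediate_value_Icc' hm1 (hcont.mono (Set.Icc_subset_Icc_right hm2))
        ⟨by linarith, by linarith⟩
    obtain ⟨z₂, hz₂, hgz₂⟩ : ∃ z ∈ Set.Icc m (c + r), g z = 0 :=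
      intermediate_value_Icc hm2 (hcont.mono (Set.Icc_subset_Icc_left hm1))
        ⟨by linarith, by linarith⟩
    have hc1 : |z₁ - c| ≤ r := hIcc ⟨hz₁.1, hz₁.2.trans hm2⟩
    have hc2 : |z₂ - c| ≤ r := hIcc ⟨hm1.trans hz₂.1, hz₂.2⟩
    have hlt1 : z₁ < m := lt_of_le_of_ne hz₁.2 (by rintro rfl; linarith)
    have hlt2 : m < z₂ := lt_of_le_of_ne hz₂.1 (by rintro rfl; linarith)
    have hd1 : deriv g z₁ ≤ -(d * δ ^ 2 / 4) := by
      have := hT hc1 (hmem (hIcc hm))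
      have h4 : deriv g z₁ * (m - z₁) < -(d * δ ^ 2 / 4) := by nlinarith [sq_nonneg (m - z₁)]
      have h5 : m - z₁ ≤ 1 := by linarith [hz₁.1]
      by_contra! hcon
      nlinarith
    have hd2 : d * δ ^ 2 / 4 ≤ deriv g z₂ := by
      have := hT hc2 (hmem (hIcc hm))
      have h4 : deriv g z₂ * (m - z₂) < -(d * δ ^ 2 / 4) := by nlinarith [sq_nonneg (m - z₂)]
      have h5 : z₂ - m ≤ 1 := by linarith [hz₂.2]
      by_contra! hcon
      nlinarith
    refine ⟨z₁, z₂, hc1, hc2, hgz₁, hgz₂, hd1, hd2, fun x η hx hη hx1 hx2 => ?_⟩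
    rcases lt_or_ge x z₁ with hlt | hge
    · rw [abs_of_neg (by linarith)] at hx1
      have := hT hc1 (hmem hx)
      refine le_trans ?_ (le_abs_self _)
      nlinarith [sq_nonneg (x - z₁)]
    rcases lt_or_ge z₂ x with hlt | hle
    · rw [abs_of_pos (by linarith)] at hx2
      have := hT hc2 (hmem hx)
      refine le_trans ?_ (le_abs_self _)
      nlinarith [sq_nonneg (x - z₂)]
    rw [abs_of_nonneg (by linarith)] at hx1
    rw [abs_of_nonpos (by linarith)] at hx2
    have e0 := hT hx (hmem (hIcc hm))
    have e1 := hT hx (hmem hc1)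
    have e2 := hT hx (hmem hc2)
    rw [hgz₁] at e1
    rw [hgz₂] at e2
    refine le_trans ?_ (neg_le_abs _)
    have s0 := sq_nonneg (m - x)
    have s1 := sq_nonneg (z₁ - x)
    have s2 := sq_nonneg (z₂ - x)
    have hd0 : 0 ≤ d / 2 := by positivity
    rcases le_total x m with hxm | hxm
    · refine chord_bound (D := deriv g x) (A := x - z₁) (B := m - x) ?_ ?_ (by positivity) hη hx1
        ?_ ?_ ?_ <;> first | linarith [hz₁.1] | skip
      · linarith [mul_nonneg hd0 s0]
      · linarith [mul_nonneg hd0 s1]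
    · refine chord_bound (D := -deriv g x) (A := z₂ - x) (B := x - m) ?_ ?_ (by positivity) hη
        (by linarith) ?_ ?_ ?_ <;> first | linarith [hz₂.2] | skip
      · linarith [mul_nonneg hd0 s0]
      · linarith [mul_nonneg hd0 s2]

/-! ### Shapes of the critical functions -/

theorem pow_small {d : ℝ} (hd0 : 0 < d) (hd : d ≤ 1 / 10000) {m n : ℕ} (h : m < n) :
    10000 * d ^ n ≤ d ^ m := by
  obtain ⟨l, rfl⟩ : ∃ l, n = m + 1 + l := ⟨n - (m + 1), by lia⟩
  have h1 : d ^ l ≤ 1 := pow_le_one₀ hd0.le (by linarith)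
  have h2 : 0 < d ^ m := by positivity
  calc 10000 * d ^ (m + 1 + l) = d ^ m * (10000 * d) * d ^ l := by ring
    _ ≤ d ^ m * 1 * 1 := by gcongr; linarith
    _ = d ^ m := by ring

/-- The two critical functions cross zero transversally, in opposite directions. -/
structure CrossShape (p : ℕ) (d ρ : ℝ) (c : Bool → ℝ) (F : Bool → ℝ → ℝ) (c' : Bool → ℝ) :
    Prop where
  near : ∀ b, nd (c' b - c b) ≤ ρ
  zero : ∀ b, F b (c' b) = 0
  slope : ∃ s : Bool → ℝ, (∀ b, |s b| = 1) ∧ s true * s false = -1 ∧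
    ∀ b x, |x - c' b| ≤ 64 * d ^ (4 * p + 12) → d ^ (2 * p + 2) ≤ s b * deriv (F b) x
  zone : ∀ b x, nd (x - c b) < 2 * ρ → (∀ b', d ^ (4 * p + 12) ≤ nd (x - c' b')) →
    d ^ (6 * p + 16) ≤ |F b x|

/-- The critical function has a single, nondegenerate, critical point. -/
structure TangentShape (p : ℕ) (d ρ : ℝ) (c : Bool → ℝ) (F : Bool → ℝ → ℝ) (c' : Bool → ℝ) :
    Prop where
  near : ∀ b, nd (c' b - c b) ≤ ρ
  center_eq : c' true = c' false
  fun_eq : F true = F false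
  convex : ∃ s : ℝ, |s| = 1 ∧
    (∀ x, |x - c' true| ≤ 4 * d ^ p → d ≤ s * deriv (deriv (F true)) x) ∧
    ∀ x, d ^ p ≤ |x - c' true| → |x - c' true| ≤ 2 * d ^ p → d ^ (6 * p + 16) ≤ s * F true x
  zone : ∀ b x, nd (x - c b) < 2 * ρ → d ^ p ≤ nd (x - c' true) → d ^ (6 * p + 16) ≤ |F b x|

theorem exists_nd_eq_abs (x c : ℝ) : ∃ m : ℤ, |x - m - c| = nd (x - c) ∧
    ∀ z, nd (x - m - z) = nd (x - z) := by
  obtain ⟨m, hm⟩ := exists_int_abs_eq_nd (x - c)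
  refine ⟨m, by rw [← hm]; ring_nf, fun z => ?_⟩
  rw [← nd_sub_int (x - z) m]; ring_nf

theorem deriv_mul_eq {s : ℝ} (f : ℝ → ℝ) :
    deriv (fun x => s * f x) = fun x => s * deriv f x := by
  funext x
  exact deriv_const_mul_field s

theorem abs_mul_of_abs_eq_one {s : ℝ} (hs : |s| = 1) (y : ℝ) : |s * y| = |y| := by
  rw [abs_mul, hs, one_mul]

/-- A function which is convex near a point and positive elsewhere has one of the two shapes. -/
theorem exists_shape {p : ℕ} {d ρ r c₀ s : ℝ} {c : Bool → ℝ} {f : ℝ → ℝ} (hp : 2 ≤ p)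
    (hd0 : 0 < d) (hd : d ≤ 1 / 10000) (hdr : d ≤ r) (hr : r ≤ 1 / 2) (hs : |s| = 1)
    (hf : Function.Periodic f 1) (hj : ∀ x, |x - c₀| < 2 * r → JetBound d f x (5 / d))
    (hconv : ∀ x, |x - c₀| < 2 * r → d ≤ s * deriv (deriv f) x)
    (hout : ∀ b x, nd (x - c b) < 2 * ρ → r ≤ nd (x - c₀) → d ≤ s * f x)
    (hloc : ∀ x, r ≤ |x - c₀| → |x - c₀| < 2 * r → d ≤ s * f x)
    (hin : ∀ b x, |x - c₀| ≤ r → nd (x - c b) ≤ ρ) :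
    ∃ c', CrossShape p d ρ c (fun _ => f) c' ∨ TangentShape p d ρ c (fun _ => f) c' := by
  have hr0 : 0 < r := hd0.trans_le hdr
  have hd1 : d ≤ 1 := by linarith
  have hdeq := deriv_mul_eq (s := s) f
  have hdeq2 : deriv (deriv (fun x => s * f x)) = fun x => s * deriv (deriv f) x := by
    rw [hdeq, deriv_mul_eq]
  have hmem : ∀ {x}, x ∈ Set.Ioo (c₀ - 2 * r) (c₀ + 2 * r) → |x - c₀| < 2 * r := fun {x} hx => by
    rw [abs_lt]; constructor <;> linarith [hx.1, hx.2]
  have hmem' : ∀ {x}, |x - c₀| < 2 * r → x ∈ Set.Ioo (c₀ - 2 * r) (c₀ + 2 * r) := fun {x} hx => by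
    rw [abs_lt] at hx; constructor <;> linarith [hx.1, hx.2]
  have hpd : d ^ p ≤ d ^ 2 := pow_le_pow_of_le_one hd0.le hd1 hp
  have hd2 : 10000 * d ^ 2 ≤ d ^ 1 := pow_small hd0 hd (by norm_num)
  rw [pow_one] at hd2
  have hdp0 : 0 < d ^ p := by positivity
  have hv : d * (d ^ p) ^ 2 / 4 = d ^ (2 * p + 1) / 4 := by ring
  have hv1 : 10000 * d ^ (2 * p + 2) ≤ d ^ (2 * p + 1) := pow_small hd0 hd (by lia)
  have hv0 : 0 < d ^ (2 * p + 2) := by positivity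
  have hE : 10000 * d ^ (6 * p + 16) ≤ d ^ (2 * p + 1) := pow_small hd0 hd (by lia)
  have hEd : 10000 * d ^ (6 * p + 16) ≤ d ^ 1 := pow_small hd0 hd (by lia)
  rw [pow_one] at hEd
  have hE0 : 0 < d ^ (6 * p + 16) := by positivity
  rcases convex_profile (g := fun x => s * f x) (c := c₀) (δ := d ^ p) hr0 hr hd0 hdp0.le
      (by nlinarith) (fun x hx => (hj x (hmem hx)).hasDerivAt_self.differentiableAt.const_mul s)
      (fun x hx => by
        rw [hdeq]
        exact (hj x (hmem hx)).hasDerivAt_deriv.differentiableAt.const_mul s)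
      (fun x hx => by rw [hdeq2]; exact hconv x (hmem hx))
      (fun x hx h => hloc x h (hmem hx)) with
    ⟨m, hm, hpos⟩ | ⟨z₁, z₂, hz₁, hz₂, h01, h02, hd1', hd2', hfar⟩
  · have hnear : ∀ {x}, |x - m| ≤ 4 * d ^ p → |x - c₀| < 2 * r := fun {x} h => by
      have := abs_sub_le x m c₀
      linarith
    refine ⟨fun _ => m, Or.inr ⟨fun b => hin b m hm, rfl, rfl, ⟨s, hs, fun x hx => ?_,
      fun x hx hx' => ?_⟩, fun b x hx hxm => ?_⟩⟩
    · exact hconv x (hnear hx)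
    · have := hpos x (hmem' (hnear (by linarith))) hx
      rw [hv] at this
      linarith
    · beta_reduce at hxm ⊢
      rw [← abs_mul_of_abs_eq_one hs]
      refine le_trans ?_ (le_abs_self _)
      obtain ⟨k, hk, hk'⟩ := exists_nd_eq_abs x c₀
      by_cases hrx : r ≤ nd (x - c₀)
      · linarith [hout b x hx hrx]
      · push Not at hrx
        rw [← hf.sub_int_mul_eq k, mul_one]
        have := hpos (x - k) (hmem' (by linarith)) (by
          rw [← hk' m] at hxm
          exact hxm.trans (nd_le_abs _))
        rw [hv] at this
        linarith
  · rw [hv] at hd1' hd2'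
    rw [hdeq] at hd1' hd2'
    simp only [hv] at hfar
    have hS : 10000 * d ^ (4 * p + 12) ≤ d ^ (2 * p + 6) := pow_small hd0 hd (by lia)
    have hS2 : 10000 * d ^ (4 * p + 12) ≤ d ^ 1 := pow_small hd0 hd (by lia)
    rw [pow_one] at hS2
    have hS0 : 0 < d ^ (4 * p + 12) := by positivity
    have hnear : ∀ {x z}, |z - c₀| ≤ r → |x - z| ≤ 64 * d ^ (4 * p + 12) → |x - c₀| < 2 * r :=
      fun {x z} h h' => by
        have := abs_sub_le x z c₀
        linarith
    have hdev : ∀ {x z}, |z - c₀| ≤ r → |x - z| ≤ 64 * d ^ (4 * p + 12) →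
        |s * deriv f x - s * deriv f z| ≤ d ^ (2 * p + 2) := fun {x z} hz h => by
      have hI : ∀ w ∈ Set.uIcc z x, |w - c₀| < 2 * r := fun w hw =>
        hnear hz ((Set.abs_sub_left_of_mem_uIcc hw).trans h)
      have := abs_sub_le_of_abs_deriv_le (f := deriv f) (v := 2 * (5 / d) / d ^ 2)
        (fun w hw => (hj w (hI w hw)).hasDerivAt_deriv.differentiableAt)
        (fun w hw => (hj w (hI w hw)).abs_deriv2_le hd0)
      rw [← mul_sub, abs_mul_of_abs_eq_one hs]
      refine this.trans ?_
      calc 2 * (5 / d) / d ^ 2 * |x - z| ≤ 2 * (5 / d) / d ^ 2 * (64 * d ^ (4 * p + 12)) := by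
            gcongr
        _ = 640 * d ^ (4 * p + 12) / d ^ 3 := by field_simp; ring
        _ ≤ d ^ (2 * p + 6) / d ^ 3 := by gcongr; linarith
        _ = d ^ (2 * p + 3) := by rw [div_eq_iff (by positivity)]; ring
        _ ≤ d ^ (2 * p + 2) := pow_le_pow_of_le_one hd0.le hd1 (by lia)
    refine ⟨fun b => if b then z₂ else z₁, Or.inl ⟨fun b => ?_, fun b => ?_,
      ⟨fun b => if b then s else -s, fun b => ?_, ?_, fun b x hx => ?_⟩, fun b x hx hxm => ?_⟩⟩
    · cases b <;> simp [hin, hz₁, hz₂]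
    · have hs0 : s ≠ 0 := by rintro rfl; simp at hs
      have h01' : f z₁ = 0 := by simpa [hs0] using h01
      have h02' : f z₂ = 0 := by simpa [hs0] using h02
      cases b <;> simpa
    · cases b <;> simpa
    · have : s ^ 2 = 1 := by rw [← sq_abs, hs]; norm_num
      simp; linarith
    · cases b
      · simp only [Bool.false_eq_true, if_false] at hx ⊢
        have := abs_le.1 (hdev hz₁ hx)
        linarith
      · simp only [if_true] at hx ⊢
        have := abs_le.1 (hdev hz₂ hx)
        linarith
    · have hx1 := hxm false
      have hx2 := hxm true
      simp only [Bool.false_eq_true, if_false, if_true] at hx1 hx2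
      rw [← abs_mul_of_abs_eq_one hs]
      obtain ⟨k, hk, hk'⟩ := exists_nd_eq_abs x c₀
      by_cases hrx : r ≤ nd (x - c₀)
      · exact le_trans (by linarith [hout b x hx hrx]) (le_abs_self _)
      · push Not at hrx
        rw [← hf.sub_int_mul_eq k, mul_one]
        rw [← hk'] at hx1 hx2
        have := hfar (x - k) (d ^ (4 * p + 12)) (by linarith) hS0.le (hx1.trans (nd_le_abs _))
          (hx2.trans (nd_le_abs _))
        refine le_trans ?_ this
        have e1 : 10000 * d ^ (6 * p + 16) ≤ d ^ (6 * p + 13) := pow_small hd0 hd (by lia)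
        calc d ^ (6 * p + 16) ≤ d ^ (6 * p + 13) / 4 := by linarith
          _ = _ := by ring

/-! ### Evolution of the shapes -/

theorem mul_abs_sub_le_of_le_deriv {f : ℝ → ℝ} {s v z x : ℝ}
    (hz : f z = 0) (h1 : ∀ w ∈ Set.uIcc z x, DifferentiableAt ℝ f w)
    (h2 : ∀ w ∈ Set.uIcc z x, v ≤ s * deriv f w) : v * (x - z) ≤ s * f x ∧ z ≤ x ∨
      v * (z - x) ≤ -(s * f x) ∧ x ≤ z := by
  have hd : ∀ w, deriv (fun x => s * f x) w = s * deriv f w := fun w => by rw [deriv_mul_eq]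
  rcases le_total z x with h | h
  · left
    rw [Set.uIcc_of_le h] at h1 h2
    have := mul_sub_le_of_le_deriv (f := fun x => s * f x) (v := v) h
      (fun w hw => (h1 w hw).const_mul s) fun w hw => by rw [hd]; exact h2 w hw
    simp only [hz, mul_zero, sub_zero] at this
    exact ⟨this, h⟩
  · right
    rw [Set.uIcc_of_ge h] at h1 h2
    have := mul_sub_le_of_le_deriv (f := fun x => s * f x) (v := v) h
      (fun w hw => (h1 w hw).const_mul s) fun w hw => by rw [hd]; exact h2 w hw
    simp only [hz, mul_zero, zero_sub] at this
    exact ⟨this, h⟩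

theorem JetBound.deriv_eq_add {h x K L : ℝ} {f g : ℝ → ℝ} (H : JetBound h f x K)
    (He : JetBound h (fun y => g y - f y) x L) :
    deriv g x = deriv f x + deriv (fun y => g y - f y) x ∧
      deriv (deriv g) x = deriv (deriv f) x + deriv (deriv fun y => g y - f y) x := by
  have e : (fun y => f y + (g y - f y)) = g := by funext y; ring
  have h1 : ∀ᶠ y in 𝓝 x, HasDerivAt g (deriv f y + deriv (fun y => g y - f y) y) y := by
    filter_upwards [H.hasDerivAt, He.hasDerivAt] with y h1 h2
    have := h1.fun_add h2
    rwa [e] at this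
  have h2 : deriv g =ᶠ[𝓝 x] fun y => deriv f y + deriv (fun y => g y - f y) y :=
    h1.mono fun y hy => hy.deriv
  refine ⟨h2.eq_of_nhds, ?_⟩
  rw [h2.deriv_eq]
  exact (H.hasDerivAt_deriv.fun_add He.hasDerivAt_deriv).deriv

theorem JetBound.deriv_deriv_mul {h x K L : ℝ} {f g : ℝ → ℝ} (Hf : JetBound h f x K)
    (Hg : JetBound h g x L) :
    deriv (deriv fun y => f y * g y) x =
      deriv (deriv f) x * g x + 2 * (deriv f x * deriv g x) + f x * deriv (deriv g) x := by
  have h1 : deriv (fun y => f y * g y) =ᶠ[𝓝 x] fun y => deriv f y * g y + f y * deriv g y := by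
    filter_upwards [Hf.hasDerivAt, Hg.hasDerivAt] with y h1 h2
    exact (h1.fun_mul h2).deriv
  rw [h1.deriv_eq, ((Hf.hasDerivAt_deriv.fun_mul Hg.hasDerivAt_self).fun_add
    (Hf.hasDerivAt_self.fun_mul Hg.hasDerivAt_deriv)).deriv]
  ring

section Evolution

variable {p : ℕ} {d d' ρ ε : ℝ} {c c' : Bool → ℝ} {F F' : Bool → ℝ → ℝ}

theorem CrossShape.nonres (C : CrossShape p d ρ c F c') (hd0 : 0 < d) (hd : d ≤ 1 / 10000)
    (hd' : d' = d ^ (12 * p + 40)) (hε : ε ≤ d ^ (28 * p + 90)) (hdρ : 16 * d ^ (4 * p + 12) ≤ ρ)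
    (hF : ∀ b x, nd (x - c b) < 2 * ρ → JetBound d (F b) x (5 / d))
    (hFF : ∀ b x, nd (x - c' b) < 2 * d ^ (4 * p + 12) →
      JetBound d (fun x => F' b x - F b x) x ε)
    (hF' : ∀ b x, nd (x - c' b) < 2 * d ^ (4 * p + 12) → JetBound d' (F' b) x (5 / d'))
    (hper : ∀ b, Function.Periodic (F' b) 1) :
    ∃ c'', CrossShape p d' (d ^ (4 * p + 12)) c' F' c'' := by
  obtain ⟨s, hs, hss, hsl⟩ := C.slope
  have hd1 : d ≤ 1 := by linarith
  have hr0 : 0 < d ^ (4 * p + 12) := by positivity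
  obtain ⟨r, hr⟩ : ∃ r, r = d ^ (4 * p + 12) := ⟨_, rfl⟩
  obtain ⟨v, hv⟩ : ∃ v, v = d ^ (2 * p + 2) := ⟨_, rfl⟩
  have hv0 : 0 < v := by rw [hv]; positivity
  have hd'0 : 0 < d' := by rw [hd']; positivity
  have hd'v : 10000 * d' ≤ v := by rw [hd', hv]; exact pow_small hd0 hd (by lia)
  have hd'r : 10000 * d' ≤ r := by rw [hd', hr]; exact pow_small hd0 hd (by lia)
  have hd'1 : d' ≤ 1 := by
    have : r ≤ 1 := by rw [hr]; exact pow_le_one₀ hd0.le hd1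
    linarith
  have hεd : ε / d ≤ v / 2 := by
    rw [div_le_iff₀ hd0]
    have : 10000 * d ^ (28 * p + 90) ≤ d ^ (2 * p + 3) := pow_small hd0 hd (by lia)
    have e : v * d = d ^ (2 * p + 3) := by rw [hv]; ring
    have : 0 < d ^ (2 * p + 3) := by positivity
    linarith
  have hεr : ε < v * (r / 2) := by
    have h1 : 10000 * d ^ (28 * p + 90) ≤ d ^ (6 * p + 14) := pow_small hd0 hd (by lia)
    have e : v * r = d ^ (6 * p + 14) := by rw [hv, hr]; ring
    have : 0 < d ^ (6 * p + 14) := by positivity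
    linarith
  simp only [← hr, ← hv] at *
  have hnd : ∀ {b x}, |x - c' b| < 2 * r → nd (x - c' b) < 2 * r := fun h => (nd_le_abs _).trans_lt h
  have hnear : ∀ {b x}, |x - c' b| < 2 * r → nd (x - c b) < 2 * ρ := fun {b x} h => by
    have := nd_sub_triangle x (c' b) (c b)
    have := C.near b
    linarith [hnd h]
  have hsl' : ∀ b x, |x - c' b| < 2 * r → v / 2 ≤ s b * deriv (F' b) x := fun b x h => by
    have h1 := hFF b x (hnd h)
    rw [((hF b x (hnear h)).deriv_eq_add h1).1, mul_add]
    have h2 := h1.abs_deriv_le hd0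
    rw [← abs_mul_of_abs_eq_one (hs b), abs_le] at h2
    linarith [hsl b x (by linarith)]
  have hdiff : ∀ b x, |x - c' b| < 2 * r → DifferentiableAt ℝ (F' b) x := fun b x h =>
    (hF' b x (hnd h)).hasDerivAt_self.differentiableAt
  have hval : ∀ b x, |x - c' b| = r / 2 →
      (0 < s b * F' b x ∧ c' b ≤ x) ∨ (s b * F' b x < 0 ∧ x ≤ c' b) := fun b x hx => by
    have hlt : ∀ w ∈ Set.uIcc (c' b) x, |w - c' b| < 2 * r := fun w hw =>
      (Set.abs_sub_left_of_mem_uIcc hw).trans_lt (by rw [hx]; linarith)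
    have h3 := (hFF b x (hnd (by rw [hx]; linarith))).abs_le hd0.le
    rw [← abs_mul_of_abs_eq_one (hs b), mul_sub, abs_le] at h3
    rcases mul_abs_sub_le_of_le_deriv (v := v) (s := s b) (C.zero b) (fun w hw =>
      (hF b w (hnear (hlt w hw))).hasDerivAt_self.differentiableAt)
      (fun w hw => hsl b w (by linarith [hlt w hw])) with ⟨h1, h2⟩ | ⟨h1, h2⟩
    · left
      rw [abs_of_nonneg (by linarith)] at hx
      rw [hx] at h1
      exact ⟨by linarith, h2⟩
    · right
      rw [abs_of_nonpos (by linarith)] at hx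
      rw [neg_sub] at hx
      rw [hx] at h1
      exact ⟨by linarith, h2⟩
  have hzero : ∀ b, ∃ z, |z - c' b| ≤ r / 2 ∧ F' b z = 0 := fun b => by
    have hcont : ContinuousOn (fun x => s b * F' b x) (Set.Icc (c' b - r / 2) (c' b + r / 2)) :=
      fun x hx => ((hdiff b x (by rw [abs_lt]; constructor <;> linarith [hx.1, hx.2])).const_mul
        (s b)).continuousAt.continuousWithinAt
    have h1 : s b * F' b (c' b - r / 2) ≤ 0 := by
      rcases hval b (c' b - r / 2) (by
        rw [sub_sub_cancel_left, abs_neg, abs_of_pos (by linarith)]) with ⟨-, h⟩ | ⟨h, -⟩ <;>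
      linarith
    have h2 : 0 ≤ s b * F' b (c' b + r / 2) := by
      rcases hval b (c' b + r / 2) (by
        rw [add_sub_cancel_left, abs_of_pos (by linarith)]) with ⟨h, -⟩ | ⟨-, h⟩ <;>
      linarith
    obtain ⟨z, hz, hz0⟩ := intermediate_value_Icc (by linarith) hcont ⟨h1, h2⟩
    refine ⟨z, by rw [abs_le]; constructor <;> linarith [hz.1, hz.2], ?_⟩
    have : s b ≠ 0 := by intro h; have := hs b; simp [h] at this
    simpa [this] using hz0
  choose z hz hz0 using hzero
  have hlt : ∀ {b x}, |x - c' b| < 2 * r → ∀ w ∈ Set.uIcc (z b) x, |w - c' b| < 2 * r :=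
    fun {b x} h w hw => by
      have h1 := hz b
      rw [abs_le] at h1
      rw [abs_lt] at h ⊢
      rcases Set.mem_uIcc.1 hw with h2 | h2 <;> constructor <;> linarith [h2.1, h2.2]
  have hpow : ∀ k : ℕ, k ≠ 0 → d' ^ k ≤ d' := fun k hk =>
    pow_le_of_le_one hd'0.le hd'1 hk
  refine ⟨z, ⟨fun b => (nd_le_abs _).trans (by linarith [hz b]), hz0, ⟨s, hs, hss,
    fun b x hx => ?_⟩, fun b x hx hxz => ?_⟩⟩
  · have := abs_sub_le x (z b) (c' b)
    have := hz b
    linarith [hpow (4 * p + 12) (by lia), hpow (2 * p + 2) (by lia),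
      hsl' b x (by linarith [hpow (4 * p + 12) (by lia)])]
  · obtain ⟨k, hk, hk'⟩ := exists_nd_eq_abs x (c' b)
    rw [← (hper b).sub_int_mul_eq k, mul_one]
    have hx' : |x - k - c' b| < 2 * r := by linarith
    have h1 := hxz b
    rw [← hk'] at h1
    have h2 := h1.trans (nd_le_abs _)
    have h3 : v / 2 * |x - k - z b| ≤ |F' b (x - k)| := by
      rw [← abs_mul_of_abs_eq_one (hs b) (F' b (x - k))]
      rcases mul_abs_sub_le_of_le_deriv (v := v / 2) (s := s b) (hz0 b)
        (fun w hw => hdiff b w (hlt hx' w hw)) (fun w hw => hsl' b w (hlt hx' w hw)) with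
        ⟨h3, h4⟩ | ⟨h3, h4⟩
      · rw [abs_of_nonneg (by linarith)]
        exact h3.trans (le_abs_self _)
      · rw [abs_of_nonpos (by linarith), neg_sub]
        exact h3.trans (neg_le_abs _)
    calc d' ^ (6 * p + 16) ≤ d' ^ (4 * p + 13) := pow_le_pow_of_le_one hd'0.le hd'1 (by lia)
      _ = d' * d' ^ (4 * p + 12) := by ring
      _ ≤ v / 2 * |x - k - z b| := by gcongr; linarith
      _ ≤ _ := h3

theorem TangentShape.nonres (C : TangentShape p d ρ c F c') (hp : 2 ≤ p) (hd0 : 0 < d)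
    (hd : d ≤ 1 / 10000)
    (hd' : d' = d ^ (12 * p + 40)) (hε : ε ≤ d ^ (28 * p + 90)) (hdρ : 16 * d ^ p ≤ ρ)
    (hF : ∀ b x, nd (x - c b) < 2 * ρ → JetBound d (F b) x (5 / d))
    (hFF : ∀ b x, nd (x - c' b) < 2 * d ^ p → JetBound d (fun x => F' b x - F b x) x ε)
    (hF' : ∀ b x, nd (x - c' b) < 2 * d ^ p → JetBound d' (F' b) x (5 / d'))
    (hper : ∀ b, Function.Periodic (F' b) 1) (hFeq : F' true = F' false) :
    ∃ c'', CrossShape p d' (d ^ p) c' F' c'' ∨ TangentShape p d' (d ^ p) c' F' c'' := by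
  obtain ⟨s, hs, hconv, hann⟩ := C.convex
  have hd1 : d ≤ 1 := by linarith
  have hcb : ∀ b, c' b = c' true := fun b => by cases b <;> simp [C.center_eq]
  have hFb : F' = fun _ => F' true := by funext b; cases b <;> simp [hFeq]
  have hd'0 : 0 < d' := by rw [hd']; positivity
  have hd'd : 10000 * d' ≤ d := by
    have : 10000 * d ^ (12 * p + 40) ≤ d ^ 1 := pow_small hd0 hd (by lia)
    rwa [pow_one, ← hd'] at this
  have hd'r : 10000 * d' ≤ d ^ p := by rw [hd']; exact pow_small hd0 hd (by lia)
  have hd'E : 10000 * d' ≤ d ^ (6 * p + 16) := by rw [hd']; exact pow_small hd0 hd (by lia)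
  have hεE : 10000 * d ^ (28 * p + 90) ≤ d ^ (6 * p + 16) := pow_small hd0 hd (by lia)
  have hE0 : 0 < d ^ (6 * p + 16) := by positivity
  have hr2 : 10000 * d ^ p ≤ d ^ 1 := pow_small hd0 hd (by lia)
  have hr0 : 0 < d ^ p := by positivity
  rw [pow_one] at hr2
  have hεd : 2 * ε / d ^ 2 ≤ d / 2 := by
    rw [div_le_iff₀ (by positivity)]
    have : 10000 * d ^ (28 * p + 90) ≤ d ^ 3 := pow_small hd0 hd (by lia)
    linarith [show d / 2 * d ^ 2 = d ^ 3 / 2 by ring, show 0 < d ^ 3 by positivity]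
  obtain ⟨r, hr⟩ : ∃ r, r = d ^ p := ⟨_, rfl⟩
  simp only [← hr] at *
  have hnd : ∀ {x}, |x - c' true| < 2 * r → nd (x - c' true) < 2 * r :=
    fun h => (nd_le_abs _).trans_lt h
  have hnear : ∀ {x}, |x - c' true| < 2 * r → nd (x - c true) < 2 * ρ := fun {x} h => by
    have := nd_sub_triangle x (c' true) (c true)
    have := C.near true
    linarith [hnd h]
  have hval : ∀ x, r ≤ |x - c' true| → |x - c' true| < 2 * r → d' ≤ s * F' true x :=
    fun x h1 h2 => by
      have h3 := (hFF true x (hnd h2)).abs_le hd0.le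
      rw [← abs_mul_of_abs_eq_one hs, mul_sub, abs_le] at h3
      linarith [hann x h1 h2.le]
  rw [hFb]
  refine exists_shape (c₀ := c' true) (s := s) (r := r) hp hd'0 (by linarith) (by linarith)
    (by linarith) hs (hper true) (fun x hx => hF' true x (hnd hx)) (fun x hx => ?_)
    (fun b x hx hxr => ?_) hval (fun b x hx => ?_)
  · have h1 := hFF true x (hnd hx)
    rw [((hF true x (hnear hx)).deriv_eq_add h1).2, mul_add]
    have h2 := h1.abs_deriv2_le hd0
    rw [← abs_mul_of_abs_eq_one hs, abs_le] at h2
    linarith [hconv x (by linarith)]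
  · rw [hcb] at hx
    obtain ⟨k, hk, -⟩ := exists_nd_eq_abs x (c' true)
    rw [← (hper true).sub_int_mul_eq k, mul_one]
    exact hval _ (by linarith) (by linarith)
  · rw [hcb]
    exact (nd_le_abs _).trans hx

theorem cross_mul {r v z₁ z₂ s₁ s₂ : ℝ} {f₁ f₂ : ℝ → ℝ} (hd0 : 0 < d) (hr : 0 < r) (hv : 0 ≤ v)
    (hs : s₁ * s₂ = -1) (hz : |z₁ - z₂| ≤ 4 * r)
    (h₁ : f₁ z₁ = 0) (h₂ : f₂ z₂ = 0)
    (hj₁ : ∀ x, |x - z₁| < 16 * r → JetBound d f₁ x (5 / d))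
    (hj₂ : ∀ x, |x - z₁| < 16 * r → JetBound d f₂ x (5 / d))
    (hv₁ : ∀ x, |x - z₁| < 16 * r → v ≤ s₁ * deriv f₁ x)
    (hv₂ : ∀ x, |x - z₁| < 16 * r → v ≤ s₂ * deriv f₂ x) {x : ℝ} (hx : |x - z₁| < 16 * r) :
    2 * v ^ 2 - 1800 * r / d ^ 5 ≤ -deriv (deriv fun y => f₁ y * f₂ y) x ∧
      (8 * r ≤ |x - z₁| → 32 * r ^ 2 * v ^ 2 ≤ -(f₁ x * f₂ x)) := by
  have hu₁ : ∀ w ∈ Set.uIcc z₁ x, |w - z₁| < 16 * r := fun w hw =>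
    (Set.abs_sub_left_of_mem_uIcc hw).trans_lt hx
  have hu₂ : ∀ w ∈ Set.uIcc z₂ x, |w - z₁| < 16 * r := fun w hw => by
    rw [abs_le] at hz
    rw [abs_lt] at hx ⊢
    rcases Set.mem_uIcc.1 hw with h2 | h2 <;> constructor <;> linarith [h2.1, h2.2]
  have hxz₂ : |x - z₂| ≤ 20 * r := by linarith [abs_sub_le x z₁ z₂]
  have hneg : ∀ y₁ y₂ : ℝ, -(y₁ * y₂) = (s₁ * y₁) * (s₂ * y₂) := fun y₁ y₂ => by
    rw [show (s₁ * y₁) * (s₂ * y₂) = s₁ * s₂ * (y₁ * y₂) by ring, hs]; ring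
  constructor
  · rw [(hj₁ x hx).deriv_deriv_mul (hj₂ x hx)]
    have e1 : 5 / d / d = 5 / d ^ 2 := by field_simp
    have e2 : 2 * (5 / d) / d ^ 2 = 10 / d ^ 3 := by field_simp; norm_num
    have b1 : |f₁ x| ≤ 5 / d ^ 2 * (16 * r) := by
      have := abs_sub_le_of_abs_deriv_le (f := f₁) (v := 5 / d ^ 2)
        (fun w hw => (hj₁ w (hu₁ w hw)).hasDerivAt_self.differentiableAt)
        (fun w hw => by rw [← e1]; exact (hj₁ w (hu₁ w hw)).abs_deriv_le hd0)
      rw [h₁, sub_zero] at this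
      exact this.trans (by gcongr)
    have b2 : |f₂ x| ≤ 5 / d ^ 2 * (20 * r) := by
      have := abs_sub_le_of_abs_deriv_le (f := f₂) (v := 5 / d ^ 2)
        (fun w hw => (hj₂ w (hu₂ w hw)).hasDerivAt_self.differentiableAt)
        (fun w hw => by rw [← e1]; exact (hj₂ w (hu₂ w hw)).abs_deriv_le hd0)
      rw [h₂, sub_zero] at this
      exact this.trans (by gcongr)
    have c1 := (hj₁ x hx).abs_deriv2_le hd0
    have c2 := (hj₂ x hx).abs_deriv2_le hd0
    rw [e2] at c1 c2
    have m1 : |deriv (deriv f₁) x * f₂ x| ≤ 10 / d ^ 3 * (5 / d ^ 2 * (20 * r)) := by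
      rw [abs_mul]; gcongr
    have m2 : |f₁ x * deriv (deriv f₂) x| ≤ 5 / d ^ 2 * (16 * r) * (10 / d ^ 3) := by
      rw [abs_mul]; gcongr
    have e3 : 10 / d ^ 3 * (5 / d ^ 2 * (20 * r)) + 5 / d ^ 2 * (16 * r) * (10 / d ^ 3) =
        1800 * r / d ^ 5 := by field_simp; norm_num
    have m3 : v * v ≤ -(deriv f₁ x * deriv f₂ x) := by
      rw [hneg]
      exact mul_le_mul (hv₁ x hx) (hv₂ x hx) hv (hv.trans (hv₁ x hx))
    linarith [(abs_le.1 m1).2, (abs_le.1 m2).2]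
  · intro hx8
    rw [hneg]
    have e : 32 * r ^ 2 * v ^ 2 = (v * (8 * r)) * (v * (4 * r)) := by ring
    rw [abs_le] at hz
    have k1 := mul_abs_sub_le_of_le_deriv (v := v) (s := s₁) h₁ (fun w hw =>
      (hj₁ w (hu₁ w hw)).hasDerivAt_self.differentiableAt) fun w hw => hv₁ w (hu₁ w hw)
    have k2 := mul_abs_sub_le_of_le_deriv (v := v) (s := s₂) h₂ (fun w hw =>
      (hj₂ w (hu₂ w hw)).hasDerivAt_self.differentiableAt) fun w hw => hv₂ w (hu₂ w hw)
    have hr4 : 0 ≤ v * (4 * r) := by positivity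
    rw [e]
    rcases le_total z₁ x with h | h
    · rw [abs_of_nonneg (by linarith)] at hx8
      have t1 : v * (8 * r) ≤ s₁ * f₁ x := by
        rcases k1 with k1 | k1
        · exact (mul_le_mul_of_nonneg_left hx8 hv).trans k1.1
        · exfalso; linarith
      have t2 : v * (4 * r) ≤ s₂ * f₂ x := by
        rcases k2 with k2 | k2
        · exact (mul_le_mul_of_nonneg_left (by linarith) hv).trans k2.1
        · exfalso; linarith
      exact mul_le_mul t1 t2 hr4 (by linarith)
    · rw [abs_of_nonpos (by linarith)] at hx8
      have t1 : v * (8 * r) ≤ -(s₁ * f₁ x) := by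
        rcases k1 with k1 | k1
        · exfalso; linarith
        · exact (mul_le_mul_of_nonneg_left (by linarith) hv).trans k1.1
      have t2 : v * (4 * r) ≤ -(s₂ * f₂ x) := by
        rcases k2 with k2 | k2
        · exfalso; linarith
        · exact (mul_le_mul_of_nonneg_left (by linarith) hv).trans k2.1
      rw [← neg_mul_neg (s₁ * f₁ x)]
      exact mul_le_mul t1 t2 hr4 (by linarith)

theorem CrossShape.res {q : Bool} {β K : ℝ} {f : ℝ → ℝ} (C : CrossShape p d ρ c F c') (hp : 2 ≤ p)
    (hd0 : 0 < d) (hd : d ≤ 1 / 10000) (hd' : d' = d ^ (12 * p + 40))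
    (hdρ : 100 * d ^ (4 * p + 12) ≤ ρ) (hK : K ≤ d ^ (28 * p + 88))
    (hF : ∀ b x, nd (x - c b) < 2 * ρ → JetBound d (F b) x (5 / d))
    (hFper : ∀ b, Function.Periodic (F b) 1)
    (hres : nd (c' q + β - c' !q) < 4 * d ^ (4 * p + 12))
    (hj : ∀ x, nd (x - c' q) < 16 * d ^ (4 * p + 12) → JetBound d' f x (5 / d'))
    (hf : ∀ x, nd (x - c' q) < 16 * d ^ (4 * p + 12) →
      JetBound d' (fun x => f x - F q x * F (!q) (x + β)) x K)
    (hper : Function.Periodic f 1) :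
    ∃ c'', CrossShape p d' (8 * d ^ (4 * p + 12)) (fun _ => c' q) (fun _ => f) c'' ∨
      TangentShape p d' (8 * d ^ (4 * p + 12)) (fun _ => c' q) (fun _ => f) c'' := by
  obtain ⟨s, hs, hss, hsl⟩ := C.slope
  have hd1 : d ≤ 1 := by linarith
  have hd'0 : 0 < d' := by rw [hd']; positivity
  have hr0 : 0 < d ^ (4 * p + 12) := by positivity
  have q1 : 10000 * d' ≤ d ^ (4 * p + 4) := by rw [hd']; exact pow_small hd0 hd (by lia)
  have q2 : 10000 * d' ≤ d ^ (12 * p + 28) := by rw [hd']; exact pow_small hd0 hd (by lia)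
  have q3 : 10000 * d' ≤ d ^ (4 * p + 12) := by rw [hd']; exact pow_small hd0 hd (by lia)
  have q4 : 10000 * d ^ (28 * p + 88) ≤ d ^ (28 * p + 84) := pow_small hd0 hd (by lia)
  have q5 : 10000 * d ^ (28 * p + 88) ≤ d ^ (12 * p + 28) := pow_small hd0 hd (by lia)
  have q6 : 10000 * d ^ (4 * p + 7) ≤ d ^ (4 * p + 4) := pow_small hd0 hd (by lia)
  have q7 : 10000 * d ^ (4 * p + 12) ≤ d ^ 0 := pow_small hd0 hd (by lia)
  rw [pow_zero] at q7
  have e1 : (d ^ (2 * p + 2)) ^ 2 = d ^ (4 * p + 4) := by rw [← pow_mul]; ring_nf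
  have e2 : d ^ (4 * p + 12) / d ^ 5 = d ^ (4 * p + 7) := by
    rw [div_eq_iff (by positivity)]; ring
  have e3 : (d ^ (4 * p + 12)) ^ 2 * d ^ (4 * p + 4) = d ^ (12 * p + 28) := by
    rw [← pow_mul]; ring
  have e4 : d' ^ 2 * d ^ (4 * p + 4) = d ^ (28 * p + 84) := by
    rw [hd', ← pow_mul]; ring
  have hv0 : 0 ≤ d ^ (2 * p + 2) := by positivity
  have hK2 : 2 * K / d' ^ 2 ≤ d ^ (4 * p + 4) / 2 := by
    rw [div_le_iff₀ (by positivity)]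
    have : 0 < d ^ (28 * p + 84) := by positivity
    linarith
  have hdd' : d' ≤ d := by
    rw [hd']; exact pow_le_of_le_one hd0.le hd1 (by lia)
  obtain ⟨k, hk, -⟩ := exists_nd_eq_abs (c' q + β) (c' !q)
  obtain ⟨f₂, hf₂⟩ : ∃ f₂, f₂ = fun x => F (!q) (x + (β - k)) := ⟨_, rfl⟩
  have hf₂' : (fun x => F (!q) (x + β)) = f₂ := by
    rw [hf₂]
    funext x
    rw [← (hFper (!q)).sub_int_mul_eq k, mul_one]
    ring_nf
  have hf₂x : ∀ x, F (!q) (x + β) = f₂ x := fun x => congrFun hf₂' x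
  have hf₂d : ∀ x, deriv f₂ x = deriv (F !q) (x + (β - k)) := fun x => by
    rw [hf₂]; exact deriv_comp_add_const _ _ _
  simp only [hf₂x] at hf
  obtain ⟨r, hr⟩ : ∃ r, r = d ^ (4 * p + 12) := ⟨_, rfl⟩
  simp only [← hr] at *
  have hz : |c' q - (c' (!q) + k - β)| ≤ 4 * r := by
    rw [show c' q - (c' (!q) + k - β) = c' q + β - k - c' !q by ring, hk]; exact hres.le
  have hnear : ∀ {b x}, |x - c' b| < 20 * r → nd (x - c b) < 2 * ρ := fun {b x} h => by
    have h1 := nd_sub_triangle x (c' b) (c b)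
    have h2 := C.near b
    linarith [nd_le_abs (x - c' b)]
  have hx₂ : ∀ {x}, |x - c' q| < 16 * r → |x + (β - k) - c' !q| < 20 * r := fun {x} h => by
    have := abs_sub_le x (c' q) (c' (!q) + k - β)
    rw [show x + (β - k) - c' (!q) = x - (c' (!q) + k - β) by ring]
    linarith
  have hj₁ : ∀ x, |x - c' q| < 16 * r → JetBound d (F q) x (5 / d) := fun x hx =>
    hF q x (hnear (by linarith))
  have hj₂ : ∀ x, |x - c' q| < 16 * r → JetBound d f₂ x (5 / d) := fun x hx => by
    rw [hf₂]; exact (hF (!q) _ (hnear (hx₂ hx))).comp_add_const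
  have hmul := fun x => cross_mul (x := x) (v := d ^ (2 * p + 2)) hd0 hr0 hv0
    (s₁ := s q) (s₂ := s !q) (by cases q <;> simp [hss, mul_comm (s false)]) hz
    (C.zero q) (by rw [hf₂]; simp [C.zero]) hj₁ hj₂ (fun x hx => hsl q x (by linarith))
    (fun x hx => by rw [hf₂d]; exact hsl (!q) _ (by linarith [hx₂ hx]))
  have hnd : ∀ {x}, |x - c' q| < 16 * r → nd (x - c' q) < 16 * r :=
    fun h => (nd_le_abs _).trans_lt h
  rw [mul_div_assoc, e2, e1, mul_assoc, e3] at hmul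
  have hval : ∀ x, 8 * r ≤ |x - c' q| → |x - c' q| < 2 * (8 * r) → d' ≤ -1 * f x :=
    fun x h1 h2 => by
      have h3 := (hmul x (by linarith)).2 h1
      have h4 := (hf x (hnd (by linarith))).abs_le hd'0.le
      rw [abs_le] at h4
      linarith
  refine exists_shape (c₀ := c' q) (s := -1) (r := 8 * r) hp hd'0 (by linarith) (by linarith)
    (by linarith) (by simp) hper (fun x hx => hj x (hnd (by linarith))) (fun x hx => ?_)
    (fun b x hx hxr => ?_) hval (fun b x hx => ?_)
  · replace hx : |x - c' q| < 16 * r := by linarith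
    have h1 := hf x (hnd hx)
    have hG : JetBound d' (fun x => F q x * f₂ x) x (5 / d * (5 / d)) :=
      ((hj₁ x hx).mul (hj₂ x hx) hd0.le).mono_weight hd'0.le hdd'
    rw [(hG.deriv_eq_add h1).2]
    have h2 := h1.abs_deriv2_le hd'0
    rw [abs_le] at h2
    have h3 := (hmul x hx).1
    have : 0 < d ^ (4 * p + 4) := by positivity
    linarith
  · obtain ⟨k, hk, -⟩ := exists_nd_eq_abs x (c' q)
    rw [← hper.sub_int_mul_eq k, mul_one]
    exact hval _ (by linarith) (by linarith)
  · exact (nd_le_abs _).trans hx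

end Evolution

/-! ### The inductive step -/

/-- The exponent of the accuracy reached at each scale. -/
def accExp (p : ℕ) : ℕ := (12 * p + 40) * (28 * p + 90) + (12 * p + 40) + 8

/-- The state of the induction at the scale `d`, with return times at least `M`. -/
def Stage (S : Sys) (p : ℕ) (d M Γ : ℝ) : Prop :=
  ∃ (k : ℕ) (ρ ε : ℝ) (c : Bool → ℝ) (F : Bool → ℝ → ℝ) (μ : ℝ → ℝ),
    S.Dyn k M d ρ Γ ε c F μ ∧ k ≤ 1 / d ∧ d ≤ ρ ∧ ρ ≤ 1 ∧ 0 ≤ ε ∧ ε ≤ d ^ (28 * p + 90) ∧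
      ∃ c', CrossShape p d ρ c F c' ∨ TangentShape p d ρ c F c'

theorem scale_of_small {p : ℕ} {M d Γ ε Γ' : ℝ} (hd0 : 0 < d) (hd : d ≤ 1 / 10000) (hM : 0 < M)
    (hε0 : 0 ≤ ε) (hε : ε ≤ d ^ (28 * p + 90)) (hΓ' : 1 ≤ Γ')
    (hexp : Real.exp (-Γ' * M) ≤ d ^ (accExp p + (6 * p + 24)))
    (hΓ : Γ' * M + Real.log (4 / d ^ (6 * p + 16)) ≤ Γ * M) :
    Sys.Scale M d Γ ε (d ^ (12 * p + 40)) (d ^ (6 * p + 16)) (d ^ accExp p) Γ' := by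
  have hd1 : d ≤ 1 := by linarith
  have he0 : 0 < d ^ (6 * p + 16) := by positivity
  have he1 : d ^ (6 * p + 16) ≤ 1 := pow_le_one₀ hd0.le hd1
  have hΓΓ : Real.exp (-Γ * M) ≤ Real.exp (-Γ' * M) := by
    have : 0 ≤ Real.log (4 / d ^ (6 * p + 16)) :=
      Real.log_nonneg (by rw [le_div_iff₀ he0]; linarith)
    exact Real.exp_le_exp.2 (by linarith)
  have hη0 : 0 < d ^ accExp p := by positivity
  have key : 2 / d * (4 / d ^ (6 * p + 16)) * Real.exp (-Γ' * M) ≤ d ^ accExp p / 2 := by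
    have h1 : 10000 * d ^ (accExp p + (6 * p + 24)) ≤ d ^ (accExp p + (6 * p + 17)) :=
      pow_small hd0 hd (by lia)
    rw [show 2 / d * (4 / d ^ (6 * p + 16)) = 8 / d ^ (6 * p + 17) by field_simp; ring,
      div_mul_eq_mul_div, div_le_iff₀ (by positivity)]
    rw [pow_add d (accExp p) (6 * p + 17)] at h1
    have : 0 < d ^ accExp p * d ^ (6 * p + 17) := by positivity
    linarith
  constructor
  · positivity
  · exact pow_le_of_le_one hd0.le hd1 (by lia)
  · exact hd1
  · exact hM
  · exact he0
  · exact he1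
  · exact hη0.le
  · exact hε0
  · obtain ⟨B, hB⟩ : ∃ B, accExp p = B + 1 := ⟨_, rfl⟩
    have hB' : 6 * p + 16 < B := by
      have : accExp p = (12 * p + 40) * (28 * p + 90) + (12 * p + 40) + 8 := rfl
      nlinarith
    have h1 : 10000 * d ^ (12 * p + 38) ≤ d ^ (6 * p + 16) := pow_small hd0 hd (by lia)
    have h2 : 10000 * d ^ (28 * p + 90) ≤ d ^ (6 * p + 16) := pow_small hd0 hd (by lia)
    have h3 : 10000 * d ^ B ≤ d ^ (6 * p + 16) := pow_small hd0 hd hB'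
    rw [hB, show 5 / d * (d ^ (12 * p + 40) / d) = 5 * d ^ (12 * p + 38) by field_simp; ring,
      show 2 * d ^ (B + 1) / d = 2 * d ^ B by field_simp; ring]
    linarith
  · have h1 : 10000 * d ^ (12 * p + 40) ≤ d ^ 1 := pow_small hd0 hd (by lia)
    have h2 : 10000 * d ^ accExp p ≤ d ^ 1 := pow_small hd0 hd (by unfold accExp; lia)
    rw [pow_one] at h1 h2
    linarith
  · exact hΓ'
  · exact hΓ
  · exact (mul_le_mul_of_nonneg_left hΓΓ (by positivity)).trans (key.trans (by linarith))
  · exact key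

set_option maxHeartbeats 800000 in
theorem Stage.step {S : Sys} {p : ℕ} {d M Γ Γ' : ℝ} (H : Stage S p d M Γ) (hp : 2 ≤ p)
    (hd0 : 0 < d) (hd : d ≤ 1 / 10000) (hM : 0 < M)
    (hdio : ∀ t : ℕ, 1 ≤ t → (t : ℝ) ≤ 4 / d → 64 * d ^ p ≤ nd (t * S.α)) (hΓ' : 1 ≤ Γ')
    (hexp : Real.exp (-Γ' * M) ≤ d ^ (accExp p + (6 * p + 24)))
    (hΓ : Γ' * M + Real.log (4 / d ^ (6 * p + 16)) ≤ Γ * M) :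
    Stage S p (d ^ (12 * p + 40)) (1 / d) Γ' := by
  obtain ⟨k, ρ, ε, c, F, μ, D, hk, hdρ, hρ1, hε0, hε, c', hC⟩ := H
  have C := scale_of_small hd0 hd hM hε0 hε hΓ' hexp hΓ
  have hd1 : d ≤ 1 := by linarith
  obtain ⟨d', hd'⟩ : ∃ d', d' = d ^ (12 * p + 40) := ⟨_, rfl⟩
  rw [← hd'] at C ⊢
  have hd'0 : 0 < d' := C.hd'
  have hM' : (0:ℝ) ≤ 1 / d := by positivity
  have hsmall : ∀ n, 2 ≤ n → 10000 * d ^ n ≤ ρ := fun n hn => by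
    have := pow_small hd0 hd (m := 1) (n := n) (by lia)
    rw [pow_one] at this
    linarith
  have hdd' : 10000 * d' ≤ d ^ 2 := by rw [hd']; exact pow_small hd0 hd (by lia)
  have hd3 : 3 / d ≤ 1 / d' := by
    rw [div_le_div_iff₀ hd0 hd'0]
    have : d ^ 2 ≤ d := by rw [pow_two]; nlinarith
    linarith
  have hd2 : 8 / d ^ 2 ≤ 1 / d' := by
    rw [div_le_div_iff₀ (by positivity) hd'0]; linarith
  have h1d : 1 / d ≤ 1 / d' := by
    have : (0:ℝ) < 1 / d := by positivity
    have e : 3 / d = 3 * (1 / d) := by ring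
    linarith
  have hε1 : 4 * (1 / d') * d ^ accExp p ≤ d' ^ (28 * p + 90) := by
    have e : d ^ accExp p = d' * (d' ^ (28 * p + 90) * d ^ 8) := by
      rw [hd', ← pow_mul, ← pow_add, ← pow_add]
      congr 1
      unfold accExp
      ring
    rw [e, show 4 * (1 / d') * (d' * (d' ^ (28 * p + 90) * d ^ 8)) =
      d' ^ (28 * p + 90) * (4 * d ^ 8) by field_simp]
    have h1 := pow_small hd0 hd (m := 0) (n := 8) (by lia)
    rw [pow_zero] at h1
    exact mul_le_of_le_one_right (by positivity) (by linarith)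
  have hε2 : 4 * (1 / d) * d ^ accExp p ≤ d' ^ (28 * p + 90) := by
    refine le_trans ?_ hε1
    gcongr
  have hd'r : ∀ n, n < 12 * p + 40 → d' ≤ d ^ n := fun n hn => by
    have := pow_small hd0 hd hn
    rw [← hd'] at this
    linarith
  have hret : ∀ ρ' : ℝ, ρ' ≤ d ^ p → nd (c' true - c' false) < ρ' →
      ∀ (x : ℝ) (t : ℕ), 1 ≤ t → Sys.InJ c' (2 * ρ') x → Sys.InJ c' (2 * ρ') (x + t * S.α) →
      k + 1 / d ≤ t := fun ρ' hρ' hcc x t ht ⟨b₁, hb₁⟩ ⟨b₂, hb₂⟩ => by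
    by_contra! h
    have h1 := hdio t ht (by
      have e : 4 / d = 4 * (1 / d) := by ring
      linarith)
    have h2 : nd (c' b₁ - c' b₂) < ρ' := by
      have h0 : nd 0 = 0 := by simp [nd]
      have := (nd_nonneg (c' true - c' false)).trans_lt hcc
      cases b₁ <;> cases b₂ <;> simp [h0, hcc, this]
      rwa [nd_sub_comm]
    have h3 := nd_sub_triangle (x + t * S.α) (c' b₂) x
    have h4 := nd_sub_triangle (c' b₂) (c' b₁) x
    rw [nd_sub_comm (c' b₂) (c' b₁), nd_sub_comm (c' b₁) x] at h4
    rw [add_sub_cancel_left] at h3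
    linarith [show 0 < d ^ p by positivity]
  have hFd : ∀ b x, nd (x - c b) < 2 * ρ → JetBound d (F b) x (5 / d) := D.F_jet
  have nonres : ∀ n : ℕ, 2 ≤ n → n < 12 * p + 40 →
      (∀ b, nd (c' b - c b) ≤ ρ) →
      (∀ b x, nd (x - c b) < 2 * ρ → (∀ b', d ^ n ≤ nd (x - c' b')) →
        d ^ (6 * p + 16) ≤ |F b x|) →
      (∀ (x : ℝ) (t : ℕ), 1 ≤ t → Sys.InJ c' (2 * d ^ n) x →
        Sys.InJ c' (2 * d ^ n) (x + t * S.α) → k + 1 / d ≤ t) →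
      (∀ F' : Bool → ℝ → ℝ, (c' true = c' false → F' true = F' false) →
        (∀ b x, nd (x - c' b) < 2 * d ^ n → JetBound d (fun x => F' b x - F b x) x ε) →
        (∀ b x, nd (x - c' b) < 2 * d ^ n → JetBound d' (F' b) x (5 / d')) →
        (∀ b, Function.Periodic (F' b) 1) →
        ∃ c'', CrossShape p d' (d ^ n) c' F' c'' ∨ TangentShape p d' (d ^ n) c' F' c'') →
      Stage S p d' (1 / d) Γ' := fun n hn hn' h1 h2 h3 h4 => by
    obtain ⟨F', D', hF1, hF2⟩ := Sys.nonres_step (M' := 1 / d) (ρ' := d ^ n) (c' := c') D C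
      (by positivity) (by linarith [hsmall n hn, show 0 < d ^ n by positivity]) h1 h2 h3 hε2
    exact ⟨k, d ^ n, _, c', F', μ, D', by linarith, hd'r n hn', pow_le_one₀ hd0.le hd1,
      by positivity, le_rfl, h4 F' hF1 hF2 D'.F_jet D'.F_periodic⟩
  rcases hC with hC | hC
  · by_cases hres : ∃ (q : Bool) (m : ℕ), 1 ≤ m ∧ (m : ℝ) ≤ k + 1 / d ∧
        nd (c' q + m * S.α - c' !q) < 4 * d ^ (4 * p + 12)
    · obtain ⟨q, m, hm, hmk, hres⟩ := hres
      have hpp : d ^ (4 * p + 12) ≤ d ^ p := pow_le_pow_of_le_one hd0.le hd1 (by lia)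
      obtain ⟨f, μ', D', hf⟩ := Sys.res_step (q := q) (M' := 1 / d) (ρ' := d ^ (4 * p + 12))
        (c' := c') (T := 4 / d) D C (by positivity)
        (by linarith [hsmall (4 * p + 12) (by lia), show 0 < d ^ (4 * p + 12) by positivity])
        hC.near hC.zone hm hmk (by
          have e : 4 / d = 4 * (1 / d) := by ring
          linarith) hM' hres (fun t h1 h2 => by linarith [hdio t h1 h2]) hd2 hε1
      have h8 : 8 * d ^ (4 * p + 12) ≤ 1 := by
        have := pow_small hd0 hd (m := 0) (n := 4 * p + 12) (by lia)
        rw [pow_zero] at this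
        linarith [show 0 < d ^ (4 * p + 12) by positivity]
      refine ⟨k + m, _, _, _, _, μ', D', ?_, ?_, h8, by positivity, le_rfl,
        hC.res hp hd0 hd hd' (β := m * S.α) (K := 10 * (ε + 4 * d ^ accExp p / d) / d) ?_ ?_ hFd
          D.F_periodic hres (fun x hx => D'.F_jet true x ?_) hf (D'.F_periodic true)⟩
      · push_cast
        have e : 3 / d = 3 * (1 / d) := by ring
        linarith
      · have := hd'r (4 * p + 12) (by lia)
        linarith [show 0 < d ^ (4 * p + 12) by positivity]
      · linarith [hsmall (4 * p + 12) (by lia), show 0 < d ^ (4 * p + 12) by positivity]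
      · obtain ⟨B, hB⟩ : ∃ B, accExp p = B + 2 := ⟨_, rfl⟩
        have hB' : 28 * p + 88 < B := by
          have : accExp p = (12 * p + 40) * (28 * p + 90) + (12 * p + 40) + 8 := rfl
          nlinarith
        have h1 : 10000 * d ^ (28 * p + 89) ≤ d ^ (28 * p + 88) := pow_small hd0 hd (by lia)
        have h2 : 10000 * d ^ B ≤ d ^ (28 * p + 88) := pow_small hd0 hd hB'
        rw [hB, div_le_iff₀ hd0, show 4 * d ^ (B + 2) / d = 4 * d ^ B * d by field_simp; ring]
        have e1 : d ^ (28 * p + 90) = d ^ (28 * p + 89) * d := by ring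
        have : 10 * (d ^ (28 * p + 89) + 4 * d ^ B) ≤ d ^ (28 * p + 88) := by
          linarith [show 0 < d ^ (28 * p + 88) by positivity]
        nlinarith
      · linarith
    · have hnr : ∀ (x : ℝ) (t : ℕ), 1 ≤ t → Sys.InJ c' (2 * d ^ (4 * p + 12)) x →
          Sys.InJ c' (2 * d ^ (4 * p + 12)) (x + t * S.α) → k + 1 / d ≤ t :=
        fun x t ht ⟨b₁, hb₁⟩ ⟨b₂, hb₂⟩ => by
          by_contra! h
          have hpp : d ^ (4 * p + 12) ≤ d ^ p := pow_le_pow_of_le_one hd0.le hd1 (by lia)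
          have hp0 : 0 < d ^ (4 * p + 12) := by positivity
          have h1 := hdio t ht (by
            have e : 4 / d = 4 * (1 / d) := by ring
            linarith)
          have h3 := nd_sub_triangle (c' b₁ + t * S.α) (x + t * S.α) (c' b₂)
          rw [add_sub_add_right_eq_sub, nd_sub_comm (c' b₁) x] at h3
          by_cases hb : b₂ = b₁
          · rw [hb, add_sub_cancel_left] at h3
            rw [hb] at hb₂
            linarith
          · have hb' : b₂ = !b₁ := Bool.eq_not_iff.2 hb
            rw [hb'] at h3 hb₂
            exact hres ⟨b₁, t, ht, h.le, by linarith⟩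
      refine nonres (4 * p + 12) (by lia) (by lia) hC.near hC.zone hnr fun F' h1 h2 h3 h4 => ?_
      obtain ⟨c'', h⟩ := hC.nonres hd0 hd hd' hε (by
        linarith [hsmall (4 * p + 12) (by lia), show 0 < d ^ (4 * p + 12) by positivity])
        hFd h2 h3 h4
      exact ⟨c'', Or.inl h⟩
  · refine nonres p hp (by lia) hC.near (fun b x h1 h2 => hC.zone b x h1 (h2 true))
      (hret _ le_rfl (by rw [hC.center_eq]; simp [nd, hd0])) fun F' h1 h2 h3 h4 => ?_
    exact hC.nonres hp hd0 hd hd' hε (by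
      linarith [hsmall p hp, show 0 < d ^ p by positivity]) hFd h2 h3 h4 (h1 hC.center_eq)

/-! ### Iteration of the inductive step -/

theorem Stage.exists_large {S : Sys} {p : ℕ} {d M Γ : ℝ} (H : Stage S p d M Γ) (hd0 : 0 < d)
    (hM : 0 < M) : ∃ (n : ℕ) (z : ℝ), M ≤ n ∧ Real.exp (Γ * n) ≤ |S.a n z| := by
  obtain ⟨k, ρ, ε, c, F, μ, D, -, hdρ, -, -, -, -⟩ := H
  have hρ : 0 < ρ := by linarith
  have hc : Sys.InJ c (5 / 4 * ρ) (c true + (0 : ℤ) * S.α) :=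
    ⟨true, by simp only [Int.cast_zero, zero_mul, add_zero, sub_self]
              rw [show nd 0 = 0 by simp [nd]]; positivity⟩
  obtain ⟨n, hn⟩ := Sys.exists_old_right D hM hρ 0 hc
  have hI : Sys.Itin S c ρ (c true) (S.itin c ρ (c true)) :=
    Sys.itin_spec (by rw [sub_self, show nd 0 = 0 by simp [nd]]; positivity)
  have he := hn.exc hI
  refine ⟨n, c true + ((0 + k : ℤ) : ℝ) * S.α, ?_, ?_⟩
  · have h1 := D.ret _ (k + n) (by have := he.one_le; lia) he.left (by
      have := he.right
      convert this using 1
      push_cast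
      ring)
    push_cast at h1
    linarith
  · have hg := D.exc _ _ he
    have h1 := hg.inv.abs_le hd0.le
    rw [abs_inv, neg_mul, Real.exp_neg] at h1
    exact (inv_le_inv₀ (abs_pos.2 hg.ne) (Real.exp_pos _)).1 h1

theorem mul_log_inv_le {D : ℝ} (hD : 0 < D) : D * Real.log (1 / D) ≤ 2 * √D := by
  have hs : 0 < √D := Real.sqrt_pos.2 hD
  have h1 : Real.log (1 / D) = 2 * Real.log (1 / √D) := by
    rw [Real.log_div one_ne_zero hD.ne', Real.log_div one_ne_zero hs.ne', Real.log_sqrt hD.le,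
      Real.log_one]
    ring
  have h2 : Real.log (1 / √D) ≤ 1 / √D := by
    have := Real.log_le_sub_one_of_pos (show 0 < 1 / √D by positivity)
    linarith
  calc D * Real.log (1 / D) = √D ^ 2 * (2 * Real.log (1 / √D)) := by rw [h1, Real.sq_sqrt hD.le]
    _ ≤ √D ^ 2 * (2 * (1 / √D)) := by gcongr
    _ = 2 * √D := by field_simp

/-- The constant in front of the loss of the growth rate. -/
def lossConst (p : ℕ) : ℕ := 4 * ((12 * p + 40) * (6 * p + 16) + 1)

theorem mul_log_loss_le {p : ℕ} {D : ℝ} (hD : 0 < D) (hD4 : D ≤ 1 / 4) :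
    D * Real.log (4 / (D ^ (12 * p + 40)) ^ (6 * p + 16)) ≤ lossConst p * (√D / 2) := by
  obtain ⟨B, hB⟩ : ∃ B, B = (12 * p + 40) * (6 * p + 16) := ⟨_, rfl⟩
  have h1 : 4 / (D ^ (12 * p + 40)) ^ (6 * p + 16) ≤ (1 / D) ^ (B + 1) := by
    rw [← pow_mul, ← hB, _root_.one_div_pow, div_le_div_iff₀ (by positivity) (by positivity), pow_succ]
    have : 0 < D ^ B := by positivity
    nlinarith
  have h2 := Real.log_le_log (by positivity) h1
  rw [Real.log_pow] at h2
  have h3 := mul_log_inv_le hD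
  calc _ ≤ D * (((B + 1 : ℕ) : ℝ) * Real.log (1 / D)) := by gcongr
    _ = ((B + 1 : ℕ) : ℝ) * (D * Real.log (1 / D)) := by ring
    _ ≤ ((B + 1 : ℕ) : ℝ) * (2 * √D) := by gcongr
    _ = _ := by rw [lossConst, ← hB]; push_cast; ring

theorem exp_neg_div_le {D Γ : ℝ} {n : ℕ} (hD : 0 < D) (hn : D ≤ 1 / (n + 1).factorial)
    (hΓ : 1 ≤ Γ) : Real.exp (-Γ * (1 / D)) ≤ D ^ n := by
  have h1 := Real.pow_div_factorial_le_exp (1 / D) (by positivity) (n + 1)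
  have h2 : Real.exp (-Γ * (1 / D)) ≤ Real.exp (-(1 / D)) := by
    apply Real.exp_le_exp.2
    have : 0 < 1 / D := by positivity
    nlinarith
  refine h2.trans ?_
  rw [Real.exp_neg]
  refine inv_le_of_inv_le₀ (by positivity) (le_trans ?_ h1)
  rw [le_div_iff₀ (by positivity), _root_.one_div_pow, pow_succ,
    inv_mul_le_iff₀ (by positivity), show D ^ n * (1 / (D ^ n * D)) = 1 / D by field_simp]
  rwa [le_div_comm₀ hD (by positivity)] at hn

theorem Stage.growth {S : Sys} {p : ℕ} {d G Γ : ℝ} (H : Stage S p d 1 Γ) (hp : 2 ≤ p)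
    (hd0 : 0 < d) (hd : d ≤ 1 / 10000)
    (hfac : d ≤ 1 / ((12 * p + 40) * (accExp p + (6 * p + 24)) + 1).factorial)
    (hdio : ∀ D, 0 < D → D ≤ d → ∀ t : ℕ, 1 ≤ t → (t : ℝ) ≤ 4 / D → 64 * D ^ p ≤ nd (t * S.α))
    (hG : 1 ≤ G) (hexp : Real.exp (-G) ≤ d ^ (accExp p + (6 * p + 24)))
    (hΓ : G + lossConst p + Real.log (4 / d ^ (6 * p + 16)) ≤ Γ) (N : ℕ) :
    ∃ (n : ℕ) (z : ℝ), N ≤ n ∧ Real.exp (G * n) ≤ |S.a n z| := by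
  have hpow : ∀ D : ℝ, 0 < D → D ≤ d → 10000 * D ^ (12 * p + 40) ≤ D := fun D h1 h2 => by
    have := pow_small h1 (h2.trans hd) (m := 1) (n := 12 * p + 40) (by lia)
    rwa [pow_one] at this
  have hL : (0:ℝ) ≤ lossConst p := Nat.cast_nonneg _
  have main : ∀ n : ℕ, ∃ D : ℝ, 0 < D ∧ D ≤ d ∧ D * (n + 1) ≤ 1 ∧
      Stage S p (D ^ (12 * p + 40)) (1 / D) (G + lossConst p * √D) := by
    intro n
    induction n with
    | zero =>
      refine ⟨d, hd0, le_rfl, by push_cast; linarith, ?_⟩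
      have h1 : √d ≤ 1 := Real.sqrt_le_one.2 (by linarith)
      have h2 : (lossConst p : ℝ) * √d ≤ lossConst p := mul_le_of_le_one_right hL h1
      have h3 : 0 ≤ (lossConst p : ℝ) * √d := by positivity
      exact H.step hp hd0 hd one_pos (hdio d hd0 le_rfl) (by linarith)
        (le_trans (Real.exp_le_exp.2 (by linarith)) hexp) (by linarith)
    | succ n ih =>
      obtain ⟨D, hD0, hDd, hDn, hS⟩ := ih
      have h1 := hpow D hD0 hDd
      have hD'0 : 0 < D ^ (12 * p + 40) := by positivity
      have hn0 : (0:ℝ) ≤ n := Nat.cast_nonneg n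
      refine ⟨D ^ (12 * p + 40), hD'0, by linarith, by push_cast; nlinarith, ?_⟩
      have hs : √(D ^ (12 * p + 40)) ≤ √D / 2 := by
        rw [Real.sqrt_le_left (by positivity), div_pow, Real.sq_sqrt hD0.le]
        linarith
      have h3 : 0 ≤ (lossConst p : ℝ) * √(D ^ (12 * p + 40)) := by positivity
      refine hS.step hp hD'0 (by linarith) (by positivity) (hdio _ hD'0 (by linarith))
        (by linarith) ?_ ?_
      · rw [← pow_mul]
        exact exp_neg_div_le hD0 (hDd.trans hfac) (by linarith)
      · have h4 := mul_log_loss_le (p := p) hD0 (by linarith)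
        rw [mul_one_div, mul_one_div, ← sub_nonneg]
        have h5 := mul_le_mul_of_nonneg_left hs hL
        have e : ∀ x y z : ℝ, x / D - (y / D + z) = (x - (y + D * z)) / D := fun x y z => by
          field_simp
        rw [e]
        exact div_nonneg (by linarith) hD0.le
  obtain ⟨D, hD0, hDd, hDn, hS⟩ := main N
  obtain ⟨n, z, hn, hz⟩ := hS.exists_large (by positivity) (by positivity)
  refine ⟨n, z, ?_, le_trans (Real.exp_le_exp.2 ?_) hz⟩
  · have : (N + 1 : ℝ) ≤ 1 / D := by rw [le_div_iff₀ hD0]; linarith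
    exact_mod_cast (show (N : ℝ) ≤ n by linarith)
  · have : 0 ≤ (lossConst p : ℝ) * √D := by positivity
    gcongr
    linarith

/-! ### The initial scale -/

theorem jetBound_cos_sin {φ : ℝ → ℝ} {K h x : ℝ} (h1 : Differentiable ℝ φ)
    (h2 : Differentiable ℝ (deriv φ)) (hK1 : ∀ x, |deriv φ x| ≤ K)
    (hK2 : ∀ x, |deriv (deriv φ) x| ≤ K) (hh : 0 ≤ h) :
    JetBound h (fun x => Real.cos (φ x)) x (1 + h * K + h ^ 2 / 2 * (K ^ 2 + K)) ∧
      JetBound h (fun x => Real.sin (φ x)) x (1 + h * K + h ^ 2 / 2 * (K ^ 2 + K)) := by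
  have d1 : ∀ y, HasDerivAt φ (deriv φ y) y := fun y => (h1 y).hasDerivAt
  have d2 : ∀ y, HasDerivAt (deriv φ) (deriv (deriv φ) y) y := fun y => (h2 y).hasDerivAt
  have hK0 : 0 ≤ K := (abs_nonneg _).trans (hK1 x)
  have hc := Real.abs_cos_le_one (φ x)
  have hs := Real.abs_sin_le_one (φ x)
  have bd : ∀ u v : ℝ, |u| ≤ 1 → |v| ≤ 1 → |u| + h * |v * deriv φ x| + h ^ 2 / 2 *
      |u * deriv φ x * deriv φ x + v * deriv (deriv φ) x| ≤
        1 + h * K + h ^ 2 / 2 * (K ^ 2 + K) := fun u v hu hv => by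
    have e1 : |v * deriv φ x| ≤ 1 * K := by rw [abs_mul]; gcongr; exact hK1 x
    have e2 : |u * deriv φ x * deriv φ x| ≤ 1 * K * K := by
      rw [abs_mul, abs_mul]; gcongr <;> exact hK1 x
    have e3 : |v * deriv (deriv φ) x| ≤ 1 * K := by rw [abs_mul]; gcongr; exact hK2 x
    have e4 := abs_add_le (u * deriv φ x * deriv φ x) (v * deriv (deriv φ) x)
    gcongr <;> linarith
  constructor
  · refine JetBound.of_hasDerivAt (f1 := fun y => -Real.sin (φ y) * deriv φ y)
      (a2 := -Real.cos (φ x) * deriv φ x * deriv φ x + -Real.sin (φ x) * deriv (deriv φ) x)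
      (Eventually.of_forall fun y => (d1 y).cos)
      ((((d1 x).sin.fun_neg).fun_mul (d2 x)).congr_deriv (by ring)) ?_
    have := bd (-Real.cos (φ x)) (-Real.sin (φ x)) (by rwa [abs_neg]) (by rwa [abs_neg])
    rwa [abs_neg (Real.cos _)] at this
  · refine JetBound.of_hasDerivAt (f1 := fun y => Real.cos (φ y) * deriv φ y)
      (a2 := -Real.sin (φ x) * deriv φ x * deriv φ x + Real.cos (φ x) * deriv (deriv φ) x)
      (Eventually.of_forall fun y => (d1 y).sin)
      (((d1 x).cos.fun_mul (d2 x)).congr_deriv (by ring)) ?_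
    have := bd (-Real.sin (φ x)) (Real.cos (φ x)) (by rwa [abs_neg]) hc
    rwa [abs_neg (Real.sin _)] at this

namespace Sys

variable {S : Sys}

theorem a_one (x : ℝ) : S.a 1 x = S.lam := by simp [a, P_one]

theorem y_one : S.y 1 = fun _ => 0 := by funext x; simp [y, P_one]

theorem w_one : S.w 1 = fun _ => 0 := by funext x; simp [w, P_one]

theorem inJ_one (c : Bool → ℝ) {r : ℝ} (hr : 1 ≤ r) (x : ℝ) : InJ c r x :=
  ⟨true, by linarith [nd_le_half (x - c true)]⟩

theorem Exc.eq_one {c : Bool → ℝ} {z : ℝ} {k n : ℕ} (H : Exc S k c 1 z n) : n = 1 := by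
  by_contra hn
  have h1 := H.one_le
  exact H.inter 1 one_pos (by lia) (inJ_one c le_rfl _)

theorem nQ_zero_one (x : ℝ) : S.nQ 0 (fun _ => 1) x = rot (S.φ x) := by
  simp [nQ, Q, W, fwdIter]

theorem dyn_zero {d K : ℝ} (h1 : Differentiable ℝ S.φ) (h2 : Differentiable ℝ (deriv S.φ))
    (hK1 : ∀ x, |deriv S.φ x| ≤ K) (hK2 : ∀ x, |deriv (deriv S.φ) x| ≤ K) (hd0 : 0 < d)
    (hd1 : d ≤ 1) (hdK : 1 + d * K + d ^ 2 / 2 * (K ^ 2 + K) ≤ 1 / d) :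
    S.Dyn 0 1 d 1 (Real.log S.lam) 0 (fun _ => 0) (fun _ x => Real.cos (S.φ x))
      (fun _ => 1) := by
  have hcs := fun x => jetBound_cos_sin (x := x) h1 h2 hK1 hK2 hd0.le
  have hd5 : 1 / d ≤ 5 / d := by gcongr; norm_num
  refine ⟨fun x t ht _ _ => by simpa using ht, fun _ _ => one_ne_zero, fun x _ => ?_,
    fun x _ i j => ?_, fun z n H => ?_, fun b x i j _ hi hj => ?_, fun b x _ => ?_,
    fun _ => rfl, fun b x => ?_⟩
  · simpa using JetBound.const (h := d) (x := x) ((1 : ℝ)⁻¹)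
  · simp only [nQ_zero_one]
    fin_cases i <;> fin_cases j
    · exact (hcs x).1.mono hdK
    · exact (hcs x).2.neg.mono hdK
    · exact (hcs x).2.mono hdK
    · exact (hcs x).1.mono hdK
  · obtain rfl := H.eq_one
    have h0 : JetBound d (fun _ : ℝ => (0 : ℝ)) z (1 - d) :=
      (JetBound.const 0).mono (by simpa using hd1)
    refine ⟨by rw [a_one]; exact S.lam_pos.ne', ?_, by rwa [y_one], by rwa [w_one]⟩
    simp only [a_one]
    refine (JetBound.const _).mono ?_
    rw [abs_of_pos (inv_pos.2 S.lam_pos), Nat.cast_one, mul_one, Real.exp_neg,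
      Real.exp_log S.lam_pos]
  · obtain rfl := hi.eq_one
    obtain rfl := hj.eq_one
    have : (fun x => S.joint (S.nQ 0 fun _ => 1) 0 1 1 x - Real.cos (S.φ x)) =
        fun _ => (0 : ℝ) := by
      funext x
      simp [joint, y_one, w_one, nQ_zero_one, rot]
    rw [this]
    simpa using JetBound.const (h := d) (x := x) (0 : ℝ)
  · exact (hcs x).1.mono (hdK.trans hd5)
  · rw [S.periodic]

end Sys

/-! ### Phases with two nondegenerate critical points -/

/-- A periodic phase with one nondegenerate minimum `u`, one nondegenerate maximum `v`, and
no other critical point. -/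
structure Profile (ψ : ℝ → ℝ) (u v : ℝ) : Prop where
  diff : Differentiable ℝ ψ
  diff2 : Differentiable ℝ (deriv ψ)
  cont2 : Continuous (deriv (deriv ψ))
  periodic : Function.Periodic ψ 1
  lt : u < v
  lt' : v < u + 1
  ne : ∀ x ∈ Set.Ioo u v, deriv ψ x ≠ 0
  ne' : ∀ x ∈ Set.Ioo v (u + 1), deriv ψ x ≠ 0
  isMin : ∀ x, ψ u ≤ ψ x
  isMax : ∀ x, ψ x ≤ ψ v
  pos : 0 < deriv (deriv ψ) u
  neg : deriv (deriv ψ) v < 0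

theorem deriv_periodic {f : ℝ → ℝ} (hf : Function.Periodic f 1) :
    Function.Periodic (deriv f) 1 := fun x => by
  rw [← deriv_comp_add_const, funext hf]

theorem exists_abs_le_of_periodic {f : ℝ → ℝ} (hf : Function.Periodic f 1)
    (hc : Continuous f) : ∃ K, ∀ x, |f x| ≤ K := by
  obtain ⟨K, hK⟩ := isCompact_Icc.exists_bound_of_continuousOn (s := Set.Icc (0 : ℝ) 1)
    hc.continuousOn
  refine ⟨K, fun x => ?_⟩
  obtain ⟨y, hy, he⟩ := hf.exists_mem_Ico₀ one_pos x
  rw [he]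
  exact hK y ⟨hy.1, hy.2.le⟩

namespace Profile

variable {ψ : ℝ → ℝ} {u v : ℝ}

theorem reflect (H : Profile ψ u v) : Profile (fun x => -ψ x) v (u + 1) := by
  have e1 : deriv (fun x => -ψ x) = fun x => -deriv ψ x := by funext x; exact deriv.fun_neg
  have e2 : deriv (fun x => -deriv ψ x) = fun x => -deriv (deriv ψ) x := by
    funext x; exact deriv.fun_neg
  refine ⟨H.diff.fun_neg, by rw [e1]; exact H.diff2.fun_neg, by rw [e1, e2]; exact H.cont2.neg,
    fun x => by simp [H.periodic x], H.lt', by linarith [H.lt], fun x hx => ?_, fun x hx => ?_,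
    fun x => by linarith [H.isMax x], fun x => ?_, ?_, ?_⟩
  · rw [e1]; simpa using H.ne' x hx
  · rw [e1, neg_ne_zero, ← sub_add_cancel x 1, deriv_periodic H.periodic]
    exact H.ne _ ⟨by linarith [hx.1], by linarith [hx.2]⟩
  · rw [H.periodic u]; linarith [H.isMin x]
  · rw [e1, e2]; linarith [H.neg]
  · rw [e1, e2]
    simp only
    rw [deriv_periodic (deriv_periodic H.periodic)]
    linarith [H.pos]

theorem apply_lt (H : Profile ψ u v) : ψ u < ψ v := by
  refine (H.isMin v).lt_of_ne fun h => ?_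
  have hc : ψ = fun _ => ψ u := by
    funext x
    exact le_antisymm (h ▸ H.isMax x) (H.isMin x)
  have hlt := H.lt
  refine H.ne ((u + v) / 2) ⟨by linarith, by linarith⟩ ?_
  rw [hc, deriv_const]

theorem deriv_pos (H : Profile ψ u v) {x : ℝ} (hx : x ∈ Set.Ioo u v) : 0 < deriv ψ x := by
  obtain ⟨y, hy, he⟩ := exists_deriv_eq_slope ψ H.lt H.diff.continuous.continuousOn
    H.diff.differentiableOn
  have hy0 : 0 < deriv ψ y := by
    rw [he]
    exact div_pos (sub_pos.2 H.apply_lt) (sub_pos.2 H.lt)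
  by_contra! h
  obtain ⟨z, hz, hz0⟩ := isPreconnected_Ioo.intermediate_value hx hy
    H.diff2.continuous.continuousOn ⟨h, hy0.le⟩
  exact H.ne z hz hz0

theorem strictMonoOn (H : Profile ψ u v) : StrictMonoOn ψ (Set.Icc u v) :=
  strictMonoOn_of_deriv_pos (convex_Icc u v) H.diff.continuous.continuousOn fun x hx => by
    rw [interior_Icc] at hx
    exact H.deriv_pos hx

theorem lt_apply (H : Profile ψ u v) {x : ℝ} (hx : x ∈ Set.Ioo u (u + 1)) : ψ u < ψ x := by
  have h1 := H.lt
  have h2 := H.lt'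
  rcases le_total x v with h | h
  · exact H.strictMonoOn ⟨le_rfl, h1.le⟩ ⟨hx.1.le, h⟩ hx.1
  · have := H.reflect.strictMonoOn ⟨h, hx.2.le⟩ ⟨h2.le, le_rfl⟩ hx.2
    simp only [H.periodic u] at this
    linarith

theorem exists_gap (H : Profile ψ u v) {r : ℝ} (hr : 0 < r) :
    ∃ μ > 0, ∀ x, r ≤ nd (x - u) → ψ u + μ ≤ ψ x := by
  have hK : IsCompact (Set.Icc u (u + 1) ∩ {x | r ≤ nd (x - u)}) :=
    isCompact_Icc.inter_right
      (isClosed_le continuous_const (continuous_nd.comp (continuous_id.sub continuous_const)))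
  obtain ⟨μ, hμ, hh⟩ : ∃ μ > 0, ∀ x ∈ Set.Icc u (u + 1) ∩ {x | r ≤ nd (x - u)},
      ψ u + μ ≤ ψ x := by
    rcases (Set.Icc u (u + 1) ∩ {x | r ≤ nd (x - u)}).eq_empty_or_nonempty with h | h
    · exact ⟨1, one_pos, fun x hx => by rw [h] at hx; exact hx.elim⟩
    · obtain ⟨y, hy, hm⟩ := hK.exists_isMinOn h H.diff.continuous.continuousOn
      have hy2 : r ≤ nd (y - u) := hy.2
      have hne1 : y ≠ u := by
        rintro rfl
        simp [nd] at hy2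
        linarith
      have hne2 : y ≠ u + 1 := by
        rintro rfl
        have := nd_sub_int 1 1
        simp [nd] at hy2 this
        linarith
      have := H.lt_apply ⟨hy.1.1.lt_of_ne' hne1, hy.1.2.lt_of_ne hne2⟩
      exact ⟨ψ y - ψ u, by linarith, fun x hx => by linarith [isMinOn_iff.1 hm x hx]⟩
  refine ⟨μ, hμ, fun x hx => ?_⟩
  obtain ⟨m, hm⟩ : ∃ m : ℤ, x - m ∈ Set.Ico u (u + 1) := by
    obtain ⟨m, hm, -⟩ := existsUnique_sub_zsmul_mem_Ico one_pos x u
    exact ⟨m, by simpa using hm⟩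
  have hp : ψ (x - m) = ψ x := by simpa using H.periodic.sub_int_mul_eq m (x := x)
  rw [← hp]
  refine hh _ ⟨⟨hm.1, hm.2.le⟩, ?_⟩
  rw [Set.mem_ofPred_eq, sub_right_comm, nd_sub_int]
  exact hx

theorem exists_arc (H : Profile ψ u v) {δ L : ℝ} (hδ : 0 < δ) (hL0 : 0 < L)
    (hL : ∀ x, |deriv ψ x| ≤ L) : ∃ κ > 0, ∀ E, ψ u + δ ≤ E → E ≤ ψ v - δ →
      ∃ a ∈ Set.Ioo u v, ψ a = E ∧
        (∀ x, L * |x - a| ≤ δ / 2 → κ ≤ deriv ψ x ∧ |ψ x - E| ≤ δ / 2) ∧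
        ∀ x ∈ Set.Icc u v, |ψ x - E| ≤ δ / 2 → κ * |x - a| ≤ |ψ x - E| := by
  have hcont := H.diff.continuous
  have hK : IsCompact (Set.Icc u v ∩ {x | ψ u + δ / 2 ≤ ψ x ∧ ψ x ≤ ψ v - δ / 2}) :=
    isCompact_Icc.inter_right ((isClosed_le continuous_const hcont).inter
      (isClosed_le hcont continuous_const))
  obtain ⟨κ, hκ, hh⟩ : ∃ κ > 0, ∀ x ∈ Set.Icc u v, ψ u + δ / 2 ≤ ψ x → ψ x ≤ ψ v - δ / 2 →
      κ ≤ deriv ψ x := by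
    rcases (Set.Icc u v ∩ {x | ψ u + δ / 2 ≤ ψ x ∧ ψ x ≤ ψ v - δ / 2}).eq_empty_or_nonempty
      with h | h
    · refine ⟨1, one_pos, fun x hx h1 h2 => ?_⟩
      have : x ∈ Set.Icc u v ∩ {x | ψ u + δ / 2 ≤ ψ x ∧ ψ x ≤ ψ v - δ / 2} := ⟨hx, h1, h2⟩
      rw [h] at this
      exact this.elim
    · obtain ⟨y, hy, hm⟩ := hK.exists_isMinOn h H.diff2.continuous.continuousOn
      obtain ⟨hy1, hy2, hy3⟩ := hy
      have hne1 : y ≠ u := by rintro rfl; linarith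
      have hne2 : y ≠ v := by rintro rfl; linarith
      exact ⟨deriv ψ y, H.deriv_pos ⟨hy1.1.lt_of_ne' hne1, hy1.2.lt_of_ne hne2⟩,
        fun x hx h1 h2 => isMinOn_iff.1 hm x ⟨hx, h1, h2⟩⟩
  have hlip : ∀ x y, |ψ x - ψ y| ≤ L * |x - y| := fun x y =>
    abs_sub_le_of_abs_deriv_le (fun z _ => H.diff z) (fun z _ => hL z)
  refine ⟨κ, hκ, fun E h1 h2 => ?_⟩
  obtain ⟨a, ha, haE⟩ := intermediate_value_Icc H.lt.le hcont.continuousOn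
    (show E ∈ Set.Icc (ψ u) (ψ v) from ⟨by linarith, by linarith⟩)
  have hau : u < a := ha.1.lt_of_ne (by rintro rfl; linarith)
  have hav : a < v := ha.2.lt_of_ne (by rintro rfl; linarith)
  refine ⟨a, ⟨hau, hav⟩, haE, fun x hx => ?_, fun x hx hxE => ?_⟩
  · have hxE := (hlip x a).trans hx
    rw [haE] at hxE
    refine ⟨?_, hxE⟩
    rw [abs_le] at hxE
    refine hh x ⟨?_, ?_⟩ (by linarith) (by linarith)
    · have := hlip a u
      rw [abs_of_nonneg (by linarith), abs_of_pos (sub_pos.2 hau)] at this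
      have h4 : L * (a - u) ≥ δ := by linarith
      have h5 : L * (a - x) ≤ δ / 2 :=
        (mul_le_mul_of_nonneg_left (by rw [abs_sub_comm]; exact le_abs_self _) hL0.le).trans hx
      by_contra! h6
      have : L * (a - u) < L * (a - x) := by gcongr
      linarith
    · have := hlip v a
      rw [abs_of_nonneg (by linarith), abs_of_pos (sub_pos.2 hav)] at this
      have h4 : L * (v - a) ≥ δ := by linarith
      have h5 : L * (x - a) ≤ δ / 2 :=
        (mul_le_mul_of_nonneg_left (le_abs_self _) hL0.le).trans hx
      by_contra! h6
      have : L * (v - a) < L * (x - a) := by gcongr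
      linarith
  · rw [abs_le] at hxE
    have hm := H.strictMonoOn.monotoneOn
    rcases le_total a x with hax | hax
    · rw [abs_of_nonneg (sub_nonneg.2 hax)]
      have := mul_sub_le_of_le_deriv (f := ψ) (v := κ) hax (fun z _ => H.diff z) fun z hz => by
        have hz' : z ∈ Set.Icc u v := ⟨ha.1.trans hz.1, hz.2.trans hx.2⟩
        have e1 := hm ha hz' hz.1
        have e2 := hm hz' hx hz.2
        exact hh z hz' (by linarith) (by linarith)
      exact this.trans (by rw [haE]; exact le_abs_self _)
    · rw [abs_of_nonpos (sub_nonpos.2 hax)]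
      have := mul_sub_le_of_le_deriv (f := ψ) (v := κ) hax (fun z _ => H.diff z) fun z hz => by
        have hz' : z ∈ Set.Icc u v := ⟨hx.1.trans hz.1, hz.2.trans ha.2⟩
        have e1 := hm hx hz' hz.1
        have e2 := hm hz' ha hz.2
        exact hh z hz' (by linarith) (by linarith)
      rw [neg_sub]
      exact this.trans (by rw [haE, abs_sub_comm]; exact le_abs_self _)

end Profile

/-! ### Shapes at the initial scale -/

theorem mul_le_sin_of_le_pi_sub {δ g : ℝ} (hδ : 0 < δ) (hδ' : δ ≤ π) (h0 : 0 ≤ g)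
    (h1 : g ≤ π - δ) : 2 * δ / π ^ 2 * g ≤ Real.sin g := by
  have hpi := Real.pi_pos
  rcases le_total g (π / 2) with h | h
  · refine le_trans ?_ (Real.mul_le_sin h0 h)
    have : 2 * δ / π ^ 2 ≤ 2 / π := by
      rw [div_le_div_iff₀ (by positivity) hpi]
      nlinarith
    gcongr
  · rw [← Real.sin_pi_sub]
    refine le_trans ?_ (Real.mul_le_sin (by linarith) (by linarith))
    calc 2 * δ / π ^ 2 * g ≤ 2 * δ / π ^ 2 * π := by gcongr; linarith
      _ = 2 / π * δ := by field_simp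
      _ ≤ _ := by gcongr; linarith

theorem mul_abs_le_abs_sin {δ g : ℝ} (hδ : 0 < δ) (hδ' : δ ≤ π) (h1 : |g| ≤ π - δ) :
    2 * δ / π ^ 2 * |g| ≤ |Real.sin g| := by
  rcases le_total 0 g with h | h
  · rw [abs_of_nonneg h] at h1 ⊢
    exact (mul_le_sin_of_le_pi_sub hδ hδ' h h1).trans (le_abs_self _)
  · rw [abs_of_nonpos h] at h1 ⊢
    rw [← abs_neg (Real.sin g), ← Real.sin_neg]
    exact (mul_le_sin_of_le_pi_sub hδ hδ' (by linarith) h1).trans (le_abs_self _)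

theorem exists_cos_add_eq (θ : ℝ) (j : ℤ) :
    ∃ s : ℝ, |s| = 1 ∧ ∀ t, Real.cos (t + θ) = s * Real.sin (t - (π / 2 + j * π - θ)) := by
  refine ⟨-(-1) ^ j, by simp, fun t => ?_⟩
  have h1 : t - (π / 2 + j * π - θ) = (t + θ - π / 2) - j * π := by ring
  rw [h1, Real.sin_sub_int_mul_pi, Real.sin_sub_pi_div_two]
  have : ((-1 : ℝ) ^ j) * (-1) ^ j = 1 := by rw [← mul_zpow]; simp
  linear_combination (-Real.cos (t + θ)) * this

theorem hasDerivAt_sin_phase {ψ : ℝ → ℝ} (h1 : Differentiable ℝ ψ) (s E x : ℝ) :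
    HasDerivAt (fun x => s * Real.sin (ψ x - E)) (s * (Real.cos (ψ x - E) * deriv ψ x)) x :=
  ((h1 x).hasDerivAt.sub_const E).sin.const_mul s

theorem deriv_deriv_sin_phase {ψ : ℝ → ℝ} (h1 : Differentiable ℝ ψ)
    (h2 : Differentiable ℝ (deriv ψ)) (s E x : ℝ) :
    deriv (deriv fun x => s * Real.sin (ψ x - E)) x =
      s * (-Real.sin (ψ x - E) * deriv ψ x ^ 2 + Real.cos (ψ x - E) * deriv (deriv ψ) x) := by
  have : deriv (fun x => s * Real.sin (ψ x - E)) =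
      fun x => s * (Real.cos (ψ x - E) * deriv ψ x) :=
    funext fun y => (hasDerivAt_sin_phase h1 s E y).deriv
  rw [this]
  refine HasDerivAt.deriv ?_
  refine ((((h1 x).hasDerivAt.sub_const E).cos.mul (h2 x).hasDerivAt).const_mul s).congr_deriv ?_
  ring

theorem half_le_cos {g : ℝ} (hg : |g| ≤ 1) : 1 / 2 ≤ Real.cos g := by
  have := Real.one_sub_sq_div_two_le_cos (x := g)
  have h2 : g ^ 2 ≤ 1 := by rw [← sq_abs]; nlinarith [abs_nonneg g]
  linarith

namespace Profile

variable {ψ : ℝ → ℝ} {u v : ℝ}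

theorem exists_shape_min (H : Profile ψ u v) {δ : ℝ} {p : ℕ} (hp : 2 ≤ p) (hδ : 0 < δ)
    (hδ1 : δ ≤ 1 / 2) (hosc : ψ v - ψ u + 2 * δ ≤ π) :
    ∃ η > 0, ∃ d₀ > 0, ∀ d, 0 < d → d ≤ d₀ → ∀ s E : ℝ, |s| = 1 → ψ u - δ ≤ E → E ≤ ψ u + η →
      (∀ x, JetBound d (fun x => s * Real.sin (ψ x - E)) x (5 / d)) →
      ∃ c', CrossShape p d 1 (fun _ => 0) (fun _ x => s * Real.sin (ψ x - E)) c' ∨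
        TangentShape p d 1 (fun _ => 0) (fun _ x => s * Real.sin (ψ x - E)) c' := by
  have hκ := H.pos
  have hu0 : deriv ψ u = 0 := by
    refine IsLocalMin.deriv_eq_zero ?_
    exact Eventually.of_forall H.isMin
  set κ := deriv (deriv ψ) u with hκdef
  have ev : ∀ᶠ x in 𝓝 u, κ / 2 < deriv (deriv ψ) x ∧ deriv ψ x ^ 2 < κ / 8 ∧
      |ψ x - ψ u| < 1 / 2 := by
    have c1 : Tendsto (deriv (deriv ψ)) (𝓝 u) (𝓝 κ) := H.cont2.tendsto u
    have c2 : Tendsto (fun x => deriv ψ x ^ 2) (𝓝 u) (𝓝 0) := by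
      have := (show Continuous fun x => deriv ψ x ^ 2 from H.diff2.continuous.pow 2).tendsto u
      simpa [hu0] using this
    have c3 : Tendsto (fun x => |ψ x - ψ u|) (𝓝 u) (𝓝 0) := by
      have := ((H.diff.continuous.sub continuous_const).abs : Continuous fun x => |ψ x - ψ u|)
        |>.tendsto u
      simpa using this
    exact (c1.eventually_const_lt (by linarith)).and
      ((c2.eventually_lt_const (by positivity)).and (c3.eventually_lt_const (by norm_num)))
  obtain ⟨R, hR, hball⟩ := Metric.eventually_nhds_iff.1 ev
  set r := min (R / 2) (1 / 4) with hr
  have hr0 : 0 < r := by positivity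
  have hrR : r ≤ R / 2 := min_le_left _ _
  have hr4 : r ≤ 1 / 4 := min_le_right _ _
  obtain ⟨μ, hμ, hgap⟩ := H.exists_gap hr0
  have hη0 : 0 < min (μ / 2) (1 / 2) := by positivity
  have hpi := Real.pi_pos
  have huv := H.apply_lt
  refine ⟨min (μ / 2) (1 / 2), hη0,
    min (min (1 / 10000) r) (min (κ / 8) (2 * δ / π ^ 2 * (μ / 2))), by positivity,
    fun d hd0 hd s E hs hE1 hE2 hjet => ?_⟩
  simp only [le_min_iff] at hd
  obtain ⟨⟨hd1, hdr⟩, hdκ, hdμ⟩ := hd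
  have hE3 := hE2.trans (add_le_add_right (min_le_left _ _) _)
  have hE4 := hE2.trans (add_le_add_right (min_le_right _ _) _)
  have hss : s * s = 1 := by rw [← abs_mul_abs_self, hs, one_mul]
  have hout : ∀ x, r ≤ nd (x - u) → d ≤ s * (s * Real.sin (ψ x - E)) := fun x hx => by
    have h1 := hgap x hx
    have h2 := H.isMax x
    rw [← mul_assoc, hss, one_mul]
    have := mul_le_sin_of_le_pi_sub (δ := δ) (g := ψ x - E) hδ (by linarith) (by linarith)
      (by linarith)
    have h3 : 2 * δ / π ^ 2 * (μ / 2) ≤ 2 * δ / π ^ 2 * (ψ x - E) := by gcongr; linarith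
    linarith
  refine exists_shape hp hd0 hd1 hdr (by linarith) hs (c₀ := u)
    (fun x => by simp only [H.periodic x]) (fun x _ => hjet x) (fun x hx => ?_)
    (fun _ x _ hx => hout x hx) (fun x hx1 hx2 => hout x ?_)
    (fun _ x _ => (nd_le_half _).trans (by norm_num))
  · obtain ⟨h1, h2, h3⟩ := hball (y := x) (by rw [Real.dist_eq]; linarith)
    rw [deriv_deriv_sin_phase H.diff H.diff2, ← mul_assoc, hss, one_mul]
    rw [abs_lt] at h3
    have hc := half_le_cos (g := ψ x - E) (by rw [abs_le]; constructor <;> linarith [H.isMin x])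
    have hsn := Real.sin_le_one (ψ x - E)
    have hsq := sq_nonneg (deriv ψ x)
    have e1 : Real.sin (ψ x - E) * deriv ψ x ^ 2 ≤ 1 * deriv ψ x ^ 2 := by gcongr
    have e2 : 1 / 2 * (κ / 2) ≤ Real.cos (ψ x - E) * deriv (deriv ψ) x := by gcongr
    linarith
  · have hx3 : |x - u| ≤ 1 / 2 := by linarith
    rw [nd_eq, round_eq_zero_iff.2]
    · simpa using hx1
    · rw [abs_lt] at hx2
      constructor <;> linarith

end Profile

namespace Profile

variable {ψ : ℝ → ℝ} {u v : ℝ}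

theorem exists_shape_mid (H : Profile ψ u v) {δ η : ℝ} {p : ℕ} (hδ : 0 < δ)
    (hosc : ψ v - ψ u + 2 * δ ≤ π) (hη : 0 < η) (hη1 : η ≤ 1) :
    ∃ d₀ > 0, ∀ d, 0 < d → d ≤ d₀ → ∀ s E : ℝ, |s| = 1 → ψ u + η ≤ E → E ≤ ψ v - η →
      ∃ c', CrossShape p d 1 (fun _ => 0) (fun _ x => s * Real.sin (ψ x - E)) c' := by
  obtain ⟨L₀, hL₀⟩ := exists_abs_le_of_periodic (deriv_periodic H.periodic) H.diff2.continuous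
  have hL0 : 0 < L₀ + 1 := by linarith [(abs_nonneg _).trans (hL₀ 0)]
  set L := L₀ + 1 with hLdef
  have hL : ∀ x, |deriv ψ x| ≤ L := fun x => by linarith [hL₀ x]
  have e1 : deriv (fun x => -ψ x) = fun x => -deriv ψ x := by funext x; exact deriv.fun_neg
  obtain ⟨κ₁, hκ₁, h₁⟩ := H.exists_arc hη hL0 hL
  obtain ⟨κ₂, hκ₂, h₂⟩ := H.reflect.exists_arc hη hL0
    (fun x => by rw [e1]; simpa using hL x)
  have hpi := Real.pi_pos
  have huv := H.apply_lt
  set κ := min κ₁ κ₂ with hκ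
  have hκ0 : 0 < κ := lt_min hκ₁ hκ₂
  have hκ1 : κ ≤ κ₁ := min_le_left _ _
  have hκ2 : κ ≤ κ₂ := min_le_right _ _
  set q := 2 * δ / π ^ 2 with hq
  have hq0 : 0 < q := by positivity
  refine ⟨min (min 1 (κ / 2)) (min (η / (128 * L)) (min (q * (η / 2)) (q * κ))),
    by positivity, fun d hd0 hd s E hs hE1 hE2 => ?_⟩
  simp only [le_min_iff] at hd
  obtain ⟨⟨hd1, hdκ⟩, hdη, hdq, hdqκ⟩ := hd
  have hss : s * s = 1 := by rw [← abs_mul_abs_self, hs, one_mul]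
  have hpow : ∀ n, 1 ≤ n → d ^ n ≤ d := fun n hn => by
    simpa using pow_le_pow_of_le_one hd0.le hd1 hn
  obtain ⟨a, ha, haE, ha1, ha2⟩ := h₁ E hE1 hE2
  obtain ⟨b, hb, hbE, hb1, hb2⟩ := h₂ (-E) (by linarith) (by rw [H.periodic]; linarith)
  simp only [e1] at hb1
  have hsl : ∀ x c : ℝ, |x - c| ≤ 64 * d ^ (4 * p + 12) → L * |x - c| ≤ η / 2 := fun x c hx => by
    have h1 := hpow (4 * p + 12) (by lia)
    calc L * |x - c| ≤ L * (64 * (η / (128 * L))) := by gcongr; linarith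
      _ = η / 2 := by field_simp; ring
  have hsin : ∀ x, q * |ψ x - E| ≤ |Real.sin (ψ x - E)| := fun x => by
    have h1 := H.isMin x
    have h2 := H.isMax x
    refine mul_abs_le_abs_sin hδ (by linarith) ?_
    rw [abs_le]
    constructor <;> linarith
  have hder : ∀ x, deriv (fun x => s * Real.sin (ψ x - E)) x =
      s * (Real.cos (ψ x - E) * deriv ψ x) := fun x =>
    (hasDerivAt_sin_phase H.diff s E x).deriv
  have hpd : d ^ (2 * p + 2) ≤ 1 / 2 * κ := by linarith [hpow (2 * p + 2) (by lia)]
  have hfar : ∀ x c : ℝ, d ^ (4 * p + 12) ≤ |x - c| → κ * |x - c| ≤ |ψ x - E| →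
      d ^ (6 * p + 16) ≤ |Real.sin (ψ x - E)| := fun x c h1 h2 => by
    calc d ^ (6 * p + 16) ≤ d ^ (1 + (4 * p + 12)) :=
          pow_le_pow_of_le_one hd0.le hd1 (by lia)
      _ = d * d ^ (4 * p + 12) := by rw [pow_add, pow_one]
      _ ≤ q * κ * |x - c| := by gcongr
      _ = q * (κ * |x - c|) := by ring
      _ ≤ q * |ψ x - E| := by gcongr
      _ ≤ _ := hsin x
  refine ⟨fun t => if t then a else b, fun _ => (nd_le_half _).trans (by norm_num), ?_,
    ⟨fun t => if t then s else -s, ?_, ?_, ?_⟩, ?_⟩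
  · rintro (_ | _)
    · have : ψ b = E := by linarith
      simp [this]
    · simp [haE]
  · rintro (_ | _) <;> simp [hs]
  · simp [hss]
  · rintro (_ | _) x hx
    · simp only [Bool.false_eq_true, if_false] at hx ⊢
      obtain ⟨k1, k2⟩ := hb1 x (hsl x b hx)
      rw [hder]
      have hc := half_le_cos (g := ψ x - E) (by rw [← abs_neg, neg_sub]; rw [neg_sub_neg] at k2; linarith)
      have : 1 / 2 * κ ≤ Real.cos (ψ x - E) * -deriv ψ x := by gcongr; linarith
      have h3 : -s * (s * (Real.cos (ψ x - E) * deriv ψ x)) =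
          s * s * (Real.cos (ψ x - E) * -deriv ψ x) := by ring
      rw [h3, hss]
      linarith
    · simp only [if_true] at hx ⊢
      obtain ⟨k1, k2⟩ := ha1 x (hsl x a hx)
      rw [hder]
      have hc := half_le_cos (g := ψ x - E) (by linarith)
      have : 1 / 2 * κ ≤ Real.cos (ψ x - E) * deriv ψ x := by gcongr; linarith
      rw [← mul_assoc, hss]
      linarith
  · intro _ x _ hx
    rw [abs_mul, hs, one_mul]
    have hxa : d ^ (4 * p + 12) ≤ nd (x - a) := hx true
    have hxb : d ^ (4 * p + 12) ≤ nd (x - b) := hx false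
    obtain ⟨m, hm⟩ : ∃ m : ℤ, x - m ∈ Set.Ico u (u + 1) := by
      obtain ⟨m, hm, -⟩ := existsUnique_sub_zsmul_mem_Ico one_pos x u
      exact ⟨m, by simpa using hm⟩
    have hp : ψ (x - m) = ψ x := by simpa using H.periodic.sub_int_mul_eq m (x := x)
    have hshift : ∀ c, nd (x - c) ≤ |x - m - c| := fun c => by
      have := nd_le_abs_sub_int (x - c) m
      rwa [sub_right_comm] at this
    rw [← hp]
    rcases le_total (η / 2) |ψ (x - m) - E| with hbig | hsmall
    · calc d ^ (6 * p + 16) ≤ d := hpow _ (by lia)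
        _ ≤ q * (η / 2) := hdq
        _ ≤ q * |ψ (x - m) - E| := by gcongr
        _ ≤ _ := hsin _
    · rcases le_total (x - m) v with h | h
      · refine hfar _ a (hxa.trans (hshift a)) (le_trans ?_ (ha2 _ ⟨hm.1, h⟩ hsmall))
        gcongr
      · have hs' : |-ψ (x - m) - -E| = |ψ (x - m) - E| := by
          rw [neg_sub_neg, abs_sub_comm]
        have := hb2 (x - m) ⟨h, hm.2.le⟩ (by rwa [hs'])
        rw [hs'] at this
        refine hfar _ b (hxb.trans (hshift b)) (le_trans ?_ this)
        gcongr

theorem jet_weight_le {d K : ℝ} (hK : 0 ≤ K) (hd0 : 0 < d) (hd : d ≤ 1 / 10000)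
    (hdK : d ≤ 1 / (1 + K + K ^ 2)) : 1 + d * K + d ^ 2 / 2 * (K ^ 2 + K) ≤ 1 / d := by
  rw [le_div_iff₀ (by positivity)] at hdK
  have h3 : (3 : ℝ) ≤ 1 / d := by rw [le_div_iff₀ hd0]; linarith
  have h1 : 0 ≤ d * K := by positivity
  have h2 : 0 ≤ d * K ^ 2 := by positivity
  have h4 : d * (d * (K ^ 2 + K)) ≤ 1 * (d * (K ^ 2 + K)) := by gcongr; linarith
  nlinarith

theorem exists_stage (H : Profile ψ u v) {p : ℕ} (hp : 2 ≤ p) (hosc : ψ v - ψ u < π) :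
    ∃ δ > 0, ∃ d₀ > 0, ∀ d, 0 < d → d ≤ d₀ → ∀ (S : Sys) (θ : ℝ), S.φ = (fun x => ψ x + θ) →
      (∀ x, δ ≤ |Real.cos (S.φ x)|) ∨ Stage S p d 1 (Real.log S.lam) := by
  have hpi := Real.pi_pos
  have huv := H.apply_lt
  obtain ⟨K₁, hK₁⟩ := exists_abs_le_of_periodic (deriv_periodic H.periodic) H.diff2.continuous
  obtain ⟨K₂, hK₂⟩ := exists_abs_le_of_periodic (deriv_periodic (deriv_periodic H.periodic))
    H.cont2
  set K := max K₁ K₂ with hKdef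
  have hK1 : ∀ x, |deriv ψ x| ≤ K := fun x => (hK₁ x).trans (le_max_left _ _)
  have hK2 : ∀ x, |deriv (deriv ψ) x| ≤ K := fun x => (hK₂ x).trans (le_max_right _ _)
  have hK0 : 0 ≤ K := (abs_nonneg _).trans (hK1 0)
  set δ := min (1 / 2) ((π - (ψ v - ψ u)) / 2) with hδdef
  have hδ0 : 0 < δ := lt_min (by norm_num) (by linarith)
  have hδ1 : δ ≤ 1 / 2 := min_le_left _ _
  have hδ2 : δ ≤ (π - (ψ v - ψ u)) / 2 := min_le_right _ _
  obtain ⟨η₁, hη₁, d₁, hd₁, h₁⟩ := H.exists_shape_min hp hδ0 hδ1 (by linarith)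
  obtain ⟨η₂, hη₂, d₂, hd₂, h₂⟩ := H.reflect.exists_shape_min hp hδ0 hδ1
    (by rw [H.periodic]; linarith)
  obtain ⟨d₃, hd₃, h₃⟩ := H.exists_shape_mid (p := p) (η := min 1 (min η₁ η₂)) hδ0 (by linarith)
    (by positivity) (min_le_left _ _)
  refine ⟨2 / π * δ, by positivity,
    min (min (1 / 10000) (1 / (1 + K + K ^ 2))) (min d₁ (min d₂ d₃)), by positivity,
    fun d hd0 hd S θ hS => ?_⟩
  simp only [le_min_iff] at hd
  obtain ⟨⟨hd4, hdK⟩, hdd1, hdd2, hdd3⟩ := hd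
  by_cases hE : ∃ j : ℤ, ψ u - δ ≤ π / 2 + j * π - θ ∧ π / 2 + j * π - θ ≤ ψ v + δ
  · right
    obtain ⟨j, hj1, hj2⟩ := hE
    obtain ⟨s, hs, hcos⟩ := exists_cos_add_eq θ j
    set E := π / 2 + j * π - θ
    have hder : deriv S.φ = deriv ψ := by
      funext x
      rw [hS, deriv_add_const]
    have hD : Differentiable ℝ S.φ := by rw [hS]; exact H.diff.add_const θ
    have hw := jet_weight_le hK0 hd0 hd4 hdK
    have hdyn : S.Dyn 0 1 d 1 (Real.log S.lam) 0 (fun _ => 0) (fun _ x => Real.cos (S.φ x))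
        (fun _ => 1) :=
      Sys.dyn_zero hD (by rw [hder]; exact H.diff2) (by rwa [hder]) (by rwa [hder]) hd0
        (by linarith) hw
    have hF : (fun x => Real.cos (S.φ x)) = fun x => s * Real.sin (ψ x - E) := by
      funext x
      rw [hS]
      exact hcos _
    have hjet : ∀ x, JetBound d (fun x => s * Real.sin (ψ x - E)) x (5 / d) := fun x => by
      rw [← hF]
      exact hdyn.F_jet true x ((nd_le_half _).trans_lt (by norm_num))
    refine ⟨0, 1, 0, fun _ => 0, _, _, hdyn, by simp [hd0.le], by linarith, le_rfl,
      le_rfl, by positivity, ?_⟩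
    rw [hF]
    rcases le_total E (ψ u + η₁) with k1 | k1
    · exact h₁ d hd0 hdd1 s E hs hj1 k1 hjet
    · rcases le_total (ψ v - η₂) E with k2 | k2
      · have heq : (fun x => s * Real.sin (ψ x - E)) =
            fun x => -s * Real.sin (-ψ x - -E) := by
          funext x
          rw [show -ψ x - -E = -(ψ x - E) by ring, Real.sin_neg, neg_mul_neg]
        rw [heq]
        exact h₂ d hd0 hdd2 (-s) (-E) (by rwa [abs_neg]) (by linarith) (by linarith)
          (by rwa [← heq])
      · have hm1 : min 1 (min η₁ η₂) ≤ η₁ := (min_le_right _ _).trans (min_le_left _ _)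
        have hm2 : min 1 (min η₁ η₂) ≤ η₂ := (min_le_right _ _).trans (min_le_right _ _)
        obtain ⟨c', hc'⟩ := h₃ d hd0 hdd3 s E hs (by linarith) (by linarith)
        exact ⟨c', Or.inl hc'⟩
  · left
    intro x
    set j := round ((ψ x + θ - π / 2) / π) with hj
    obtain ⟨s, hs, hcos⟩ := exists_cos_add_eq θ j
    rw [hS]
    simp only
    rw [hcos, abs_mul, hs, one_mul]
    have h1 := abs_sub_round ((ψ x + θ - π / 2) / π)
    rw [← hj] at h1
    have h2 : |ψ x - (π / 2 + j * π - θ)| ≤ π / 2 := by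
      have : ψ x - (π / 2 + j * π - θ) = ((ψ x + θ - π / 2) / π - j) * π := by
        field_simp; ring
      rw [this, abs_mul, abs_of_pos hpi]
      calc _ ≤ 1 / 2 * π := by gcongr
        _ = _ := by ring
    have h3 : δ ≤ |ψ x - (π / 2 + j * π - θ)| := by
      by_contra! h
      rw [abs_lt] at h
      exact hE ⟨j, by linarith [H.isMin x], by linarith [H.isMax x]⟩
    refine le_trans ?_ (Real.mul_abs_le_abs_sin h2)
    gcongr

end Profile

/-! ### Growth along a subsequence -/

namespace Sys

variable (S : Sys)

theorem P_succ (n : ℕ) (x : ℝ) : S.P (n + 1) x = S.gen (x + n * S.α) * S.P n x := by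
  rw [P, P, W, W, fwdIter, Matrix.mul_assoc]

theorem a_growth_of_le_abs_cos {δ : ℝ} (hδ : 0 < δ) (h : ∀ x, δ ≤ |Real.cos (S.φ x)|)
    (hlam : 3 / δ ≤ S.lam) (x : ℝ) (n : ℕ) :
    (S.lam * (δ / 2)) ^ (n + 1) ≤ |S.P (n + 1) x 0 0| ∧
      |S.P (n + 1) x 1 0| ≤ δ / 2 * |S.P (n + 1) x 0 0| := by
  have hl := S.lam_pos
  have hδ1 : δ ≤ 1 := (h 0).trans (Real.abs_cos_le_one _)
  rw [div_le_iff₀ hδ] at hlam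
  induction n with
  | zero =>
    rw [zero_add, P_one]
    simp only [pow_one, diagonal_apply_eq, cons_val_zero, abs_of_pos hl, ne_eq, one_ne_zero,
      not_false_eq_true, diagonal_apply_ne, abs_zero]
    constructor
    · nlinarith
    · positivity
  | succ n ih =>
    obtain ⟨h1, h2⟩ := ih
    set A := S.P (n + 1) x 0 0
    set B := S.P (n + 1) x 1 0
    set f := S.φ (x + (n + 1 : ℕ) * S.α) with hf
    have e0 : S.P (n + 1 + 1) x 0 0 = S.lam * (Real.cos f * A - Real.sin f * B) := by
      rw [P_succ, gen, ← hf]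
      simp [Matrix.mul_apply, Fin.sum_univ_two, rot, A, B]
      ring
    have e1 : S.P (n + 1 + 1) x 1 0 = S.lam⁻¹ * (Real.sin f * A + Real.cos f * B) := by
      rw [P_succ, gen, ← hf]
      simp [Matrix.mul_apply, Fin.sum_univ_two, rot, A, B]
      ring
    have hc := h (x + (n + 1 : ℕ) * S.α)
    rw [← hf] at hc
    have hs1 := Real.abs_sin_le_one f
    have hc1 := Real.abs_cos_le_one f
    have k1 : S.lam * (δ / 2) * |A| ≤ |S.P (n + 1 + 1) x 0 0| := by
      rw [e0, abs_mul, abs_of_pos hl, mul_assoc]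
      gcongr
      have := abs_sub_abs_le_abs_sub (Real.cos f * A) (Real.sin f * B)
      rw [abs_mul, abs_mul] at this
      have k2 : δ * |A| ≤ |Real.cos f| * |A| := by gcongr
      have k3 : |Real.sin f| * |B| ≤ 1 * (δ / 2 * |A|) := by gcongr
      linarith
    have k2 : |S.P (n + 1 + 1) x 1 0| ≤ S.lam⁻¹ * (2 * |A|) := by
      rw [e1, abs_mul, abs_of_pos (inv_pos.2 hl)]
      gcongr
      have := abs_add_le (Real.sin f * A) (Real.cos f * B)
      rw [abs_mul, abs_mul] at this
      have k2 : |Real.sin f| * |A| ≤ 1 * |A| := by gcongr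
      have k3 : |Real.cos f| * |B| ≤ 1 * (1 * |A|) := by
        gcongr
        exact h2.trans (by gcongr; linarith)
      linarith
    refine ⟨?_, ?_⟩
    · rw [pow_succ']
      refine le_trans ?_ k1
      gcongr
    · refine k2.trans (le_trans ?_ (mul_le_mul_of_nonneg_left k1 (by positivity)))
      have : S.lam⁻¹ * 2 ≤ δ / 2 * (S.lam * (δ / 2)) := by
        rw [inv_mul_le_iff₀ hl]
        nlinarith
      nlinarith [abs_nonneg A]

theorem exists_growth_of_le_abs_cos {δ G : ℝ} (hδ : 0 < δ)
    (h : ∀ x, δ ≤ |Real.cos (S.φ x)|) (hlam : 3 / δ ≤ S.lam)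
    (hG : Real.exp G ≤ S.lam * (δ / 2)) (N : ℕ) :
    ∃ n z, N ≤ n ∧ Real.exp (G * n) ≤ |S.a n z| := by
  refine ⟨N + 1, 0, by lia, ?_⟩
  rw [mul_comm, Real.exp_nat_mul]
  refine le_trans ?_ (S.a_growth_of_le_abs_cos hδ h hlam 0 N).1
  gcongr

end Sys

theorem le_nd_of_dcWith {τ γ α : ℝ} (hγ : 0 < γ) (H : DCwith τ γ α) {t : ℕ} (ht : 1 ≤ t) :
    γ / (t : ℝ) ^ ⌈τ⌉₊ ≤ nd (t * α) := by
  have ht1 : (1 : ℝ) ≤ t := by exact_mod_cast ht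
  have ht0 : (0 : ℝ) < t := by linarith
  have h1 := H (round (t * α)) t (by exact_mod_cast (by lia : t ≠ 0))
  rw [Int.cast_natCast, abs_of_pos ht0] at h1
  have h2 : nd (t * α) = t * |α - (round (t * α) : ℝ) / t| := by
    rw [nd_eq, ← abs_of_pos ht0, ← abs_mul, abs_of_pos ht0]
    congr 1
    field_simp
  have h3 : (t : ℝ) ^ τ ≤ (t : ℝ) ^ ⌈τ⌉₊ := by
    rw [← Real.rpow_natCast]
    exact Real.rpow_le_rpow_of_exponent_le ht1 (Nat.le_ceil τ)
  have h4 : γ / (t : ℝ) ^ ⌈τ⌉₊ ≤ γ / (t : ℝ) ^ τ := by gcongr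
  rw [h2]
  nlinarith [abs_nonneg (α - (round (t * α) : ℝ) / t)]

theorem exists_le_nd_of_dc {τ α : ℝ} (H : DC τ α) : ∃ d₀ > 0, ∀ D, 0 < D → D ≤ d₀ →
    ∀ t : ℕ, 1 ≤ t → (t : ℝ) ≤ 4 / D → 64 * D ^ (⌈τ⌉₊ + 2) ≤ nd (t * α) := by
  obtain ⟨γ, hγ, H⟩ := H
  refine ⟨min 1 (γ / (64 * 4 ^ ⌈τ⌉₊)), by positivity, fun D hD0 hD t ht htD => ?_⟩
  simp only [le_min_iff] at hD
  refine le_trans ?_ (le_nd_of_dcWith hγ H ht)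
  have ht0 : (0 : ℝ) < t := by exact_mod_cast ht
  have h1 : γ / (4 / D) ^ ⌈τ⌉₊ ≤ γ / (t : ℝ) ^ ⌈τ⌉₊ := by gcongr
  refine le_trans ?_ h1
  rw [div_pow, div_div_eq_mul_div, le_div_iff₀ (by positivity)]
  have h2 := hD.2
  rw [le_div_iff₀ (by positivity)] at h2
  have h3 : D * D ≤ D * 1 := by gcongr; exact hD.1
  calc 64 * D ^ (⌈τ⌉₊ + 2) * 4 ^ ⌈τ⌉₊ = D * D * (64 * 4 ^ ⌈τ⌉₊) * D ^ ⌈τ⌉₊ := by ring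
    _ ≤ D * 1 * (64 * 4 ^ ⌈τ⌉₊) * D ^ ⌈τ⌉₊ := by gcongr
    _ ≤ γ * D ^ ⌈τ⌉₊ := by rw [mul_one]; gcongr

theorem Profile.exists_growth {ψ : ℝ → ℝ} {u v τ α : ℝ} (H : Profile ψ u v)
    (hosc : ψ v - ψ u < π) (hα : DC τ α) :
    ∃ C, ∀ (S : Sys) (θ : ℝ), S.α = α → S.φ = (fun x => ψ x + θ) → C ≤ Real.log S.lam →
      ∀ N : ℕ, ∃ n z, N ≤ n ∧ Real.exp (199 / 200 * Real.log S.lam * n) ≤ |S.a n z| := by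
  obtain ⟨d₁, hd₁, hdio⟩ := exists_le_nd_of_dc hα
  set p := ⌈τ⌉₊ + 2 with hp
  have hp2 : 2 ≤ p := by lia
  obtain ⟨δ, hδ, d₂, hd₂, hst⟩ := H.exists_stage hp2 hosc
  obtain ⟨d, hd0, hd⟩ : ∃ d : ℝ, 0 < d ∧ d ≤ min (min d₁ d₂) (min (1 / 10000)
      (1 / ((12 * p + 40) * (accExp p + (6 * p + 24)) + 1).factorial)) :=
    ⟨_, by positivity, le_rfl⟩
  simp only [le_min_iff] at hd
  obtain ⟨⟨hdd1, hdd2⟩, hd1, hdfac⟩ := hd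
  set A := accExp p + (6 * p + 24)
  refine ⟨max (max (200 * (lossConst p + Real.log (4 / d ^ (6 * p + 16)))) 2)
    (max (200 / 199 * -Real.log (d ^ A)) (max (Real.log (3 / δ)) (200 * -Real.log (δ / 2)))),
    fun S θ hSα hSφ hC N => ?_⟩
  simp only [max_le_iff] at hC
  obtain ⟨⟨c1, c2⟩, c3, c4, c5⟩ := hC
  have hl := S.lam_pos
  rcases hst d hd0 hdd2 S θ hSφ with hU | hS
  · refine S.exists_growth_of_le_abs_cos hδ hU ((Real.log_le_log_iff (by positivity) hl).1 c4)
      ?_ N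
    rw [← Real.le_log_iff_exp_le (by positivity), Real.log_mul hl.ne' (by positivity)]
    linarith
  · refine Stage.growth hS hp2 hd0 hd1 hdfac (fun D h0 h1 t ht htD => ?_) (by linarith) ?_
      (by linarith) N
    · rw [hSα]
      exact hdio D h0 (h1.trans hdd1) t ht htD
    · rw [← Real.le_log_iff_exp_le (by positivity)]
      linarith

/-! ### Uniform equidistribution of irrational rotations -/

/-- The Birkhoff averages of `F` under the rotation by `β` converge uniformly to its mean. -/
def UnifAvg (β : ℝ) (F : UnitAddCircle → ℂ) : Prop :=
  ∀ ε > 0, ∃ Q : ℕ, ∀ q : ℕ, Q ≤ q → ∀ z : ℝ,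
    ‖∑ l ∈ Finset.range q, F ((z + l * β : ℝ) : UnitAddCircle) -
      q * ∫ x in (0 : ℝ)..1, F (x : UnitAddCircle)‖ ≤ ε * q

theorem unifAvg_fourier {β : ℝ} (hβ : Irrational β) (n : ℤ) :
    UnifAvg β (fourier n : C(UnitAddCircle, ℂ)) := by
  intro ε hε
  have hfe : ∀ x : ℝ, (fourier n : C(UnitAddCircle, ℂ)) (x : UnitAddCircle) =
      Complex.exp (2 * π * Complex.I * n * x) := fun x => by
    rw [fourier_coe_apply]; simp
  simp only [hfe]
  rcases eq_or_ne n 0 with rfl | hn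
  · refine ⟨0, fun q _ z => ?_⟩
    simp
    positivity
  have hn' : (n : ℂ) ≠ 0 := by exact_mod_cast hn
  have hc : 2 * π * Complex.I * n ≠ 0 := by
    simp [Real.pi_ne_zero, hn]
  have hint : ∫ x in (0 : ℝ)..1, Complex.exp (2 * π * Complex.I * n * x) = 0 := by
    rw [integral_exp_mul_complex hc]
    have : Complex.exp (2 * π * Complex.I * n * (1 : ℝ)) = 1 := by
      rw [Complex.exp_eq_one_iff]
      exact ⟨n, by push_cast; ring⟩
    simp only [this]
    simp
  set w := Complex.exp (2 * π * Complex.I * n * β) with hw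
  have hw1 : w ≠ 1 := by
    intro h
    rw [hw, Complex.exp_eq_one_iff] at h
    obtain ⟨m, hm⟩ := h
    have h2 : (n : ℂ) * β = m := by
      have : (2 * π * Complex.I) ≠ 0 := by simp [Real.pi_ne_zero]
      refine mul_left_cancel₀ this ?_
      linear_combination hm
    have h3 : (n : ℝ) * β = m := by exact_mod_cast h2
    exact (hβ.intCast_mul hn).ne_int m h3
  have hwn : ‖w‖ = 1 := by
    rw [hw, show 2 * π * Complex.I * n * β = ((2 * π * n * β : ℝ) : ℂ) * Complex.I by
      push_cast; ring]
    exact Complex.norm_exp_ofReal_mul_I _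
  have hd : 0 < ‖w - 1‖ := norm_pos_iff.2 (sub_ne_zero.2 hw1)
  obtain ⟨Q, hQ⟩ := exists_nat_ge (2 / ‖w - 1‖ / ε)
  refine ⟨Q, fun q hq z => ?_⟩
  rw [hint, mul_zero, sub_zero]
  have hsum : ∑ l ∈ Finset.range q, Complex.exp (2 * π * Complex.I * n * ((z + l * β : ℝ) : ℂ)) =
      Complex.exp (2 * π * Complex.I * n * z) * ((w ^ q - 1) / (w - 1)) := by
    rw [← geom_sum_eq hw1, Finset.mul_sum]
    refine Finset.sum_congr rfl fun l _ => ?_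
    rw [hw, ← Complex.exp_nat_mul, ← Complex.exp_add]
    congr 1
    push_cast
    ring
  have hzn : ‖Complex.exp (2 * π * Complex.I * n * z)‖ = 1 := by
    rw [show 2 * π * Complex.I * n * z = ((2 * π * n * z : ℝ) : ℂ) * Complex.I by
      push_cast; ring]
    exact Complex.norm_exp_ofReal_mul_I _
  rw [hsum, norm_mul, hzn, one_mul, norm_div]
  have h2 : ‖w ^ q - 1‖ ≤ 2 := by
    refine (norm_sub_le _ _).trans ?_
    rw [norm_pow, hwn]
    norm_num
  have h3 : ‖w ^ q - 1‖ / ‖w - 1‖ ≤ 2 / ‖w - 1‖ := by gcongr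
  have h4 : (Q : ℝ) ≤ q := by exact_mod_cast hq
  have h5 := hQ.trans h4
  rw [div_le_iff₀ hε] at h5
  linarith

theorem UnifAvg.add {β : ℝ} {F G : C(UnitAddCircle, ℂ)} (hF : UnifAvg β F) (hG : UnifAvg β G) :
    UnifAvg β (F + G : C(UnitAddCircle, ℂ)) := by
  intro ε hε
  obtain ⟨Q₁, h₁⟩ := hF (ε / 2) (by positivity)
  obtain ⟨Q₂, h₂⟩ := hG (ε / 2) (by positivity)
  have cF : Continuous fun x : ℝ => F (x : UnitAddCircle) :=
    F.continuous.comp (AddCircle.continuous_mk' 1)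
  have cG : Continuous fun x : ℝ => G (x : UnitAddCircle) :=
    G.continuous.comp (AddCircle.continuous_mk' 1)
  refine ⟨max Q₁ Q₂, fun q hq z => ?_⟩
  have e1 := h₁ q ((le_max_left _ _).trans hq) z
  have e2 := h₂ q ((le_max_right _ _).trans hq) z
  simp only [ContinuousMap.add_apply]
  rw [intervalIntegral.integral_add (cF.intervalIntegrable _ _) (cG.intervalIntegrable _ _),
    Finset.sum_add_distrib, mul_add, add_sub_add_comm]
  refine (norm_add_le _ _).trans ?_
  linarith

theorem UnifAvg.smul {β : ℝ} {F : C(UnitAddCircle, ℂ)} (hF : UnifAvg β F) (c : ℂ) :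
    UnifAvg β (c • F : C(UnitAddCircle, ℂ)) := by
  intro ε hε
  obtain ⟨Q, h⟩ := hF (ε / (‖c‖ + 1)) (by positivity)
  refine ⟨Q, fun q hq z => ?_⟩
  have e1 := h q hq z
  simp only [ContinuousMap.smul_apply, smul_eq_mul]
  rw [intervalIntegral.integral_const_mul, ← Finset.mul_sum, mul_left_comm, ← mul_sub, norm_mul]
  calc _ ≤ (‖c‖ + 1) * (ε / (‖c‖ + 1) * q) := by
        gcongr
        linarith
    _ = ε * q := by field_simp

theorem UnifAvg.of_dense {β : ℝ} {F : C(UnitAddCircle, ℂ)}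
    (h : ∀ ε > 0, ∃ G : C(UnitAddCircle, ℂ), ‖F - G‖ ≤ ε ∧ UnifAvg β G) : UnifAvg β F := by
  intro ε hε
  obtain ⟨G, hFG, hG⟩ := h (ε / 3) (by positivity)
  obtain ⟨Q, hQ⟩ := hG (ε / 3) (by positivity)
  have cF : Continuous fun x : ℝ => F (x : UnitAddCircle) :=
    F.continuous.comp (AddCircle.continuous_mk' 1)
  have cG : Continuous fun x : ℝ => G (x : UnitAddCircle) :=
    G.continuous.comp (AddCircle.continuous_mk' 1)
  have hpt : ∀ x, ‖F x - G x‖ ≤ ε / 3 := fun x => ((F - G).norm_coe_le_norm x).trans hFG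
  refine ⟨Q, fun q hq z => ?_⟩
  have e1 := hQ q hq z
  have e2 : ‖∑ l ∈ Finset.range q, F ((z + l * β : ℝ) : UnitAddCircle) -
      ∑ l ∈ Finset.range q, G ((z + l * β : ℝ) : UnitAddCircle)‖ ≤ q * (ε / 3) := by
    rw [← Finset.sum_sub_distrib]
    refine (norm_sum_le_of_le _ fun l _ => hpt _).trans ?_
    simp
  have e3 : ‖(∫ x in (0 : ℝ)..1, F (x : UnitAddCircle)) -
      ∫ x in (0 : ℝ)..1, G (x : UnitAddCircle)‖ ≤ ε / 3 := by
    rw [← intervalIntegral.integral_sub (cF.intervalIntegrable _ _) (cG.intervalIntegrable _ _)]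
    refine (intervalIntegral.norm_integral_le_of_norm_le_const fun x _ => hpt _).trans ?_
    simp
  set a := ∑ l ∈ Finset.range q, F ((z + l * β : ℝ) : UnitAddCircle)
  set b := ∑ l ∈ Finset.range q, G ((z + l * β : ℝ) : UnitAddCircle)
  set s := ∫ x in (0 : ℝ)..1, F (x : UnitAddCircle)
  set t := ∫ x in (0 : ℝ)..1, G (x : UnitAddCircle)
  have e4 : ‖(q : ℂ) * (s - t)‖ ≤ q * (ε / 3) := by
    rw [norm_mul, Complex.norm_natCast]
    gcongr
  calc ‖a - q * s‖ = ‖(a - b) + (b - q * t) - q * (s - t)‖ := by congr 1; ring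
    _ ≤ ‖a - b‖ + ‖b - q * t‖ + ‖q * (s - t)‖ :=
      (norm_sub_le _ _).trans (add_le_add_left (norm_add_le _ _) _)
    _ ≤ _ := by linarith

theorem unifAvg_of_irrational {β : ℝ} (hβ : Irrational β) (F : C(UnitAddCircle, ℂ)) :
    UnifAvg β F := by
  refine UnifAvg.of_dense fun ε hε => ?_
  have hF : F ∈ (Submodule.span ℂ (Set.range (fourier (T := 1)))).topologicalClosure := by
    rw [span_fourier_closure_eq_top]
    trivial
  rw [← SetLike.mem_coe, Submodule.topologicalClosure_coe, Metric.mem_closure_iff] at hF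
  obtain ⟨G, hG, hFG⟩ := hF ε hε
  refine ⟨G, by rw [← dist_eq_norm]; exact hFG.le, ?_⟩
  have hG' : G ∈ Submodule.span ℂ (Set.range (fourier (T := 1))) := hG
  clear hFG hG
  induction hG' using Submodule.span_induction with
  | mem G h =>
    obtain ⟨n, rfl⟩ := h
    exact unifAvg_fourier hβ n
  | zero =>
    intro ε hε
    refine ⟨0, fun q _ z => ?_⟩
    simp
    positivity
  | add _ _ _ _ h1 h2 => exact h1.add h2
  | smul c _ _ h => exact h.smul c

theorem exists_sum_le_of_irrational {β : ℝ} (hβ : Irrational β) {g : ℝ → ℝ}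
    (hg : Continuous g) (hp : Function.Periodic g 1) {ε : ℝ} (hε : 0 < ε) :
    ∃ Q : ℕ, ∀ q : ℕ, Q ≤ q → ∀ z : ℝ,
      ∑ l ∈ Finset.range q, g (z + l * β) ≤ q * ((∫ x in (0 : ℝ)..1, g x) + ε) := by
  have hc : Continuous (fun y : UnitAddCircle => ((hp.lift y : ℝ) : ℂ)) :=
    Complex.continuous_ofReal.comp (continuous_coinduced_dom.2 hg)
  obtain ⟨Q, hQ⟩ := unifAvg_of_irrational hβ ⟨_, hc⟩ ε hε
  refine ⟨Q, fun q hq z => ?_⟩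
  have := hQ q hq z
  simp only [ContinuousMap.coe_mk, Function.Periodic.lift_coe] at this
  rw [intervalIntegral.integral_ofReal, ← Complex.ofReal_sum, ← Complex.ofReal_natCast,
    ← Complex.ofReal_mul, ← Complex.ofReal_sub, Complex.norm_real, Real.norm_eq_abs] at this
  linarith [le_abs_self (∑ l ∈ Finset.range q, g (z + l * β) - q * ∫ x in (0 : ℝ)..1, g x)]

/-- A subadditive cocycle over an irrational rotation whose growth rate is at least `G` along
some sequence of orbit segments has mean at least `G`. -/
theorem mul_le_integral_of_frequently {α G : ℝ} (hα : Irrational α) (hG : 0 ≤ G)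
    {f : ℕ → ℝ → ℝ} (hf : ∀ n, Continuous (f n)) (hp : ∀ n, Function.Periodic (f n) 1)
    (hsub : ∀ m n x, f (m + n) x ≤ f m (x + n * α) + f n x)
    (h : ∀ N : ℕ, ∃ n z, N ≤ n ∧ G * n ≤ f n z) {m : ℕ} (hm : m ≠ 0) :
    G * m ≤ ∫ x in (0 : ℝ)..1, f m x := by
  have hm0 : 0 < m := hm.bot_lt
  refine le_of_forall_pos_le_add fun ε hε => ?_
  obtain ⟨C, hC⟩ : ∃ C, ∀ r < m, ∀ x, f r x ≤ C := by
    choose K hK using fun n => exists_abs_le_of_periodic (hp n) (hf n)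
    refine ⟨∑ r ∈ Finset.range m, |K r|, fun r hr x => ?_⟩
    exact ((le_abs_self _).trans ((hK r x).trans (le_abs_self _))).trans
      (Finset.single_le_sum (f := fun r => |K r|) (fun _ _ => abs_nonneg _)
        (Finset.mem_range.2 hr))
  obtain ⟨Q, hQ⟩ := exists_sum_le_of_irrational (hα.natCast_mul hm) (hf m) (hp m)
    (ε := ε / 2) (by positivity)
  have hblock : ∀ q r x, f (r + q * m) x ≤
      f r (x + q * (m * α)) + ∑ l ∈ Finset.range q, f m (x + l * (m * α)) := by
    intro q r
    induction q with
    | zero => intro x; simp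
    | succ q ih =>
      intro x
      have e1 := hsub (r + q * m) m x
      have e2 := ih (x + m * α)
      rw [Finset.sum_range_succ']
      have e3 : ∀ l : ℕ, x + (l + 1 : ℕ) * (m * α) = x + m * α + l * (m * α) := fun l => by
        push_cast; ring
      simp only [e3, Nat.cast_zero, zero_mul, add_zero]
      rw [show r + (q + 1) * m = r + q * m + m by ring]
      linarith
  obtain ⟨Q', hQ'⟩ := exists_nat_ge (C / (ε / 2))
  obtain ⟨n, z, hn, hz⟩ := h ((Q + Q' + 1) * m)
  have hq : Q + Q' + 1 ≤ n / m := (Nat.le_div_iff_mul_le hm0).2 hn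
  set q := n / m with hqdef
  have hnq : n % m + q * m = n := by rw [mul_comm]; exact Nat.mod_add_div n m
  have h1 := hblock q (n % m) z
  rw [hnq] at h1
  have h2 := hC (n % m) (Nat.mod_lt _ hm0) (z + q * (m * α))
  have h3 := hQ q (by lia) z
  have hq0 : (0 : ℝ) < q := by exact_mod_cast (by lia : 0 < q)
  have hCq : C ≤ q * (ε / 2) := by
    rw [div_le_iff₀ (by positivity)] at hQ'
    have : (Q' : ℝ) ≤ q := by exact_mod_cast (by lia : Q' ≤ q)
    exact hQ'.trans (by gcongr)
  have hnq' : (q : ℝ) * m ≤ n := by exact_mod_cast Nat.div_mul_le_self n m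
  have h4 : G * (q * m) ≤ G * n := by gcongr
  refine le_of_mul_le_mul_left ?_ hq0
  linarith

/-! ### The operator norm -/

theorem opNorm_mul_le (A B : M2) : opNorm (A * B) ≤ opNorm A * opNorm B := by
  rw [opNorm, map_mul]
  exact norm_mul_le _ _

theorem opNorm_pos {A : M2} (hA : A.det = 1) : 0 < opNorm A := by
  rw [opNorm, norm_pos_iff, ne_eq, map_eq_zero_iff _ (EquivLike.injective _)]
  rintro rfl
  simp at hA

theorem continuous_opNorm : Continuous opNorm :=
  ((Matrix.toEuclideanCLM (n := Fin 2) (𝕜 := ℝ)).toAlgEquiv.toLinearMap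
    |>.continuous_of_finiteDimensional).norm

theorem abs_apply_zero_le_opNorm (A : M2) : |A 0 0| ≤ opNorm A := by
  have h1 := (Matrix.toEuclideanCLM (𝕜 := ℝ) A).le_opNorm (EuclideanSpace.single 0 1)
  rw [PiLp.norm_single, norm_one, mul_one] at h1
  have h2 := PiLp.norm_apply_le (Matrix.toEuclideanCLM (𝕜 := ℝ) A (EuclideanSpace.single 0 1)) 0
  refine le_trans (le_of_eq ?_) (h2.trans h1)
  simp

theorem opNorm_rot (θ : ℝ) : opNorm (rot θ) = 1 := by
  have h1 : star (rot θ) * rot θ = 1 := by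
    ext i j
    fin_cases i <;> fin_cases j <;>
      simp [rot, Matrix.mul_apply, Fin.sum_univ_two, Matrix.star_apply, ← sq] <;> ring
  have h2 := CStarRing.norm_star_mul_self (x := Matrix.toEuclideanCLM (𝕜 := ℝ) (rot θ))
  rw [← map_star, ← map_mul, h1, map_one, norm_one] at h2
  change (1 : ℝ) = opNorm (rot θ) * opNorm (rot θ) at h2
  have h3 : 0 ≤ opNorm (rot θ) := norm_nonneg _
  nlinarith

/-! ### The Lyapunov exponent -/

theorem deriv_deriv_pos_of_isMin {f : ℝ → ℝ} {x : ℝ} (hf : Continuous f)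
    (hmin : ∀ y, f x ≤ f y) (hne : deriv (deriv f) x ≠ 0) : 0 < deriv (deriv f) x := by
  by_contra! h
  have hlt := h.lt_of_ne hne
  have h0 : deriv f x = 0 := IsLocalMin.deriv_eq_zero (Eventually.of_forall hmin)
  have hmax := isLocalMax_of_deriv_deriv_neg hlt h0 hf.continuousAt
  have hc : f =ᶠ[𝓝 x] fun _ => f x := hmax.mono fun y hy => le_antisymm hy (hmin y)
  refine hne ?_
  rw [hc.deriv.deriv_eq]
  simp

theorem exists_profile_of_conditionV {ψ : ℝ → ℝ} (hper : Function.Periodic ψ 1)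
    (hV : ConditionV ψ) (hosc : (⨆ x, ψ x) - (⨅ x, ψ x) < π) :
    ∃ u v, Profile ψ u v ∧ ψ v - ψ u < π := by
  obtain ⟨hC, z₁, z₂, h₁, h₂, hne, hcrit, hmin, hmax, hd₁, hd₂⟩ := hV
  have hsum : ψ z₂ - ψ z₁ < π := by
    have e1 : ψ z₂ ≤ ⨆ x, ψ x := le_ciSup ⟨ψ z₂, by rintro _ ⟨x, rfl⟩; exact hmax x⟩ z₂
    have e2 : ⨅ x, ψ x ≤ ψ z₁ := ciInf_le ⟨ψ z₁, by rintro _ ⟨x, rfl⟩; exact hmin x⟩ z₁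
    linarith
  have hdiff : Differentiable ℝ ψ := hC.differentiable (by norm_num)
  have hC1 : ContDiff ℝ 1 (deriv ψ) := by
    have : ContDiff ℝ (1 + 1) ψ := by simpa [one_add_one_eq_two] using hC
    exact (contDiff_succ_iff_deriv.1 this).2.2
  have hdiff2 : Differentiable ℝ (deriv ψ) := hC1.differentiable (by norm_num)
  have hcont2 : Continuous (deriv (deriv ψ)) := hC1.continuous_deriv (by norm_num)
  have hit : iteratedDeriv 2 ψ = deriv (deriv ψ) := by
    rw [iteratedDeriv_succ, iteratedDeriv_one]
  rw [hit] at hd₁ hd₂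
  obtain ⟨e, hv1, hv2⟩ : ∃ e : ℤ, z₁ < z₂ + e ∧ z₂ + e < z₁ + 1 := by
    rcases hne.lt_or_gt with h | h
    · exact ⟨0, by simpa using h, by simpa using by linarith [h₁.1, h₂.2]⟩
    · exact ⟨1, by push_cast; linarith [h₁.2, h₂.1], by push_cast; linarith⟩
  have hshift : ∀ {f : ℝ → ℝ}, Function.Periodic f 1 → f (z₂ + e) = f z₂ := fun hf => by
    simpa using hf.int_mul e z₂
  have hcrit' : ∀ x, deriv ψ x = 0 → ∃ m : ℤ, x = z₁ + m ∨ x = z₂ + m := fun x hx => by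
    have hfr : deriv ψ (Int.fract x) = 0 := by
      rw [← hx, Int.fract]
      simpa using (deriv_periodic hper).sub_int_mul_eq ⌊x⌋ (x := x)
    have := (hcrit _ ⟨Int.fract_nonneg x, Int.fract_lt_one x⟩).1 hfr
    have hx' := Int.fract_add_floor x
    refine ⟨⌊x⌋, this.imp (fun h => ?_) fun h => ?_⟩ <;> rw [← h, hx']
  have hne' : ∀ x, z₁ < x → x < z₁ + 1 → x ≠ z₂ + e → deriv ψ x ≠ 0 := fun x h1 h2 h3 h4 => by
    obtain ⟨m, rfl | rfl⟩ := hcrit' x h4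
    · have k1 : (0 : ℝ) < m := by linarith
      have k2 : (m : ℝ) < 1 := by linarith
      have k3 : 0 < m := by exact_mod_cast k1
      have k4 : m < 1 := by exact_mod_cast k2
      lia
    · have k1 : (m : ℝ) < e + 1 := by linarith
      have k2 : (e : ℝ) < m + 1 := by linarith
      have k3 : m < e + 1 := by exact_mod_cast k1
      have k4 : e < m + 1 := by exact_mod_cast k2
      exact h3 (by rw [show m = e by lia])
  refine ⟨z₁, z₂ + e, ⟨hdiff, hdiff2, hcont2, hper, hv1, hv2,
    fun x hx => hne' x hx.1 (by linarith [hx.2]) hx.2.ne,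
    fun x hx => hne' x (by linarith [hx.1]) hx.2 hx.1.ne', hmin,
    fun x => by rw [hshift hper]; exact hmax x,
    deriv_deriv_pos_of_isMin hdiff.continuous hmin hd₁, ?_⟩, by rwa [hshift hper]⟩
  rw [hshift (deriv_periodic (deriv_periodic hper))]
  have e1 : deriv (fun x => -ψ x) = fun x => -deriv ψ x := by funext x; exact deriv.fun_neg
  have e2 : deriv (fun x => -deriv ψ x) = fun x => -deriv (deriv ψ) x := by
    funext x; exact deriv.fun_neg
  have := deriv_deriv_pos_of_isMin (f := fun x => -ψ x) (x := z₂) hdiff.continuous.neg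
    (fun y => neg_le_neg (hmax y)) (by rw [e1, e2]; simpa using hd₂)
  rw [e1, e2] at this
  simpa using this

theorem irrational_of_dc {τ α : ℝ} (H : DC τ α) : Irrational α := by
  obtain ⟨γ, hγ, H⟩ := H
  rintro ⟨r, rfl⟩
  have h1 := H r.num r.den (by exact_mod_cast r.den_nz)
  have h2 : (r : ℝ) = (r.num : ℝ) / ((r.den : ℤ) : ℝ) := by
    rw [Int.cast_natCast]
    exact_mod_cast (Rat.num_div_den r).symm
  rw [← h2, sub_self, abs_zero] at h1
  have h3 : 0 < γ / |((r.den : ℤ) : ℝ)| ^ τ := by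
    have : (0 : ℝ) < |((r.den : ℤ) : ℝ)| := by
      rw [Int.cast_natCast, abs_pos]
      exact_mod_cast r.den_nz
    positivity
  linarith

namespace Sys

variable (S : Sys)

/-- The logarithm of the norm of the iterates. -/
def logNorm (n : ℕ) (x : ℝ) : ℝ := Real.log (opNorm (S.W n x))

theorem logNorm_periodic (n : ℕ) : Function.Periodic (S.logNorm n) 1 := fun x => by
  rw [logNorm, logNorm, S.W_periodic]

theorem continuous_W (hφ : Continuous S.φ) (n : ℕ) : Continuous (S.W n) := by
  induction n with
  | zero => exact continuous_const
  | succ n ih =>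
    have hg : Continuous S.gen := by
      refine continuous_const.matrix_mul ?_
      refine continuous_matrix fun i j => ?_
      fin_cases i <;> fin_cases j <;> simp [rot] <;> fun_prop
    exact (hg.comp (continuous_id.add continuous_const)).matrix_mul ih

theorem continuous_logNorm (hφ : Continuous S.φ) (n : ℕ) : Continuous (S.logNorm n) :=
  (continuous_opNorm.comp (S.continuous_W hφ n)).log fun x => (opNorm_pos (S.det_W n x)).ne'

theorem logNorm_add_le (m n : ℕ) (x : ℝ) :
    S.logNorm (m + n) x ≤ S.logNorm m (x + n * S.α) + S.logNorm n x := by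
  rw [logNorm, logNorm, logNorm, ← Real.log_mul (opNorm_pos (S.det_W _ _)).ne'
    (opNorm_pos (S.det_W _ _)).ne']
  refine Real.log_le_log (opNorm_pos (S.det_W _ _)) ?_
  rw [W_add]
  exact opNorm_mul_le _ _

theorem abs_a_le (n : ℕ) (x : ℝ) : |S.a n x| ≤ opNorm (S.W n x) := by
  refine (abs_apply_zero_le_opNorm _).trans ((opNorm_mul_le _ _).trans ?_)
  rw [opNorm_rot, mul_one]

theorem subadditive_integral_logNorm (hφ : Continuous S.φ) :
    Subadditive fun n => ∫ x in (0 : ℝ)..1, S.logNorm n x := fun m n => by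
  have hm := S.continuous_logNorm hφ m
  have hm' : Continuous fun x => S.logNorm m (x + n * S.α) :=
    hm.comp (continuous_id.add continuous_const)
  have hn := S.continuous_logNorm hφ n
  have hshift : ∫ x in (0 : ℝ)..1, S.logNorm m (x + n * S.α) =
      ∫ x in (0 : ℝ)..1, S.logNorm m x := by
    rw [intervalIntegral.integral_comp_add_right, zero_add, add_comm 1]
    simpa using (S.logNorm_periodic m).intervalIntegral_add_eq (n * S.α) 0
  beta_reduce
  rw [← hshift, ← intervalIntegral.integral_add (hm'.intervalIntegrable _ _)
    (hn.intervalIntegrable _ _)]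
  exact intervalIntegral.integral_mono_on zero_le_one
    ((S.continuous_logNorm hφ _).intervalIntegrable _ _)
    ((hm'.add hn).intervalIntegrable _ _) fun x _ => S.logNorm_add_le m n x

/-- The Lyapunov exponent exists and is at least the growth rate of the iterates along any
sequence of orbit segments. -/
theorem exists_tendsto_of_growth (hα : Irrational S.α) (hφ : Continuous S.φ) {G : ℝ}
    (hG : 0 ≤ G) (h : ∀ N : ℕ, ∃ n z, N ≤ n ∧ Real.exp (G * n) ≤ |S.a n z|) :
    ∃ L, G ≤ L ∧ Tendsto (fun n : ℕ => 1 / (n : ℝ) * ∫ x in (0 : ℝ)..1, S.logNorm n x)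
      atTop (𝓝 L) := by
  have hlow : ∀ m : ℕ, m ≠ 0 → G ≤ (∫ x in (0 : ℝ)..1, S.logNorm m x) / m := fun m hm => by
    rw [le_div_iff₀ (by exact_mod_cast hm.bot_lt)]
    refine mul_le_integral_of_frequently hα hG (S.continuous_logNorm hφ) S.logNorm_periodic
      S.logNorm_add_le (fun N => ?_) hm
    obtain ⟨n, z, hn, hz⟩ := h N
    exact ⟨n, z, hn, (Real.le_log_iff_exp_le (opNorm_pos (S.det_W _ _))).2
      (hz.trans (S.abs_a_le n z))⟩
  have hsub := S.subadditive_integral_logNorm hφ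
  have ht := hsub.tendsto_lim ⟨0, by
    rintro _ ⟨m, rfl⟩
    rcases eq_or_ne m 0 with rfl | hm
    · simp
    · exact hG.trans (hlow m hm)⟩
  refine ⟨_, ge_of_tendsto ht ((eventually_ne_atTop 0).mono hlow), ht.congr fun n => ?_⟩
  rw [one_div_mul_eq_div]

end Sys

end LargeCoupling

open LargeCoupling

/-- For α ∈ DC_τ (τ > 2) and ψ satisfying condition (V) with sup ψ - inf ψ < π, for all
large λ and every θ the Lyapunov exponent L(α,θ,λ) = lim (1/n)∫ log‖B^{(θ,λ)}_n(x)‖ dx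
exists and exceeds (99/100)·log λ. -/
theorem lyapunov_exponent_large (τ α : ℝ) (hτ : 2 < τ) (hα : DC τ α)
    (ψ : ℝ → ℝ) (hper : Function.Periodic ψ 1) (hV : ConditionV ψ)
    (hosc : (⨆ x, ψ x) - (⨅ x, ψ x) < π) :
    ∃ lam₀ > (0 : ℝ), ∀ lam > lam₀, ∀ θ : ℝ, ∃ L : ℝ,
      Filter.Tendsto
        (fun n : ℕ => (1 / (n : ℝ)) *
          ∫ x in (0 : ℝ)..1, Real.log (opNorm (cocycleIter α (rotFamily lam θ ψ) n x)))
        Filter.atTop (nhds L) ∧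
      99 / 100 * Real.log lam < L := by
  obtain ⟨u, v, H, huv⟩ := exists_profile_of_conditionV hper hV hosc
  obtain ⟨C, hC⟩ := H.exists_growth huv hα
  refine ⟨Real.exp (max C 1), Real.exp_pos _, fun lam hlam θ => ?_⟩
  have hl : 0 < lam := (Real.exp_pos _).trans hlam
  have hlog : max C 1 ≤ Real.log lam := (Real.le_log_iff_exp_le hl).2 hlam.le
  rw [max_le_iff] at hlog
  let S : Sys := ⟨α, lam, fun x => ψ x + θ, hl, fun x => by simp only [hper x]⟩
  obtain ⟨L, hGL, hL⟩ := S.exists_tendsto_of_growth (irrational_of_dc hα)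
    (H.diff.continuous.add continuous_const) (G := 199 / 200 * Real.log lam) (by linarith)
    (hC S θ rfl rfl hlog.1)
  have hgen : rotFamily lam θ ψ = S.gen := by
    funext x
    rw [rotFamily, Matrix.mul_assoc, rot_mul_rot]
    rfl
  refine ⟨L, hL.congr fun n => ?_, by linarith⟩
  simp only [cocycleIter, Int.natCast_nonneg, if_true, Int.toNat_natCast, hgen]
  rfl
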